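/- Let d ∈ {1,2}. Suppose: f ∈ C_d; {θ_m}_{m∈ℕ} is a sequence of periodic orbits of f and f is ready for operation on ∪_m θ_m; {χ_m}_{m∈ℕ} ⊆ C_d; for each m, {θ_ℓ^m}_ℓ is a sequence of periodic orbits of χ_m and χ_m is ready for operation on ∪_ℓ θ_ℓ^m; {ξ_m} are natural numbers with 1 ≤ ξ_m ≤ |θ_m|; and sup_m (ξ_m/|θ_m|)·h_top(χ_m) < ∞. Let Q = ∪_{m,k≥0} f^{−k}(θ_m) with enumeration {q_k}_{k∈ℕ}. Then there exist maps F : 𝔻 → 𝔻 and π : 𝔻 → 𝔻, a sequence {K_i}_{i≥0} of pairwise disjoint compact subsets of 𝔻, and C^∞ diffeomorphisms φ_m : 𝔻 × {0,…,|θ_m|−1} → K_m such that, writing L_k = π^{−1}({q_k}): (1) F ∈ C_d; (2) π is continuous, surjective, and π∘F = f∘π; (3) π(K_m) = θ_m for each m ≥ 1, each L_k is C^∞ diffeomorphic to 𝔻, π is injective on 𝔻 ∖ ∪_k L_k, and K_m ⊆ ∪_{q_k ∈ θ_m} int(L_k); (4) F(K_i) = K_i for each i, K_0 = 𝔻 ∖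 ∪_k int(L_k), and ∪_k ∂L_k is F-invariant; (5) NW(F) ⊆ ∪_{i≥0} K_i; (6) for every ν ∈ M(K_0 ∖ ∪_k ∂L_k, F), π is a measure-theoretic isomorphism between (F,ν) and (f, π_*ν); (7) φ_m is a topological conjugacy between F|_{K_m} and the (|θ_m|, ξ_m) tower over χ_m; (8) ∩_{n≥1} closure(∪_{m≥n} M(K_m,F)) equals the preimage under the pushforward map π_* : M(𝔻,F) → M(𝔻,f) of ∩_{n≥1} closure({μ_{θ_m} : m ≥ n}), this set is contained in M(K_0 ∖ ∪_k ∂L_k, F), and π_* maps it homeomorphically onto ∩_{n≥1} closure({μ_{θ_m} : m ≥ n}); (9) F is ready for operation on ∪_{m,ℓ} φ_m(θ_ℓ^m × {0,…,|θ_m|−1}); and (10) h_top(F) = max( h_top(f), sup_m (ξ_m/|θ_m|)·h_top(χ_m) ). -/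

import Mathlib

open Filter Topology Set MeasureTheory
open scoped ENNReal

section Dynamics

variable {X : Type*}

/-- `x` is a periodic point of `T` with minimal period `n`; its orbit is then a periodic
orbit of cardinality `n`. -/
def IsPeriodicOrbitPt (T : X → X) (x : X) (n : ℕ) : Prop :=
  0 < n ∧ T^[n] x = x ∧ ∀ j, 0 < j → j < n → T^[j] x ≠ x

/-- The orbit `{x, Tx, …, T^{n-1}x}` of a periodic point. -/
def orbitSet (T : X → X) (x : X) (n : ℕ) : Set X := (fun i => T^[i] x) '' Set.Iio n

/-- The uniform measure `μ_θ = (1/n) ∑_{i<n} δ_{T^i x}` on the orbit of a periodic point. -/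
noncomputable def orbitMeasure [MeasurableSpace X] (T : X → X) (x : X) (n : ℕ) :
    Measure X :=
  ((max n 1 : ℕ) : ℝ≥0∞)⁻¹ • ∑ i ∈ Finset.range (max n 1), Measure.dirac (T^[i] x)

lemma orbitMeasure_isProbability [MeasurableSpace X] (T : X → X) (x : X) (n : ℕ) :
    IsProbabilityMeasure (orbitMeasure T x n) := by
  constructor
  have hpos : 0 < max n 1 := lt_of_lt_of_le one_pos (le_max_right n 1)
  have hne : ((max n 1 : ℕ) : ℝ≥0∞) ≠ 0 := by
    exact_mod_cast Nat.pos_iff_ne_zero.mp hpos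
  rw [orbitMeasure, Measure.smul_apply, Measure.finset_sum_apply]
  simp only [measure_univ, Finset.sum_const, Finset.card_range, nsmul_eq_mul, mul_one,
    smul_eq_mul]
  exact ENNReal.inv_mul_cancel hne (ENNReal.natCast_ne_top _)

/-- The uniform measure on the orbit of a periodic point, as a probability measure
(for `n ≥ 1` this is `μ_θ` for the orbit `θ` of `x` of cardinality `n`). -/
noncomputable def orbitProb [MeasurableSpace X] (T : X → X) (x : X) (n : ℕ) :
    ProbabilityMeasure X :=
  ⟨orbitMeasure T x n, orbitMeasure_isProbability T x n⟩

/-- The `(n,p)` tower map over `T` on `X × {0, …, n-1}`: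
`S(x,i) = (x, i+1)` for `i < n-1` and `S(x, n-1) = (T^p x, 0)`. -/
def towerMap (T : X → X) (n p : ℕ) : X × Fin n → X × Fin n := fun z =>
  if h : (z.2 : ℕ) + 1 < n then (z.1, ⟨(z.2 : ℕ) + 1, h⟩)
  else (T^[p] z.1, ⟨0, Nat.lt_of_le_of_lt (Nat.zero_le _) z.2.isLt⟩)

/-- The map `ψ : M(Y,S) → M(X,T)` associated to an `(n,p)` tower:
`ψ(μ) = (1/p) ∑_{i<p} (T^i)_*((proj_X)_*(n·μ|_{X×{0}}))`. -/
noncomputable def towerAssoc [MeasurableSpace X] (T : X → X) (n p : ℕ)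
    (μ : Measure (X × Fin n)) : Measure X :=
  (p : ℝ≥0∞)⁻¹ • ∑ i ∈ Finset.range p,
    (((n : ℝ≥0∞) • μ.restrict {z : X × Fin n | (z.2 : ℕ) = 0}).map Prod.fst).map (T^[i])

/-- The nonwandering set of a self-map `F` of a topological space. -/
def nonwanderingSet [TopologicalSpace X] (F : X → X) : Set X :=
  {x | ∀ U : Set X, IsOpen U → x ∈ U → ∃ n ≥ 1, (F^[n] '' U ∩ U).Nonempty}

end Dynamics

open Dynamics

section DiscMaps

/-- The closed unit disc `𝔻` in `ℝ^d`. -/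
def unitDisc (d : ℕ) : Set (EuclideanSpace ℝ (Fin d)) := Metric.closedBall 0 1

/-- The class `𝒞_d` of self-maps of the closed unit disc `𝔻 ⊆ ℝ^d`: continuous
surjections (homeomorphisms when `d = 2`) restricting to the identity on `∂𝔻` and of
finite topological entropy. -/
structure MemCd (d : ℕ) (f : EuclideanSpace ℝ (Fin d) → EuclideanSpace ℝ (Fin d)) :
    Prop where
  mapsTo : Set.MapsTo f (unitDisc d) (unitDisc d)
  contOn : ContinuousOn f (unitDisc d)
  surjOn : f '' unitDisc d = unitDisc d
  injOn_of_dim2 : d = 2 → Set.InjOn f (unitDisc d)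
  boundary_id : Set.EqOn f id (Metric.sphere 0 1)
  entropy_lt_top : coverEntropy f (unitDisc d) < ⊤

/-- The complete preimage `Q = ∪_{k ≥ 0} f^{-k}(S)` of a set `S`. -/
def preimageSat {X : Type*} (f : X → X) (S : Set X) : Set X := {y | ∃ k : ℕ, f^[k] y ∈ S}

/-- `f` is ready for operation on the union of the periodic orbits `θ_m` (given by
periodic points `xper m` of minimal period `per m`), cf. Definition `readyForOpDef`:
(1) every weak* limit point `ν` of the orbit measures `μ_{θ_m}` gives the union of the
orbits measure zero; (2) the complete preimage `Q` of the union of the orbits is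
countable and contained in the interior of `𝔻`; (3) `f` is differentiable at each point
of `Q` with invertible derivative, of positive determinant when `d = 2`. -/
structure ReadyForOperation (d : ℕ)
    (f : EuclideanSpace ℝ (Fin d) → EuclideanSpace ℝ (Fin d))
    (xper : ℕ → EuclideanSpace ℝ (Fin d)) (per : ℕ → ℕ) : Prop where
  periodic : ∀ m, IsPeriodicOrbitPt f (xper m) (per m)
  limit_null : ∀ ν : ProbabilityMeasure (EuclideanSpace ℝ (Fin d)),
    ν ∈ ⋂ N : ℕ, closure ((fun m => orbitProb f (xper m) (per m)) '' Set.Ici N) →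
    (ν : MeasureTheory.Measure (EuclideanSpace ℝ (Fin d)))
      (⋃ m, orbitSet f (xper m) (per m)) = 0
  countable : (preimageSat f (⋃ m, orbitSet f (xper m) (per m))).Countable
  subset_int : preimageSat f (⋃ m, orbitSet f (xper m) (per m)) ⊆ interior (unitDisc d)
  deriv : ∀ x ∈ preimageSat f (⋃ m, orbitSet f (xper m) (per m)),
    ∃ A : EuclideanSpace ℝ (Fin d) →L[ℝ] EuclideanSpace ℝ (Fin d),
      HasFDerivAt f A x ∧
      (∃ B : EuclideanSpace ℝ (Fin d) →L[ℝ] EuclideanSpace ℝ (Fin d),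
        A.comp B = ContinuousLinearMap.id ℝ _ ∧ B.comp A = ContinuousLinearMap.id ℝ _) ∧
      (d = 2 → 0 < LinearMap.det (A : EuclideanSpace ℝ (Fin d) →ₗ[ℝ] EuclideanSpace ℝ (Fin d)))

end DiscMaps

/-- Shorthand for `ℝ^d`. -/
abbrev Eucl (d : ℕ) := EuclideanSpace ℝ (Fin d)

/-- The nonwandering set of a self-map `F` of a subset `D` of a topological space. -/
def nonwanderingOn {Y : Type*} [TopologicalSpace Y] (F : Y → Y) (D : Set Y) : Set Y :=
  {x ∈ D | ∀ U : Set Y, IsOpen U → x ∈ U → ∃ n ≥ 1, ∃ y ∈ U ∩ D, F^[n] y ∈ U ∩ D}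

open Filter Topology Set MeasureTheory Dynamics
open scoped ENNReal

section Geometry

open scoped InnerProductSpace

structure QD (d : ℕ) where
  q : ℕ → Eucl d
  inj : Function.Injective q
  lt : ∀ k, ‖q k‖ < 1

namespace QD

variable {d : ℕ} (Q : QD d)

noncomputable def R (k : ℕ) : ℝ := 1 - ‖Q.q k‖
noncomputable def a (k : ℕ) : ℝ := (1/2) ^ (k+2) * Q.R k

lemma R_pos (k) : 0 < Q.R k := by have := Q.lt k; unfold R; linarith
lemma R_le (k) : Q.R k ≤ 1 := by have := norm_nonneg (Q.q k); unfold R; linarith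
lemma a_pos (k) : 0 < Q.a k := mul_pos (by positivity) (Q.R_pos k)
lemma a_le (k) : Q.a k ≤ (1/2) ^ (k+2) := by
  unfold a; exact mul_le_of_le_one_right (by positivity) (Q.R_le k)
lemma hasSum_half : HasSum (fun k : ℕ => ((1:ℝ)/2) ^ (k+2)) (1/2) := by
  have h := (hasSum_geometric_of_lt_one (r := (1:ℝ)/2) (by norm_num) (by norm_num)).mul_left
    (((1:ℝ)/2)^2)
  have e : (fun k : ℕ => ((1:ℝ)/2) ^ (k+2)) = fun i => ((1:ℝ)/2)^2 * (1/2)^i := by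
    ext k; ring
  have e2 : ((1:ℝ)/2)^2*(1-1/2)⁻¹ = 1/2 := by norm_num
  rw [e2] at h; rw [e]; exact h
lemma summable_a : Summable Q.a :=
  Summable.of_nonneg_of_le (fun k => (Q.a_pos k).le) Q.a_le hasSum_half.summable

noncomputable def u (k : ℕ) (x : Eucl d) : Eucl d :=
  (Q.a k * max 0 (‖x - Q.q k‖⁻¹ - (Q.R k)⁻¹)) • (x - Q.q k)

lemma u_self (k) : Q.u k (Q.q k) = 0 := by simp [u]

lemma norm_u_le (k) (x) : ‖Q.u k x‖ ≤ Q.a k := by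
  have ha := Q.a_pos k
  unfold u
  rw [norm_smul, Real.norm_of_nonneg (by positivity), mul_assoc]
  refine mul_le_of_le_one_right ha.le ?_
  rcases (norm_nonneg (x - Q.q k)).eq_or_lt with h | h
  · rw [← h]; simp
  · rw [max_mul_of_nonneg _ _ h.le, sub_mul, inv_mul_cancel₀ h.ne']
    have : 0 ≤ (Q.R k)⁻¹ * ‖x - Q.q k‖ := mul_nonneg (inv_nonneg.2 (Q.R_pos k).le) h.le
    simp; linarith

lemma continuousAt_u (k) {x : Eucl d} (h : x ≠ Q.q k) : ContinuousAt (Q.u k) x := by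
  have : ‖x - Q.q k‖ ≠ 0 := by simpa [sub_eq_zero] using h
  unfold u
  fun_prop (disch := assumption)

lemma u_far (k) {x : Eucl d} (h : 1 ≤ ‖x‖) : Q.u k x = 0 := by
  have h1 : Q.R k ≤ ‖x - Q.q k‖ := by
    have := norm_sub_norm_le x (Q.q k); unfold R; linarith
  have h2 : ‖x - Q.q k‖⁻¹ ≤ (Q.R k)⁻¹ := inv_anti₀ (Q.R_pos k) h1
  simp [u, max_eq_left (sub_nonpos.2 h2)]

def U (k : ℕ) (x v : Eucl d) : Prop := ‖v‖ ≤ Q.a k ∧ (x ≠ Q.q k → v = Q.u k x)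

lemma U_u (k x) : Q.U k x (Q.u k x) := ⟨Q.norm_u_le k x, fun _ => rfl⟩

lemma mono_aux {a r : ℝ} (ha : 0 < a) {p p' v v' : Eucl d}
    (h1 : ‖v‖ ≤ a) (h2 : p ≠ 0 → v = (a * max 0 (‖p‖⁻¹ - r)) • p)
    (h1' : ‖v'‖ ≤ a) (h2' : p' ≠ 0 → v' = (a * max 0 (‖p'‖⁻¹ - r)) • p') (hr : 0 < r) :
    -(a * r * ‖p - p'‖ ^ 2) ≤ ⟪v - v', p - p'⟫_ℝ := by
  have key : ∀ p v : Eucl d, ‖v‖ ≤ a → (p ≠ 0 → v = (a * max 0 (‖p‖⁻¹ - r)) • p) →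
      ⟪v + (a * r) • p, p⟫_ℝ = a * max 1 (r * ‖p‖) * ‖p‖ ∧
      ‖v + (a * r) • p‖ ≤ a * max 1 (r * ‖p‖) := by
    intro p v h1 h2
    by_cases hp : p = 0
    · subst hp; simpa using h1
    · have hp' : 0 < ‖p‖ := norm_pos_iff.2 hp
      have e : v + (a * r) • p = (a * max 1 (r * ‖p‖) * ‖p‖⁻¹) • p := by
        rw [h2 hp, ← add_smul, mul_assoc, ← mul_add]
        congr 2
        rw [max_mul_of_nonneg _ _ (inv_nonneg.2 hp'.le), one_mul, mul_assoc,
          mul_inv_cancel₀ hp'.ne', mul_one, max_add, zero_add, sub_add_cancel, max_comm]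
      rw [e]
      constructor
      · rw [real_inner_smul_left, real_inner_self_eq_norm_sq]; field_simp
      · rw [norm_smul, Real.norm_of_nonneg (by positivity), mul_assoc,
          inv_mul_cancel₀ hp'.ne', mul_one]
  obtain ⟨k1, k2⟩ := key p v h1 h2
  obtain ⟨k1', k2'⟩ := key p' v' h1' h2'
  set z := v + (a * r) • p with hz
  set z' := v' + (a * r) • p' with hz'
  set s := a * max 1 (r * ‖p‖) with hs
  set s' := a * max 1 (r * ‖p'‖) with hs'
  have e1 : ⟪v - v', p - p'⟫_ℝ = ⟪z - z', p - p'⟫_ℝ - a * r * ‖p - p'‖ ^ 2 := by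
    rw [show v - v' = (z - z') - (a * r) • (p - p') by rw [hz, hz']; module,
      inner_sub_left (𝕜 := ℝ) (z - z'), real_inner_smul_left, real_inner_self_eq_norm_sq]
  have e2 : ⟪z - z', p - p'⟫_ℝ = s * ‖p‖ + s' * ‖p'‖ - ⟪z, p'⟫_ℝ - ⟪z', p⟫_ℝ := by
    rw [inner_sub_left, inner_sub_right, inner_sub_right, k1, k1']; ring
  have e3 : ⟪z, p'⟫_ℝ ≤ s * ‖p'‖ :=
    (real_inner_le_norm _ _).trans (mul_le_mul_of_nonneg_right k2 (norm_nonneg _))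
  have e4 : ⟪z', p⟫_ℝ ≤ s' * ‖p‖ :=
    (real_inner_le_norm _ _).trans (mul_le_mul_of_nonneg_right k2' (norm_nonneg _))
  have e5 : 0 ≤ (s - s') * (‖p‖ - ‖p'‖) := by
    rcases le_total ‖p‖ ‖p'‖ with h | h
    · exact mul_nonneg_of_nonpos_of_nonpos (sub_nonpos.2 (by rw [hs, hs']; gcongr))
        (sub_nonpos.2 h)
    · exact mul_nonneg (sub_nonneg.2 (by rw [hs, hs']; gcongr)) (sub_nonneg.2 h)
  rw [e1, e2]; nlinarith

lemma U_mono {k} {x x' v v' : Eucl d} (h : Q.U k x v) (h' : Q.U k x' v') :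
    -((1/2) ^ (k+2) * ‖x - x'‖ ^ 2) ≤ ⟪v - v', x - x'⟫_ℝ := by
  have hR := Q.R_pos k
  have haR : (1/2 : ℝ) ^ (k+2) = Q.a k * (Q.R k)⁻¹ := by
    unfold a; field_simp
  have := mono_aux (Q.a_pos k) (p := x - Q.q k) (p' := x' - Q.q k) (r := (Q.R k)⁻¹) h.1
    (fun hp => h.2 (sub_ne_zero.1 hp)) h'.1 (fun hp => h'.2 (sub_ne_zero.1 hp)) (inv_pos.2 hR)
  rwa [sub_sub_sub_cancel_right, ← haR] at this

def Tr (x y : Eucl d) : Prop := ∃ v : ℕ → Eucl d, (∀ k, Q.U k x (v k)) ∧ HasSum v (y - x)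

lemma Tr_mono {x y x' y' : Eucl d} (h : Q.Tr x y) (h' : Q.Tr x' y') :
    1/2 * ‖x - x'‖ ^ 2 ≤ ⟪y - y', x - x'⟫_ℝ := by
  obtain ⟨v, hv, hs⟩ := h
  obtain ⟨v', hv', hs'⟩ := h'
  have h1 := (innerSL ℝ (x - x')).hasSum (hs.sub hs')
  have h2 := (hasSum_half.mul_right (‖x - x'‖ ^ 2)).neg
  have h3 := hasSum_le (fun k => by
    rw [innerSL_apply_apply, real_inner_comm]
    exact Q.U_mono (hv k) (hv' k)) h2 h1
  have h4 : ⟪y - y', x - x'⟫_ℝ = ⟪x - x', (y - x) - (y' - x')⟫_ℝ + ‖x - x'‖ ^ 2 := by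
    rw [show (y - x) - (y' - x') = (y - y') - (x - x') by abel,
      inner_sub_right (x - x') (y - y') (x - x'),
      real_inner_self_eq_norm_sq, real_inner_comm]; ring
  rw [innerSL_apply_apply] at h3
  rw [h4]; linarith

/-- potential -/
noncomputable def P (k : ℕ) (x : Eucl d) : ℝ :=
  -(Q.a k / (2 * Q.R k)) * (max 0 (Q.R k - ‖x - Q.q k‖)) ^ 2

lemma hasDerivAt_possq (s : ℝ) : HasDerivAt (fun s : ℝ => (max 0 s) ^ 2) (2 * max 0 s) s := by
  rw [hasDerivAt_iff_isLittleO]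
  have : (fun x' => x' - s) =o[𝓝 s] (fun _ => (1:ℝ)) := by
    rw [Asymptotics.isLittleO_one_iff]
    exact (continuous_id.sub continuous_const).tendsto' _ _ (by simp)
  have h2 := this.mul_isBigO (Asymptotics.isBigO_refl (fun x' => x' - s) (𝓝 s))
  simp only [one_mul] at h2
  refine Asymptotics.IsBigO.trans_isLittleO (Asymptotics.IsBigO.of_bound 1 ?_) h2
  refine Eventually.of_forall fun t => ?_
  rw [one_mul, Real.norm_eq_abs, Real.norm_eq_abs, abs_mul_self, smul_eq_mul, abs_le]
  rcases le_total 0 t with h | h <;> rcases le_total 0 s with h' | h' <;>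
    simp only [max_eq_left h, max_eq_right h, max_eq_left h', max_eq_right h'] <;>
    constructor <;> nlinarith

lemma P_dir (k) (x v : Eucl d) : Tendsto (fun s : ℝ => s⁻¹ * (Q.P k (x + s • v) - Q.P k x))
    (𝓝[>] 0) (𝓝 (⟪Q.u k x, v⟫_ℝ + if Q.q k = x then Q.a k * ‖v‖ else 0)) := by
  have hR := Q.R_pos k
  split_ifs with h
  · subst h
    have h1 : HasDerivAt (fun s : ℝ => -(Q.a k / (2 * Q.R k)) * (max 0 (Q.R k - s * ‖v‖)) ^ 2)
        (-(Q.a k / (2 * Q.R k)) * (2 * max 0 (Q.R k - 0 * ‖v‖) * (-‖v‖))) 0 := by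
      refine HasDerivAt.const_mul _ ?_
      refine HasDerivAt.comp (h := fun s : ℝ => Q.R k - s * ‖v‖) (0:ℝ)
        (hasDerivAt_possq (Q.R k - 0 * ‖v‖)) ?_
      simpa using ((hasDerivAt_id (0:ℝ)).mul_const ‖v‖).const_sub (Q.R k)
    have h2 := h1.tendsto_slope_zero_right
    have e : -(Q.a k / (2 * Q.R k)) * (2 * max 0 (Q.R k - 0 * ‖v‖) * (-‖v‖)) =
      ⟪Q.u k (Q.q k), v⟫_ℝ + Q.a k * ‖v‖ := by
      rw [u_self]; simp [max_eq_right hR.le]; field_simp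
    rw [← e]
    refine h2.congr' ?_
    filter_upwards [self_mem_nhdsWithin] with s hs
    simp [P, norm_smul, abs_of_pos (show (0:ℝ) < s from hs)]
  · have hx : x - Q.q k ≠ 0 := sub_ne_zero.2 (Ne.symm h)
    have hn : 0 < ‖x - Q.q k‖ := norm_pos_iff.2 hx
    have h0 : HasDerivAt (fun s : ℝ => ‖x + s • v - Q.q k‖ ^ 2) (2 * ⟪x - Q.q k, v⟫_ℝ) 0 := by
      have : HasDerivAt (fun s : ℝ => x + s • v - Q.q k) v 0 := by
        simpa using (((hasDerivAt_id (0:ℝ)).smul_const v).const_add x).sub_const (Q.q k)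
      simpa using this.norm_sq
    have h1 : HasDerivAt (fun s : ℝ => ‖x + s • v - Q.q k‖) (⟪x - Q.q k, v⟫_ℝ / ‖x - Q.q k‖) 0 := by
      have := h0.sqrt (by simpa using hn.ne')
      simp only [Real.sqrt_sq (norm_nonneg _)] at this
      convert this using 1
      simp only [zero_smul, add_zero]; field_simp
    have h2 : HasDerivAt (fun s : ℝ => Q.P k (x + s • v)) _ 0 :=
      HasDerivAt.const_mul (-(Q.a k / (2 * Q.R k)))
        ((hasDerivAt_possq _).comp (0:ℝ) (h1.const_sub (Q.R k)))
    have h3 := h2.tendsto_slope_zero_right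
    simp only [zero_add, zero_smul, add_zero, smul_eq_mul] at h3
    convert h3 using 2
    rw [u, real_inner_smul_left]
    have : max 0 (‖x - Q.q k‖⁻¹ - (Q.R k)⁻¹) =
        max 0 (Q.R k - ‖x - Q.q k‖) * (‖x - Q.q k‖⁻¹ * (Q.R k)⁻¹) := by
      rw [max_mul_of_nonneg _ _ (by positivity), zero_mul]; congr 1; field_simp
    rw [this]; field_simp; ring

lemma P_lip (k) (x y : Eucl d) : |Q.P k x - Q.P k y| ≤ Q.a k * ‖x - y‖ := by
  have hR := Q.R_pos k
  have ha := Q.a_pos k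
  set s := max 0 (Q.R k - ‖x - Q.q k‖)
  set t := max 0 (Q.R k - ‖y - Q.q k‖)
  have h1 : |s - t| ≤ ‖x - y‖ := by
    have h0 : |s - t| ≤ |(Q.R k - ‖x - Q.q k‖) - (Q.R k - ‖y - Q.q k‖)| := by
      have := abs_max_sub_max_le_max 0 (Q.R k - ‖x - Q.q k‖) 0 (Q.R k - ‖y - Q.q k‖)
      simpa using this
    rw [sub_sub_sub_cancel_left] at h0
    refine h0.trans ((abs_norm_sub_norm_le _ _).trans ?_)
    rw [sub_sub_sub_cancel_right, norm_sub_rev]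
  have hs : 0 ≤ s := le_max_left _ _
  have ht : 0 ≤ t := le_max_left _ _
  have hs' : s ≤ Q.R k := max_le hR.le (by linarith [norm_nonneg (x - Q.q k)])
  have ht' : t ≤ Q.R k := max_le hR.le (by linarith [norm_nonneg (y - Q.q k)])
  have e : Q.P k x - Q.P k y = -(Q.a k * ((s + t) / (2 * Q.R k)) * (s - t)) := by
    simp only [P]; field_simp; ring
  rw [e, abs_neg, abs_mul, abs_of_nonneg (by positivity), mul_assoc]
  refine mul_le_mul_of_nonneg_left ?_ ha.le
  have : (s + t) / (2 * Q.R k) ≤ 1 := by rw [div_le_one (by positivity)]; linarith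
  calc _ ≤ 1 * |s - t| := by gcongr
    _ ≤ _ := by rw [one_mul]; exact h1

lemma P_bound (k) (x : Eucl d) : |Q.P k x| ≤ Q.a k := by
  have hR := Q.R_pos k
  have ha := Q.a_pos k
  set s := max 0 (Q.R k - ‖x - Q.q k‖) with hs
  have h0 : 0 ≤ s := le_max_left _ _
  have hs' : s ≤ Q.R k := max_le hR.le (by linarith [norm_nonneg (x - Q.q k)])
  have h1 := Q.R_le k
  rw [P, neg_mul, abs_neg, abs_of_nonneg (by positivity), div_mul_eq_mul_div,
    div_le_iff₀ (by positivity)]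
  refine mul_le_mul_of_nonneg_left ?_ ha.le
  nlinarith

end QD
end Geometry

open Filter Topology Set MeasureTheory Dynamics
open scoped ENNReal

namespace QD
open scoped InnerProductSpace
variable {d : ℕ} (Q : QD d)

lemma summable_u (x : Eucl d) : Summable fun k => Q.u k x :=
  Summable.of_norm_bounded Q.summable_a (fun k => Q.norm_u_le k x)

noncomputable def S (x : Eucl d) : Eucl d := x + ∑' k, Q.u k x

lemma continuous_P (k) : Continuous (Q.P k) := by unfold P; fun_prop

lemma exists_Tr (y : Eucl d) : ∃ x, Q.Tr x y := by
  have sP : ∀ x, Summable fun k => Q.P k x := fun x =>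
    Summable.of_norm_bounded Q.summable_a (fun k => Q.P_bound k x)
  have hc : Continuous fun x => 1/2 * ‖x - y‖ ^ 2 + ∑' k, Q.P k x :=
    Continuous.add (by fun_prop) (continuous_tsum Q.continuous_P Q.summable_a Q.P_bound)
  obtain ⟨x, hx⟩ := hc.exists_forall_le (by
    have h1 : Tendsto (fun x : Eucl d => 1/2 * ‖x - y‖ ^ 2 + -∑' k, Q.a k) (cocompact _) atTop := by
      refine tendsto_atTop_add_const_right _ _ (Tendsto.const_mul_atTop (by norm_num)
        ((tendsto_pow_atTop (by norm_num)).comp ?_))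
      simpa only [dist_eq_norm] using tendsto_dist_right_cocompact_atTop y
    refine tendsto_atTop_mono (fun x => ?_) h1
    have := Summable.tsum_le_tsum (fun k => (abs_le.1 (Q.P_bound k x)).1) Q.summable_a.neg (sP x)
    rw [tsum_neg] at this; linarith)
  have hu := Q.summable_u x
  set e := y - x - ∑' k, Q.u k x with he
  have sa : Summable fun k => if Q.q k = x then Q.a k else 0 :=
    Summable.of_nonneg_of_le (fun k => by split_ifs <;> [exact (Q.a_pos k).le; exact le_rfl])
      (fun k => by split_ifs <;> [exact le_rfl; exact (Q.a_pos k).le]) Q.summable_a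
  have key : ∀ v : Eucl d, ⟪e, v⟫_ℝ ≤ (∑' k, if Q.q k = x then Q.a k else 0) * ‖v‖ := by
    intro v
    have h1 : Tendsto (fun s : ℝ => ∑' k, s⁻¹ * (Q.P k (x + s • v) - Q.P k x)) (𝓝[>] 0)
        (𝓝 (∑' k, (⟪Q.u k x, v⟫_ℝ + if Q.q k = x then Q.a k * ‖v‖ else 0))) := by
      refine tendsto_tsum_of_dominated_convergence (Q.summable_a.mul_right ‖v‖)
        (fun k => Q.P_dir k x v) ?_
      filter_upwards [self_mem_nhdsWithin] with s hs k
      have hs : 0 < s := hs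
      have := Q.P_lip k (x + s • v) x
      rw [add_sub_cancel_left, norm_smul, Real.norm_of_nonneg hs.le] at this
      rw [norm_mul, Real.norm_eq_abs, Real.norm_eq_abs, abs_of_pos (inv_pos.2 hs),
        inv_mul_le_iff₀ hs]
      linarith
    have h2 : Tendsto (fun s : ℝ => ⟪x - y, v⟫_ℝ + s * (1/2 * ‖v‖ ^ 2)) (𝓝[>] 0)
        (𝓝 (⟪x - y, v⟫_ℝ)) := by
      refine Tendsto.mono_left ?_ nhdsWithin_le_nhds
      exact Continuous.tendsto' (by fun_prop) _ _ (by simp)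
    have h3 := ge_of_tendsto (h2.add h1) (b := 0) (by
      filter_upwards [self_mem_nhdsWithin] with s hs
      have hs : 0 < s := hs
      have h := hx (x + s • v)
      rw [tsum_mul_left, (sP _).tsum_sub (sP _)]
      have e1 : ‖x + s • v - y‖ ^ 2 = ‖x - y‖ ^ 2 + 2 * (s * ⟪x - y, v⟫_ℝ) + s ^ 2 * ‖v‖ ^ 2 := by
        rw [show x + s • v - y = (x - y) + s • v by abel, norm_add_sq_real, real_inner_smul_right,
          norm_smul, mul_pow, Real.norm_eq_abs, sq_abs]
      rw [e1] at h
      have : 0 ≤ s⁻¹ * (s * ⟪x - y, v⟫_ℝ + s^2 * (1/2 * ‖v‖ ^ 2) +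
        (∑' k, Q.P k (x + s • v) - ∑' k, Q.P k x)) :=
        mul_nonneg (inv_pos.2 hs).le (by linarith)
      refine this.trans_eq ?_
      field_simp)
    have s1 : Summable fun k => ⟪Q.u k x, v⟫_ℝ := by
      have := (innerSL ℝ v).summable hu
      simpa [real_inner_comm] using this
    have s2 : (fun k => if Q.q k = x then Q.a k * ‖v‖ else 0) =
      fun k => (if Q.q k = x then Q.a k else 0) * ‖v‖ := by ext k; simp
    have s3 : ∑' k, ⟪Q.u k x, v⟫_ℝ = ⟪∑' k, Q.u k x, v⟫_ℝ := by
      rw [real_inner_comm, ← innerSL_apply_apply (𝕜 := ℝ), (innerSL ℝ v).map_tsum hu]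
      simp [real_inner_comm]
    rw [s1.tsum_add (by rw [s2]; exact sa.mul_right _), s2, tsum_mul_right, s3] at h3
    rw [he, inner_sub_left (y - x), ← neg_sub x y, inner_neg_left]
    linarith
  have hb : ‖e‖ ≤ ∑' k, if Q.q k = x then Q.a k else 0 := by
    have := key e
    rw [real_inner_self_eq_norm_sq] at this
    rcases (norm_nonneg e).eq_or_lt with h | h
    · rw [← h]; exact tsum_nonneg fun k => by split_ifs <;> [exact (Q.a_pos k).le; exact le_rfl]
    · nlinarith
  refine ⟨x, fun j => Q.u j x + if Q.q j = x then e else 0, fun k => ?_, ?_⟩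
  · by_cases h : Q.q k = x
    · refine ⟨?_, fun h' => absurd h.symm h'⟩
      simp only [h, if_true]
      rw [← h, Q.u_self, zero_add]
      refine hb.trans_eq ?_
      rw [tsum_eq_single k (fun j hj => if_neg (fun hh => hj (Q.inj (hh.trans h.symm)))), if_pos h]
    · simp only [h, if_false, add_zero]; exact Q.U_u k x
  · have : y - x = ∑' k, Q.u k x + e := by rw [he]; abel
    rw [this]
    refine hu.hasSum.add ?_
    by_cases h : ∃ k, Q.q k = x
    · obtain ⟨k, hk⟩ := h
      convert hasSum_single (f := fun j => if Q.q j = x then e else 0) k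
        (fun j hj => if_neg (fun hh => hj (Q.inj (hh.trans hk.symm)))) using 1
      simp [hk]
    · push Not at h
      have : e = 0 := by
        simp only [h, if_false, tsum_zero] at hb
        exact norm_le_zero_iff.1 hb
      simp only [h, if_false, this]; exact hasSum_zero

noncomputable def pi (y : Eucl d) : Eucl d := (Q.exists_Tr y).choose
lemma pi_Tr (y) : Q.Tr (Q.pi y) y := (Q.exists_Tr y).choose_spec
lemma Tr_inj {x y y' : Eucl d} {x' : Eucl d} (h : Q.Tr x y) (h' : Q.Tr x' y') :
    ‖x - x'‖ ≤ 2 * ‖y - y'‖ := by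
  have h1 := Q.Tr_mono h h'
  have h2 := real_inner_le_norm (y - y') (x - x')
  rcases (norm_nonneg (x - x')).eq_or_lt with h | h
  · rw [← h]; positivity
  · nlinarith
lemma pi_eq {x y : Eucl d} (h : Q.Tr x y) : Q.pi y = x := by
  have := Q.Tr_inj (Q.pi_Tr y) h
  simpa [sub_eq_zero] using this
lemma pi_eq_iff {x y : Eucl d} : Q.pi y = x ↔ Q.Tr x y :=
  ⟨fun h => h ▸ Q.pi_Tr y, Q.pi_eq⟩
lemma continuous_pi : Continuous Q.pi :=
  (LipschitzWith.of_dist_le_mul (K := 2) fun x y => by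
    simpa [dist_eq_norm] using Q.Tr_inj (Q.pi_Tr x) (Q.pi_Tr y)).continuous

lemma Tr_S (x) : Q.Tr x (Q.S x) :=
  ⟨fun k => Q.u k x, fun k => Q.U_u k x, by simpa [S] using (Q.summable_u x).hasSum⟩
lemma pi_S (x) : Q.pi (Q.S x) = x := Q.pi_eq (Q.Tr_S x)
lemma S_far {x : Eucl d} (h : 1 ≤ ‖x‖) : Q.S x = x := by simp [S, Q.u_far _ h]
lemma pi_far {y : Eucl d} (h : 1 ≤ ‖y‖) : Q.pi y = y := by
  simpa [Q.S_far h] using Q.pi_S y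
lemma pi_notQ {x y : Eucl d} (hx : ∀ k, x ≠ Q.q k) : Q.pi y = x ↔ y = Q.S x := by
  constructor
  · rintro h
    obtain ⟨v, hv, hs⟩ := Q.pi_eq_iff.1 h
    have : v = fun k => Q.u k x := funext fun k => (hv k).2 (hx k)
    subst this; rw [S, hs.tsum_eq]; abel
  · rintro rfl; exact Q.pi_S x

noncomputable def c (k : ℕ) : Eucl d := Q.S (Q.q k)
lemma Tr_q {k : ℕ} {y : Eucl d} : Q.Tr (Q.q k) y ↔ ‖y - Q.c k‖ ≤ Q.a k := by
  constructor
  · rintro ⟨v, hv, hs⟩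
    have h1 := hs.sub (Q.summable_u (Q.q k)).hasSum
    have h2 : ∀ j, j ≠ k → v j - Q.u j (Q.q k) = 0 := fun j hj =>
      sub_eq_zero.2 ((hv j).2 (fun h => hj (Q.inj h.symm)))
    have h3 := h1.unique (hasSum_single k h2)
    rw [c, S, ← sub_sub, h3, Q.u_self, sub_zero]; exact (hv k).1
  · intro h
    refine ⟨fun j => Q.u j (Q.q k) + if j = k then y - Q.c k else 0, fun j => ?_, ?_⟩
    · by_cases hj : j = k
      · subst hj; simpa [U, Q.u_self] using h
      · simpa [hj] using Q.U_u j (Q.q k)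
    · have := (Q.summable_u (Q.q k)).hasSum.add (hasSum_ite_eq k (y - Q.c k))
      convert this using 1
      rw [c, S]; abel
lemma pi_q {k : ℕ} {y : Eucl d} : Q.pi y = Q.q k ↔ ‖y - Q.c k‖ ≤ Q.a k :=
  Q.pi_eq_iff.trans Q.Tr_q

def isQ (x : Eucl d) : Prop := ∃ k, x = Q.q k

lemma pi_maps {y : Eucl d} (h : ‖y‖ ≤ 1) : ‖Q.pi y‖ ≤ 1 := by
  by_contra! h'
  have := (Q.pi_eq_iff.1 (rfl : Q.pi y = _))
  have h2 : Q.S (Q.pi y) = Q.pi y := Q.S_far h'.le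
  have h3 := (Q.pi_notQ (x := Q.pi y) (y := y) (fun k hk => by
    have := Q.lt k; rw [← hk] at this; linarith)).1 rfl
  rw [h2] at h3; rw [h3] at h; linarith
lemma L_lt {k : ℕ} {y : Eucl d} (h : ‖y - Q.c k‖ ≤ Q.a k) : ‖y‖ < 1 := by
  by_contra! h'
  have := Q.pi_q.2 h
  rw [Q.pi_far h'] at this
  have := Q.lt k; simp_all; linarith
lemma S_maps {x : Eucl d} (h : ‖x‖ ≤ 1) : ‖Q.S x‖ ≤ 1 := by
  by_contra! h'
  have := Q.pi_S x
  rw [Q.pi_far h'.le] at this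
  rw [this] at h'; linarith

/-- the chosen selection -/
noncomputable def V (y : Eucl d) : ℕ → Eucl d := (Q.pi_Tr y).choose
lemma V_U (y k) : Q.U k (Q.pi y) (Q.V y k) := (Q.pi_Tr y).choose_spec.1 k
lemma V_sum (y) : HasSum (Q.V y) (y - Q.pi y) := (Q.pi_Tr y).choose_spec.2

lemma asym (z : Eucl d) : Tendsto (fun y => y - ∑' j, (if Q.q j = z then Q.V y j else 0))
    (comap Q.pi (𝓝 z)) (𝓝 (Q.S z)) := by
  have h1 : Tendsto (fun y => ∑' j, (if Q.q j = z then 0 else Q.V y j)) (comap Q.pi (𝓝 z))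
      (𝓝 (∑' j, Q.u j z)) := by
    refine tendsto_tsum_of_dominated_convergence Q.summable_a (fun j => ?_)
      (Eventually.of_forall fun y j => ?_)
    · by_cases h : Q.q j = z
      · simp only [h, if_true]; rw [← h, Q.u_self]; exact tendsto_const_nhds
      · simp only [h, if_false]
        refine Tendsto.congr' ?_ ((Q.continuousAt_u j (Ne.symm h)).tendsto.comp tendsto_comap)
        have : ∀ᶠ x in 𝓝 z, x ≠ Q.q j := isOpen_ne.mem_nhds (Ne.symm h)
        filter_upwards [tendsto_comap.eventually this] with y hy
        exact ((Q.V_U y j).2 hy).symm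
    · split_ifs
      · simpa using (Q.a_pos j).le
      · exact (Q.V_U y j).1
  have h2 : Tendsto Q.pi (comap Q.pi (𝓝 z)) (𝓝 z) := tendsto_comap
  refine (h2.add h1).congr fun y => ?_
  have hV := Q.V_sum y
  have n : Summable fun j => ‖Q.V y j‖ :=
    Summable.of_nonneg_of_le (fun _ => norm_nonneg _) (fun j => (Q.V_U y j).1) Q.summable_a
  have s1 : Summable fun j => (if Q.q j = z then Q.V y j else 0) :=
    Summable.of_norm_bounded n fun j => by split_ifs <;> simp
  have s2 : Summable fun j => (if Q.q j = z then 0 else Q.V y j) :=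
    Summable.of_norm_bounded n fun j => by split_ifs <;> simp
  have : y - Q.pi y = ∑' j, (if Q.q j = z then Q.V y j else 0) +
      ∑' j, (if Q.q j = z then 0 else Q.V y j) := by
    rw [← s1.tsum_add s2, ← hV.tsum_eq]
    congr 1; ext1 j; split_ifs <;> simp
  rw [eq_sub_iff_add_eq]
  rw [sub_eq_iff_eq_add] at this
  exact (by abel : _ = _).trans this.symm

end QD

open Filter Topology Set MeasureTheory Dynamics
open scoped ENNReal

namespace QD
variable {d : ℕ} (Q : QD d)

lemma u_near {k : ℕ} {x : Eucl d} (h : ‖x - Q.q k‖ ≤ Q.R k) :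
    Q.u k x = (Q.a k * (1 - ‖x - Q.q k‖ / Q.R k)) • (‖x - Q.q k‖⁻¹ • (x - Q.q k)) := by
  rcases (norm_nonneg (x - Q.q k)).eq_or_lt with h0 | h0
  · rw [u, norm_eq_zero.1 h0.symm]; simp
  · have hR := Q.R_pos k
    rw [u, max_eq_right (sub_nonneg.2 (inv_anti₀ h0 h)), smul_smul, mul_assoc]
    congr 2; field_simp

lemma u_coef {ι : Type*} {l : Filter ι} {k : ℕ} {p : ι → Eucl d} (hp : Tendsto p l (𝓝 (Q.q k))) :
    Tendsto (fun i => Q.a k * (1 - ‖p i - Q.q k‖ / Q.R k)) l (𝓝 (Q.a k)) ∧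
    ∀ᶠ i in l, ‖p i - Q.q k‖ ≤ Q.R k := by
  have h1 : Tendsto (fun i => ‖p i - Q.q k‖) l (𝓝 0) := by
    simpa using (hp.sub_const (Q.q k)).norm
  constructor
  · simpa using ((h1.div_const (Q.R k)).const_sub 1).const_mul (Q.a k)
  · exact h1.eventually_le_const (Q.R_pos k)

lemma u_tendsto {ι : Type*} {l : Filter ι} {k : ℕ} {p : ι → Eucl d} {w : Eucl d} {t : ι → ℝ}
    (hp : Tendsto p l (𝓝 (Q.q k))) (ht : ∀ᶠ i in l, 0 < t i)
    (hw : Tendsto (fun i => (t i)⁻¹ • (p i - Q.q k)) l (𝓝 w)) (hw0 : w ≠ 0) :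
    Tendsto (fun i => Q.u k (p i)) l (𝓝 (Q.a k • (‖w‖⁻¹ • w))) := by
  obtain ⟨h1, h2⟩ := Q.u_coef hp
  have h3 := (hw.norm.inv₀ (norm_ne_zero_iff.2 hw0)).smul hw
  refine (h1.smul h3).congr' ?_
  filter_upwards [h2, ht] with i hi hti
  rw [Q.u_near hi, norm_smul, Real.norm_of_nonneg (inv_pos.2 hti).le, smul_smul (_⁻¹) (_⁻¹)]
  congr 2; field_simp

lemma dir_tendsto {ι : Type*} {l : Filter ι} {k : ℕ} {p : ι → Eucl d} {w : Eucl d}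
    (hp : Tendsto p l (𝓝 (Q.q k))) (hu : Tendsto (fun i => Q.u k (p i)) l (𝓝 w)) :
    Tendsto (fun i => ‖p i - Q.q k‖⁻¹ • (p i - Q.q k)) l (𝓝 ((Q.a k)⁻¹ • w)) := by
  obtain ⟨h1, h2⟩ := Q.u_coef hp
  have ha := Q.a_pos k
  refine ((h1.inv₀ ha.ne').smul hu).congr' ?_
  filter_upwards [h2, h1.eventually_const_lt ha] with i hi hi'
  rw [Q.u_near hi, smul_smul, inv_mul_cancel₀ hi'.ne', one_smul]

noncomputable def W (k : ℕ) (w : Eucl d) : Eucl d := Q.c k + Q.a k • w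
noncomputable def W' (k : ℕ) (y : Eucl d) : Eucl d := (Q.a k)⁻¹ • (y - Q.c k)
lemma W'_W (k w) : Q.W' k (Q.W k w) = w := by
  simp [W', W, smul_smul, (Q.a_pos k).ne']
lemma W_W' (k y) : Q.W k (Q.W' k y) = y := by
  simp [W', W, smul_smul, (Q.a_pos k).ne']
lemma continuous_W (k) : Continuous (Q.W k) := by unfold W; fun_prop
lemma continuous_W' (k) : Continuous (Q.W' k) := by unfold W'; fun_prop
lemma norm_W' (k y) : ‖Q.W' k y‖ = (Q.a k)⁻¹ * ‖y - Q.c k‖ := by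
  rw [W', norm_smul, Real.norm_of_nonneg (inv_pos.2 (Q.a_pos k)).le]
lemma pi_q' {k : ℕ} {y : Eucl d} : Q.pi y = Q.q k ↔ ‖Q.W' k y‖ ≤ 1 := by
  rw [Q.pi_q, norm_W', inv_mul_le_iff₀ (Q.a_pos k), mul_one]
lemma pi_W {k : ℕ} {w : Eucl d} : Q.pi (Q.W k w) = Q.q k ↔ ‖w‖ ≤ 1 := by
  rw [Q.pi_q', W'_W]
lemma W_inj (k) : Function.Injective (Q.W k) := fun x y h => by
  rw [← Q.W'_W k x, h, W'_W]
lemma dist_W (k w w') : dist (Q.W k w) (Q.W k w') = Q.a k * dist w w' := by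
  rw [W, W, dist_add_left, dist_smul₀, Real.norm_of_nonneg (Q.a_pos k).le]
lemma pi_surj {x : Eucl d} (h : ‖x‖ ≤ 1) : ∃ y, ‖y‖ ≤ 1 ∧ Q.pi y = x :=
  ⟨Q.S x, Q.S_maps h, Q.pi_S x⟩
lemma W_lt {k : ℕ} {w : Eucl d} (h : ‖w‖ ≤ 1) : ‖Q.W k w‖ < 1 :=
  Q.L_lt (Q.pi_q.1 (Q.pi_W.2 h))
end QD

structure BD (d : ℕ) extends QD d where
  ft : Eucl d → Eucl d
  ft_cont : Continuous ft
  ft_far : ∀ x, 1 ≤ ‖x‖ → ft x = x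
  ft_maps : ∀ x, ‖x‖ ≤ 1 → ‖ft x‖ ≤ 1
  ft_surj : ∀ x, ‖x‖ ≤ 1 → ∃ x', ‖x'‖ ≤ 1 ∧ ft x' = x
  nx : ℕ → ℕ
  ft_q : ∀ k, ft (q k) = q (nx k)
  preQ : ∀ x k, ft x = q k → ∃ j, x = q j
  A : ℕ → Eucl d ≃L[ℝ] Eucl d
  hA : ∀ k, HasFDerivAt ft (A k : Eucl d →L[ℝ] Eucl d) (q k)
  g : ℕ → Eucl d → Eucl d
  g_cont : ∀ k, ContinuousOn (g k) (Metric.closedBall 0 1)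
  g_maps : ∀ k w, ‖w‖ ≤ 1 → ‖g k w‖ ≤ 1
  g_surj : ∀ k w, ‖w‖ ≤ 1 → ∃ w', ‖w'‖ ≤ 1 ∧ g k w' = w
  g_sph : ∀ k w, ‖w‖ = 1 → g k w = ‖A k w‖⁻¹ • A k w

namespace BD
variable {d : ℕ} (Q : BD d)

open Classical in
noncomputable def F (y : Eucl d) : Eucl d :=
  if h : ∃ k, Q.pi y = Q.q k then Q.W (Q.nx h.choose) (Q.g h.choose (Q.W' h.choose y))
  else Q.S (Q.ft (Q.pi y))

lemma F_q {k : ℕ} {y : Eucl d} (h : Q.pi y = Q.q k) :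
    Q.F y = Q.W (Q.nx k) (Q.g k (Q.W' k y)) := by
  have h' : ∃ k, Q.pi y = Q.q k := ⟨k, h⟩
  have : h'.choose = k := Q.inj (h'.choose_spec.symm.trans h)
  rw [F, dif_pos h', this]
lemma F_nq {y : Eucl d} (h : ∀ k, Q.pi y ≠ Q.q k) : Q.F y = Q.S (Q.ft (Q.pi y)) := by
  rw [F, dif_neg (by push Not; exact h)]
lemma F_W {k : ℕ} {w : Eucl d} (h : ‖w‖ ≤ 1) : Q.F (Q.W k w) = Q.W (Q.nx k) (Q.g k w) := by
  rw [Q.F_q (Q.pi_W.2 h), Q.W'_W]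
lemma pi_F (y : Eucl d) : Q.pi (Q.F y) = Q.ft (Q.pi y) := by
  by_cases h : ∃ k, Q.pi y = Q.q k
  · obtain ⟨k, h⟩ := h
    rw [Q.F_q h, h, Q.ft_q, Q.pi_W]
    exact Q.g_maps _ _ (Q.pi_q'.1 h)
  · push Not at h
    rw [Q.F_nq h, Q.pi_S]
lemma F_far {y : Eucl d} (h : 1 ≤ ‖y‖) : Q.F y = y := by
  rw [Q.F_nq, Q.pi_far h, Q.ft_far _ h, Q.S_far h]
  intro k hk; rw [Q.pi_far h] at hk; have := Q.lt k; rw [← hk] at this; linarith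
lemma F_maps {y : Eucl d} (h : ‖y‖ ≤ 1) : ‖Q.F y‖ ≤ 1 := by
  by_cases hh : ∃ k, Q.pi y = Q.q k
  · obtain ⟨k, hh⟩ := hh
    rw [Q.F_q hh]; exact (Q.W_lt (Q.g_maps _ _ (Q.pi_q'.1 hh))).le
  · push Not at hh
    rw [Q.F_nq hh]; exact Q.S_maps (Q.ft_maps _ (Q.pi_maps h))
lemma F_surj {y : Eucl d} (h : ‖y‖ ≤ 1) : ∃ y', ‖y'‖ ≤ 1 ∧ Q.F y' = y := by
  obtain ⟨x, hx, hx'⟩ := Q.ft_surj _ (Q.pi_maps h)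
  by_cases hh : ∃ k, Q.pi y = Q.q k
  · obtain ⟨k, hh⟩ := hh
    obtain ⟨j, rfl⟩ := Q.preQ x k (hx'.trans hh)
    rw [Q.ft_q, hh] at hx'
    have hj := Q.inj hx'
    obtain ⟨w, hw, hw'⟩ := Q.g_surj j _ (Q.pi_q'.1 hh)
    exact ⟨Q.W j w, (Q.W_lt hw).le, by rw [Q.F_W hw, hw', hj, Q.W_W']⟩
  · push Not at hh
    refine ⟨Q.S x, Q.S_maps hx, ?_⟩
    rw [Q.F_nq, Q.pi_S, hx']
    · exact ((Q.pi_notQ hh).1 rfl).symm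
    · rw [Q.pi_S]; rintro k rfl; rw [Q.ft_q] at hx'; exact hh _ hx'.symm

lemma F_inj (hf : Function.Injective Q.ft)
    (hg : ∀ k, InjOn (Q.g k) (Metric.closedBall 0 1)) : Function.Injective Q.F := by
  intro y y' h
  have h1 : Q.pi y = Q.pi y' := hf (by rw [← Q.pi_F, h, Q.pi_F])
  by_cases hh : ∃ k, Q.pi y = Q.q k
  · obtain ⟨k, hh⟩ := hh
    have hh' := h1 ▸ hh
    rw [Q.F_q hh, Q.F_q hh'] at h
    have := hg k (by simpa using Q.pi_q'.1 hh) (by simpa using Q.pi_q'.1 hh') (Q.W_inj _ h)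
    rw [← Q.W_W' k y, this, Q.W_W']
  · push Not at hh
    rw [(Q.pi_notQ hh).1 rfl, (Q.pi_notQ (y := y') hh).1 h1.symm]

lemma asym_q (k : ℕ) : Tendsto (fun y => y - Q.V y k) (comap Q.pi (𝓝 (Q.q k))) (𝓝 (Q.c k)) := by
  refine (Q.asym (Q.q k)).congr fun y => ?_
  rw [tsum_eq_single k (fun j hj => if_neg fun h => hj (Q.inj h)), if_pos rfl]
lemma asym_nq {z : Eucl d} (h : ∀ k, z ≠ Q.q k) : Tendsto id (comap Q.pi (𝓝 z)) (𝓝 (Q.S z)) := by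
  refine (Q.asym z).congr fun y => ?_
  simp [fun j => (h j).symm]

lemma continuous_F : Continuous Q.F := by
  rw [continuous_iff_continuousAt]
  intro y0
  have hF : Tendsto Q.F (𝓝 y0) (comap Q.pi (𝓝 (Q.ft (Q.pi y0)))) := by
    rw [tendsto_comap_iff]
    exact ((Q.ft_cont.comp Q.continuous_pi).tendsto y0).congr fun y => (Q.pi_F y).symm
  by_cases hp : ∀ k, Q.ft (Q.pi y0) ≠ Q.q k
  · have := (Q.asym_nq hp).comp hF
    rw [ContinuousAt, Q.F_nq]
    · exact this
    · intro k hk; rw [hk, Q.ft_q] at hp; exact hp _ rfl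
  push Not at hp
  obtain ⟨l, hl⟩ := hp
  obtain ⟨k, hk⟩ := Q.preQ _ _ hl
  have hkl : Q.nx k = l := Q.inj (by rw [← Q.ft_q, ← hk, hl])
  rw [← continuousWithinAt_univ, ← union_compl_self (Q.pi ⁻¹' {Q.q k}), continuousWithinAt_union]
  constructor
  · have h1 : ContinuousWithinAt (fun y => Q.W (Q.nx k) (Q.g k (Q.W' k y))) (Q.pi ⁻¹' {Q.q k}) y0 := by
      refine (Q.continuous_W _).continuousAt.comp_continuousWithinAt ?_
      refine ContinuousWithinAt.comp (t := Metric.closedBall 0 1) (Q.g_cont k _ ?_)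
        (Q.continuous_W' k).continuousWithinAt ?_
      · simpa using Q.pi_q'.1 hk
      · intro y hy; simpa using Q.pi_q'.1 hy
    exact h1.congr (fun y hy => Q.F_q hy) (Q.F_q hk)
  · rcases (𝓝[(Q.pi ⁻¹' {Q.q k})ᶜ] y0).eq_or_neBot with hb | hb
    · rw [ContinuousWithinAt, hb]; exact tendsto_bot
    set G := 𝓝[(Q.pi ⁻¹' {Q.q k})ᶜ] y0 with hG
    have hGle : G ≤ 𝓝 y0 := nhdsWithin_le_nhds
    have hpi : Tendsto Q.pi G (𝓝 (Q.q k)) := hk ▸ (Q.continuous_pi.tendsto y0).mono_left hGle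
    have hne : ∀ᶠ y in G, Q.pi y ≠ Q.q k := self_mem_nhdsWithin
    have h1 : Tendsto (fun y => Q.u k (Q.pi y)) G (𝓝 (y0 - Q.c k)) := by
      have h0 : Tendsto id G (comap Q.pi (𝓝 (Q.q k))) := tendsto_comap_iff.2 hpi
      have h := (tendsto_id.mono_left hGle).sub ((Q.asym_q k).comp h0)
      refine h.congr' ?_
      filter_upwards [hne] with y hy
      simp [(Q.V_U y k).2 hy]
    have h2 := Q.dir_tendsto hpi h1
    change Tendsto _ _ (𝓝 (Q.W' k y0)) at h2
    have hw : ‖Q.W' k y0‖ = 1 := by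
      refine tendsto_nhds_unique h2.norm (tendsto_const_nhds.congr' ?_)
      filter_upwards [hne] with y hy
      have : ‖Q.pi y - Q.q k‖ ≠ 0 := by simpa [sub_eq_zero] using hy
      rw [norm_smul, norm_inv, norm_norm, inv_mul_cancel₀ this]
    have hAw : Q.A k (Q.W' k y0) ≠ 0 := by
      rw [Ne, EmbeddingLike.map_eq_zero_iff]; intro h; simp [h] at hw
    have h3 : Tendsto (fun y => ‖Q.pi y - Q.q k‖⁻¹ • (Q.ft (Q.pi y) - Q.q l)) G
        (𝓝 (Q.A k (Q.W' k y0))) := by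
      have o := (hasFDerivAt_iff_isLittleO.1 (Q.hA k)).comp_tendsto hpi
      have o2 := (o.norm_right.tendsto_inv_smul_nhds_zero)
      have o3 := o2.add (((Q.A k).continuous.tendsto _).comp h2)
      rw [zero_add] at o3
      refine o3.congr fun y => ?_
      simp only [Function.comp_apply, map_smul, Q.ft_q, hkl, ContinuousLinearEquiv.coe_coe]
      rw [← smul_add]; congr 1; abel
    have hpos : ∀ᶠ y in G, 0 < ‖Q.pi y - Q.q k‖ := by
      filter_upwards [hne] with y hy; simpa [sub_eq_zero] using hy
    have hfp : Tendsto (fun y => Q.ft (Q.pi y)) G (𝓝 (Q.q l)) :=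
      hl ▸ ((Q.ft_cont.comp Q.continuous_pi).tendsto y0).mono_left hGle
    have h4 := Q.u_tendsto hfp hpos h3 hAw
    have hne2 : ∀ᶠ y in G, Q.ft (Q.pi y) ≠ Q.q l := by
      filter_upwards [h3.eventually_ne hAw] with y hy hy'
      simp [hy'] at hy
    have h5 := ((Q.asym_q l).comp (by rw [← hl]; exact hF.mono_left hGle)).add h4
    rw [ContinuousWithinAt, Q.F_q hk, hkl, Q.g_sph k _ hw]
    refine h5.congr' ?_
    filter_upwards [hne2] with y hy
    have := (Q.V_U (Q.F y) l).2 (by rw [Q.pi_F]; exact hy)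
    rw [Q.pi_F] at this
    simp [this]
end BD

open Filter Topology Set MeasureTheory Dynamics
open scoped ENNReal

section PathLemma
open Complex

lemma path2 (A : Eucl 2 ≃L[ℝ] Eucl 2)
    (hA : 0 < LinearMap.det ((A : Eucl 2 →L[ℝ] Eucl 2) : Eucl 2 →ₗ[ℝ] Eucl 2)) :
    ∃ Γ : ℝ → Eucl 2 →ₗ[ℝ] Eucl 2, Continuous (fun p : ℝ × Eucl 2 => Γ p.1 p.2) ∧
      (∀ w, Γ 0 w = w) ∧ (∀ w, Γ 1 w = A w) ∧
      ∀ t, 0 ≤ t → t ≤ 1 → Function.Injective (Γ t) := by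
  let ψ : ℂ ≃ₗᵢ[ℝ] Eucl 2 := Complex.orthonormalBasisOneI.repr
  let T : ℂ →ₗ[ℝ] ℂ := ψ.symm.toLinearEquiv.toLinearMap ∘ₗ
    ((A : Eucl 2 →L[ℝ] Eucl 2) : Eucl 2 →ₗ[ℝ] Eucl 2) ∘ₗ ψ.toLinearEquiv.toLinearMap
  have hdet : 0 < LinearMap.det T := by
    have := LinearMap.det_conj ((A : Eucl 2 →L[ℝ] Eucl 2) : Eucl 2 →ₗ[ℝ] Eucl 2)
      ψ.symm.toLinearEquiv
    rw [← this] at hA; exact hA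
  have hd2 : LinearMap.det T = (T 1).re * (T I).im - (T I).re * (T 1).im := by
    rw [← LinearMap.det_toMatrix Complex.basisOneI, Matrix.det_fin_two]
    simp [LinearMap.toMatrix_apply, Complex.coe_basisOneI_repr, Complex.coe_basisOneI]
  set c : ℂ := (T 1 - I * T I) / 2 with hc
  set c' : ℂ := (T 1 + I * T I) / 2 with hc'
  have hT : ∀ z, T z = c * z + c' * (starRingEnd ℂ z) := by
    intro z
    have h1 : z = z.re • (1:ℂ) + z.im • I := by simp [Complex.re_add_im]
    conv_lhs => rw [h1, map_add, map_smul, map_smul]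
    apply Complex.ext <;> simp [hc, hc'] <;> ring
  have hn : normSq c - normSq c' = LinearMap.det T := by
    rw [hd2]; simp [normSq_apply, hc, hc']; ring
  have hlt : normSq c' < normSq c := by linarith
  have hc0 : c ≠ 0 := by
    intro h; rw [h, map_zero] at hlt; linarith [normSq_nonneg c']
  have hk : ‖c' / c‖ < 1 := by
    rw [norm_div, div_lt_one (norm_pos_iff.2 hc0)]
    rw [normSq_eq_norm_sq, normSq_eq_norm_sq] at hlt
    exact lt_of_pow_lt_pow_left₀ 2 (norm_nonneg _) hlt
  let G : ℝ → ℂ →ₗ[ℝ] ℂ := fun t =>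
    { toFun := fun z => Complex.exp (t * Complex.log c) * (z + t * (c' / c) * (starRingEnd ℂ z))
      map_add' := fun x y => by simp; ring
      map_smul' := fun r x => by simp; ring }
  refine ⟨fun t => ψ.toLinearEquiv.toLinearMap ∘ₗ G t ∘ₗ ψ.symm.toLinearEquiv.toLinearMap,
    ?_, ?_, ?_, ?_⟩
  · change Continuous fun p : ℝ × Eucl 2 => ψ (Complex.exp (p.1 * Complex.log c) *
      (ψ.symm p.2 + p.1 * (c' / c) * (starRingEnd ℂ (ψ.symm p.2))))
    have := Complex.continuous_conj
    have h1 := ψ.continuous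
    have h2 := ψ.symm.continuous
    fun_prop
  · intro w
    change ψ (Complex.exp ((0:ℝ) * Complex.log c) *
      (ψ.symm w + (0:ℝ) * (c' / c) * (starRingEnd ℂ (ψ.symm w)))) = w
    simp
  · intro w
    change ψ (Complex.exp ((1:ℝ) * Complex.log c) *
      (ψ.symm w + (1:ℝ) * (c' / c) * (starRingEnd ℂ (ψ.symm w)))) = A w
    have h1 : ψ (T (ψ.symm w)) = A w := by simp [T]
    rw [← h1, hT, ofReal_one, one_mul, one_mul, Complex.exp_log hc0]
    congr 1; field_simp
  · intro t ht ht'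
    change Function.Injective (fun w => ψ (G t (ψ.symm w)))
    refine ψ.injective.comp (Function.Injective.comp ?_ ψ.symm.injective)
    rw [injective_iff_map_eq_zero]
    intro z hz
    have h1 : z + t * (c' / c) * (starRingEnd ℂ z) = 0 :=
      (mul_eq_zero.1 hz).resolve_left (Complex.exp_ne_zero _)
    have h2 : ‖z‖ = t * ‖c' / c‖ * ‖z‖ := by
      conv_lhs => rw [eq_neg_of_add_eq_zero_left h1]
      rw [norm_neg, norm_mul, norm_mul, Complex.norm_conj, Complex.norm_real,
        Real.norm_of_nonneg ht]
    by_contra h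
    have h3 : 0 < ‖z‖ := norm_pos_iff.2 h
    have : t * ‖c' / c‖ < 1 := by nlinarith [norm_nonneg (c' / c)]
    nlinarith
end PathLemma

def InvD (d : ℕ) (A : Eucl d →L[ℝ] Eucl d) : Prop :=
  (∃ B : Eucl d →L[ℝ] Eucl d,
    A.comp B = ContinuousLinearMap.id ℝ _ ∧ B.comp A = ContinuousLinearMap.id ℝ _) ∧
  (d = 2 → 0 < LinearMap.det (A : Eucl d →ₗ[ℝ] Eucl d))

lemma InvD.comp {d} {A B : Eucl d →L[ℝ] Eucl d} (hA : InvD d A) (hB : InvD d B) :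
    InvD d (A.comp B) := by
  obtain ⟨⟨A', h1, h2⟩, h3⟩ := hA
  obtain ⟨⟨B', h4, h5⟩, h6⟩ := hB
  refine ⟨⟨B'.comp A', ?_, ?_⟩, fun h => ?_⟩
  · calc _ = A.comp ((B.comp B').comp A') := by simp only [ContinuousLinearMap.comp_assoc]
      _ = _ := by rw [h4, ContinuousLinearMap.id_comp, h1]
  · calc _ = B'.comp ((A'.comp A).comp B) := by simp only [ContinuousLinearMap.comp_assoc]
      _ = _ := by rw [h2, ContinuousLinearMap.id_comp, h5]
  · rw [ContinuousLinearMap.toLinearMap_comp, LinearMap.det_comp]; exact mul_pos (h3 h) (h6 h)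
lemma InvD.id {d} : InvD d (ContinuousLinearMap.id ℝ (Eucl d)) :=
  ⟨⟨ContinuousLinearMap.id ℝ _, rfl, rfl⟩, fun _ => by simp⟩
lemma InvD.smul {d} {r : ℝ} (hr : r ≠ 0) (h : d = 2 → 0 < r) :
    InvD d (r • ContinuousLinearMap.id ℝ (Eucl d)) := by
  refine ⟨⟨r⁻¹ • ContinuousLinearMap.id ℝ _, ?_, ?_⟩, fun h2 => ?_⟩
  · ext1 x; simp [smul_smul, hr]
  · ext1 x; simp [smul_smul, hr]
  · have := h h2; subst h2
    have e : ((r • ContinuousLinearMap.id ℝ (Eucl 2) : Eucl 2 →L[ℝ] Eucl 2) : Eucl 2 →ₗ[ℝ] Eucl 2)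
      = r • LinearMap.id := rfl
    rw [e, LinearMap.det_smul]; simp; positivity

lemma dim1_smul (A : Eucl 1 →L[ℝ] Eucl 1) : ∃ α : ℝ, ∀ w, A w = α • w := by
  refine ⟨(A (EuclideanSpace.single 0 1)) 0, fun w => ?_⟩
  have hw : w = w 0 • EuclideanSpace.single (0 : Fin 1) (1:ℝ) := by
    ext i; fin_cases i; simp
  conv_lhs => rw [hw, map_smul]
  ext i; fin_cases i; simp [mul_comm]

noncomputable def lam (r : ℝ) : ℝ := min 1 (max 0 (4 * r - 3))
lemma lam_cont : Continuous lam := by unfold lam; fun_prop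
lemma lam0 {r : ℝ} (h : r ≤ 3/4) : lam r = 0 := by
  rw [lam, max_eq_left (by linarith), min_eq_right zero_le_one]
lemma lam1 : lam 1 = 1 := by norm_num [lam]
lemma lam_mem (r : ℝ) : 0 ≤ lam r ∧ lam r ≤ 1 :=
  ⟨le_min zero_le_one (le_max_left _ _), min_le_left _ _⟩
lemma lam_mid {r : ℝ} (h : 3/4 ≤ r) (h' : r ≤ 1) : lam r = 4 * r - 3 := by
  rw [lam, max_eq_right (by linarith), min_eq_right (by linarith)]

/-- radial-profile derivative in dimension one -/
lemma deriv1 {ψ : ℝ → ℝ} {ψ' : ℝ} {w : Eucl 1} (hw : w ≠ 0) (h : HasDerivAt ψ ψ' ‖w‖)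
    (hne : ψ ‖w‖ + ‖w‖ * ψ' ≠ 0) :
    ∃ A, InvD 1 A ∧ HasFDerivAt (fun w : Eucl 1 => ψ ‖w‖ • w) A w := by
  have h1 : ∃ B : Eucl 1 →L[ℝ] ℝ, HasFDerivAt (fun w : Eucl 1 => ‖w‖) B w ∧ B w = ‖w‖ := by
    have hd : DifferentiableAt ℝ (fun w : Eucl 1 => ‖w‖) w :=
      (contDiffAt_norm ℝ hw (n := 1)).differentiableAt (by norm_num)
    refine ⟨_, hd.hasFDerivAt, ?_⟩
    exact hd.fderiv_norm_self
  obtain ⟨B, hB, hBw⟩ := h1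
  have h2 := (h.comp_hasFDerivAt w hB).smul (hasFDerivAt_id w)
  obtain ⟨α, hα⟩ := dim1_smul (ψ ‖w‖ • ContinuousLinearMap.id ℝ (Eucl 1) +
    (ψ' • B).smulRight w)
  have hα' : α = ψ ‖w‖ + ‖w‖ * ψ' := by
    have := hα w
    simp [hBw, ← add_smul] at this
    have := smul_left_injective ℝ hw this
    linarith
  refine ⟨α • ContinuousLinearMap.id ℝ _, InvD.smul (hα' ▸ hne) (by norm_num), ?_⟩
  have e : α • ContinuousLinearMap.id ℝ (Eucl 1) = ψ ‖w‖ • ContinuousLinearMap.id ℝ (Eucl 1) +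
    (ψ' • B).smulRight w := by ext1 x; exact (hα x).symm
  rw [e]; exact h2

open Filter Topology Set MeasureTheory Dynamics
open scoped ENNReal

def TauSpec (d : ℕ) (A : Eucl d ≃L[ℝ] Eucl d) (τ : Eucl d → Eucl d) : Prop :=
  Continuous τ ∧ (∀ w, ‖τ w‖ ≤ ‖w‖) ∧ (∀ w, ‖w‖ ≤ 3/4 → τ w = w) ∧
  (∀ w, ‖w‖ = 1 → τ w = ‖A w‖⁻¹ • A w) ∧ (∀ v, ‖v‖ ≤ 1 → ∃ w, ‖w‖ ≤ 1 ∧ τ w = v) ∧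
  (d = 2 → Function.Injective τ) ∧
  (d = 1 → ∀ w, 3/4 < ‖w‖ → ‖w‖ < 1 → ∃ A', InvD d A' ∧ HasFDerivAt τ A' w)

lemma exists_tau1 (A : Eucl 1 ≃L[ℝ] Eucl 1) : ∃ τ, TauSpec 1 A τ := by
  obtain ⟨α, hα⟩ := dim1_smul (A : Eucl 1 →L[ℝ] Eucl 1)
  replace hα : ∀ w, A w = α • w := hα
  rcases lt_trichotomy α 0 with h | h | h
  · refine ⟨fun w => (1 - 2 * lam ‖w‖) • w, ?_, ?_, ?_, ?_, ?_, by norm_num, ?_⟩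
    · have := lam_cont; fun_prop
    · intro w
      rw [norm_smul]
      refine mul_le_of_le_one_left (norm_nonneg _) ?_
      rw [Real.norm_eq_abs, abs_le]; constructor <;> linarith [(lam_mem ‖w‖).1, (lam_mem ‖w‖).2]
    · intro w hw; simp [lam0 hw]
    · intro w hw
      show (1 - 2 * lam ‖w‖) • w = _
      rw [hα, hw, lam1, norm_smul, hw, Real.norm_eq_abs, abs_of_neg h, smul_smul]
      congr 1; rw [mul_one, mul_one, inv_neg, neg_mul, inv_mul_cancel₀ h.ne]; norm_num
    · intro v hv
      by_cases hv0 : v = 0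
      · exact ⟨0, by simp, by simp [hv0]⟩
      have hvp : 0 < ‖v‖ := norm_pos_iff.2 hv0
      have hc : ContinuousOn (fun s : ℝ => (1 - 2 * lam s) * s) (Icc 0 1) := by
        have := lam_cont; fun_prop
      obtain ⟨s, hs, hs'⟩ := intermediate_value_Icc' zero_le_one hc
        (show -‖v‖ ∈ Icc _ _ by
          simp only [lam1, lam0 (show (0:ℝ) ≤ 3/4 by norm_num)]
          constructor <;> linarith)
      have hn : ‖(-(s / ‖v‖)) • v‖ = s := by
        rw [norm_smul, norm_neg, Real.norm_of_nonneg (div_nonneg hs.1 hvp.le)]; field_simp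
      refine ⟨(-(s / ‖v‖)) • v, hn.trans_le hs.2, ?_⟩
      simp only [hn]; simp only at hs'
      rw [smul_smul, show (1 - 2 * lam s) * -(s / ‖v‖) = -((1 - 2 * lam s) * s) / ‖v‖ by ring, hs',
        neg_neg, div_self hvp.ne', one_smul]
    · intro _ w h1 h2
      refine deriv1 (ψ := fun r => 1 - 2 * lam r) (ψ' := -8) (by rintro rfl; norm_num at h1) ?_ ?_
      · have h3 : HasDerivAt (fun r : ℝ => 7 - 8 * r) (-8) ‖w‖ := by
          simpa using ((hasDerivAt_id ‖w‖).const_mul 8).const_sub 7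
        refine h3.congr_of_eventuallyEq ?_
        filter_upwards [Ioo_mem_nhds h1 h2] with r hr
        rw [lam_mid hr.1.le hr.2.le]; ring
      · rw [lam_mid h1.le h2.le]; intro h; linarith
  · exfalso
    have := (A.injective (by simp [hα, h] : A (EuclideanSpace.single 0 1) = A 0))
    simpa using congrArg norm this
  · refine ⟨id, continuous_id, fun _ => le_rfl, fun _ _ => rfl, fun w hw => ?_,
      fun v hv => ⟨v, hv, rfl⟩, by norm_num, fun _ w _ _ => ⟨_, InvD.id, hasFDerivAt_id w⟩⟩
    rw [hα, norm_smul, hw, Real.norm_eq_abs, abs_of_pos h, smul_smul]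
    simp [h.ne']

lemma exists_tau2 (A : Eucl 2 ≃L[ℝ] Eucl 2)
    (hA : 0 < LinearMap.det ((A : Eucl 2 →L[ℝ] Eucl 2) : Eucl 2 →ₗ[ℝ] Eucl 2)) :
    ∃ τ, TauSpec 2 A τ := by
  obtain ⟨Γ, hc, h0, h1, hi⟩ := path2 A hA
  have hi' : ∀ r : ℝ, Function.Injective (Γ (lam r)) := fun r => hi _ (lam_mem r).1 (lam_mem r).2
  have hne : ∀ (r : ℝ) (w : Eucl 2), w ≠ 0 → Γ (lam r) w ≠ 0 := fun r w hw h =>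
    hw (hi' r (h.trans (map_zero _).symm))
  have hid : ∀ w : Eucl 2, ‖w‖ ≤ 3/4 → ‖w‖ • (‖Γ (lam ‖w‖) w‖⁻¹ • Γ (lam ‖w‖) w) = w := by
    intro w hw
    rw [lam0 hw, h0, smul_smul]
    by_cases h : w = 0
    · simp [h]
    · rw [mul_inv_cancel₀ (norm_ne_zero_iff.2 h), one_smul]
  have hnorm : ∀ w : Eucl 2, ‖‖w‖ • (‖Γ (lam ‖w‖) w‖⁻¹ • Γ (lam ‖w‖) w)‖ = ‖w‖ := by
    intro w
    by_cases h : w = 0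
    · simp [h]
    · rw [norm_smul, norm_smul, norm_inv, norm_norm, norm_norm,
        inv_mul_cancel₀ (norm_ne_zero_iff.2 (hne _ w h)), mul_one]
  refine ⟨fun w => ‖w‖ • (‖Γ (lam ‖w‖) w‖⁻¹ • Γ (lam ‖w‖) w), ?_, fun w => (hnorm w).le, hid,
    ?_, ?_, ?_, by norm_num⟩
  · rw [continuous_iff_continuousAt]
    intro w
    by_cases h : w = 0
    · subst h
      refine continuousAt_id.congr ?_
      filter_upwards [Metric.closedBall_mem_nhds (0 : Eucl 2) (show (0:ℝ) < 3/4 by norm_num)] with w hw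
      exact (hid w (by simpa using hw)).symm
    · have h2 : Continuous fun w : Eucl 2 => Γ (lam ‖w‖) w :=
        hc.comp ((lam_cont.comp continuous_norm).prodMk continuous_id)
      exact continuous_norm.continuousAt.smul
        ((h2.continuousAt.norm.inv₀ (norm_ne_zero_iff.2 (hne _ w h))).smul h2.continuousAt)
  · intro w hw; simp only [hw, lam1, h1, one_smul]
  · intro v hv
    by_cases hv0 : v = 0
    · exact ⟨0, by simp, by simp [hv0]⟩
    obtain ⟨u, hu⟩ := (LinearMap.injective_iff_surjective.1 (hi' ‖v‖)) v
    have hu0 : u ≠ 0 := by rintro rfl; rw [map_zero] at hu; exact hv0 hu.symm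
    have hvp : 0 < ‖v‖ := norm_pos_iff.2 hv0
    have hup : 0 < ‖u‖ := norm_pos_iff.2 hu0
    have hn : ‖(‖v‖ / ‖u‖) • u‖ = ‖v‖ := by
      rw [norm_smul, Real.norm_of_nonneg (by positivity)]; field_simp
    refine ⟨(‖v‖ / ‖u‖) • u, hn.trans_le hv, ?_⟩
    simp only [hn, map_smul, hu, norm_smul, Real.norm_of_nonneg (div_nonneg hvp.le hup.le),
      smul_smul]
    rw [show ‖v‖ * ((‖v‖ / ‖u‖ * ‖v‖)⁻¹ * (‖v‖ / ‖u‖)) = 1 by field_simp, one_smul]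
  · intro _ w w' h
    simp only at h
    have hn : ‖w‖ = ‖w'‖ := by rw [← hnorm w, h, hnorm]
    by_cases hw : w = 0
    · subst hw; symm; simpa using hn.symm
    have hw' : w' ≠ 0 := by rintro rfl; simp at hn; exact hw hn
    have hp := norm_pos_iff.2 hw'
    rw [← hn] at hp h
    have h2 := smul_right_injective _ hp.ne' h
    simp only [← map_smul] at h2
    have h3 := hi' _ h2
    have p1 := norm_pos_iff.2 (hne ‖w‖ w hw)
    have p2 := norm_pos_iff.2 (hne ‖w‖ w' hw')
    have h4 := congrArg norm h3
    rw [norm_smul, norm_smul, norm_inv, norm_norm, norm_inv, norm_norm, ← hn] at h4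
    have h5 := mul_right_cancel₀ hp.ne' h4
    rw [h5] at h3
    exact smul_right_injective _ (inv_pos.2 p2).ne' h3

lemma exists_tau {d : ℕ} (hd : d = 1 ∨ d = 2) (A : Eucl d ≃L[ℝ] Eucl d)
    (hA : d = 2 → 0 < LinearMap.det ((A : Eucl d →L[ℝ] Eucl d) : Eucl d →ₗ[ℝ] Eucl d)) :
    ∃ τ, TauSpec d A τ := by
  rcases hd with rfl | rfl
  · exact exists_tau1 A
  · exact exists_tau2 A (hA rfl)

lemma exists_g {d : ℕ} (hd : d = 1 ∨ d = 2) (A : Eucl d ≃L[ℝ] Eucl d)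
    (hA : d = 2 → 0 < LinearMap.det ((A : Eucl d →L[ℝ] Eucl d) : Eucl d →ₗ[ℝ] Eucl d))
    {C : Set (Eucl d)} (hC : IsClosed C) (hCs : ∀ w ∈ C, ‖w‖ < 1/4) (h0 : (0 : Eucl d) ∈ C)
    {ins : Eucl d → Eucl d} (ic : Continuous ins) (iid : ∀ w, w ∉ C → ins w = w)
    (imaps : ∀ w ∈ C, ins w ∈ C) (isurj : ∀ w ∈ C, ∃ w' ∈ C, ins w' = w)
    (iinj : d = 2 → Function.Injective ins) :
    ∃ (g : Eucl d → Eucl d) (N : Eucl d → ℝ), Continuous g ∧ (∀ w, ‖w‖ ≤ 1 → ‖g w‖ ≤ 1) ∧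
      (∀ w, ‖w‖ ≤ 1 → ∃ w', ‖w'‖ ≤ 1 ∧ g w' = w) ∧
      (∀ w, ‖w‖ = 1 → g w = ‖A w‖⁻¹ • A w) ∧
      (d = 2 → InjOn g (Metric.closedBall 0 1)) ∧ Continuous N ∧ (∀ w ∈ C, g w = ins w) ∧
      (∀ w, w ∉ C → ‖w‖ < 1 → N w < ‖w‖ ∧ (g w ∈ C ∨ ‖g w‖ ≤ N w)) ∧
      (∀ w, w ∉ C → ‖w‖ ≤ 3/4 → g w ∉ C ∧ ‖g w‖ ≤ 3/4) ∧
      (d = 1 → ∀ w, w ∉ C → ‖w‖ < 1 → (g w ∉ C ∧ ‖g w‖ ≤ 3/4) ∨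
        ∃ (pre : Eucl d → Eucl d) (A' : Eucl d →L[ℝ] Eucl d), InvD d A' ∧ HasFDerivAt pre A' w ∧
          ∀ w, g w = ins (pre w)) := by
  obtain ⟨τ, tc, tn, tid, tsph, tsurj, tinj, tdiff⟩ := exists_tau hd A hA
  set Z : Set (Eucl d) := C ∪ {w | 1 ≤ ‖w‖} with hZ
  have hZc : IsClosed Z := hC.union (isClosed_le continuous_const continuous_norm)
  have hZn : Z.Nonempty := ⟨0, Or.inl h0⟩
  set δ : Eucl d → ℝ := fun w => Metric.infDist w Z with hδ
  have δ0 : ∀ w, 0 ≤ δ w := fun w => Metric.infDist_nonneg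
  have δz : ∀ w, w ∈ Z ↔ δ w = 0 := fun w => hZc.mem_iff_infDist_zero hZn
  have δle : ∀ w, δ w ≤ ‖w‖ := fun w => by
    simpa using Metric.infDist_le_dist_of_mem (x := w) (show (0 : Eucl d) ∈ Z from Or.inl h0)
  have δc : Continuous δ := Metric.continuous_infDist_pt _
  have δlip : ∀ w w', |δ w - δ w'| ≤ ‖w - w'‖ := fun w w' => by
    have h1 := Metric.infDist_le_infDist_add_dist (s := Z) (x := w) (y := w')
    have h2 := Metric.infDist_le_infDist_add_dist (s := Z) (x := w') (y := w)
    rw [dist_comm] at h2; rw [dist_eq_norm] at h1 h2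
    rw [abs_le]; constructor <;> simp only [hδ] <;> linarith
  have δ1 : ∀ w, δ w ≤ 1 := fun w => by
    by_cases h : 1 ≤ ‖w‖
    · rw [(δz w).1 (Or.inr h)]; norm_num
    · exact (δle w).trans (not_le.1 h).le
  set b : Eucl d → Eucl d := fun w => (1 - δ w / 4) • w with hb
  have bc : Continuous b := by fun_prop
  have bn : ∀ w, ‖b w‖ = (1 - δ w / 4) * ‖w‖ := fun w => by
    rw [hb, norm_smul, Real.norm_of_nonneg (by linarith [δ1 w])]
  have bz : ∀ w ∈ Z, b w = w := fun w hw => by simp [hb, (δz w).1 hw]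
  have ble : ∀ w, ‖b w‖ ≤ ‖w‖ := fun w => by
    rw [bn]; exact mul_le_of_le_one_left (norm_nonneg _) (by linarith [δ0 w])
  have binj : InjOn b (Metric.closedBall 0 1) := by
    intro w hw w' hw' h
    have e : w - w' = (δ w / 4) • (w - w') + ((δ w - δ w') / 4) • w' := by
      have : (1 - δ w / 4) • w - (1 - δ w' / 4) • w' = 0 := sub_eq_zero.2 h
      rw [← sub_eq_zero, ← this]; module
    have h1 : ‖w - w'‖ ≤ δ w / 4 * ‖w - w'‖ + |δ w - δ w'| / 4 * ‖w'‖ := by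
      conv_lhs => rw [e]
      refine (norm_add_le _ _).trans (le_of_eq ?_)
      rw [norm_smul, norm_smul, Real.norm_of_nonneg (by linarith [δ0 w]), Real.norm_eq_abs,
        abs_div, abs_of_pos (show (0:ℝ) < 4 by norm_num)]
    have h2 : |δ w - δ w'| * ‖w'‖ ≤ ‖w - w'‖ * 1 :=
      mul_le_mul (δlip _ _) (by simpa using hw') (norm_nonneg _) (norm_nonneg _)
    have h3 : δ w * ‖w - w'‖ ≤ ‖w - w'‖ := mul_le_of_le_one_left (norm_nonneg _) (δ1 w)
    have : ‖w - w'‖ ≤ 0 := by nlinarith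
    exact sub_eq_zero.1 (norm_le_zero_iff.1 this)
  have bsurj : ∀ v, ‖v‖ ≤ 1 → ∃ w, ‖w‖ ≤ 1 ∧ b w = v := by
    intro v hv
    by_cases hv0 : v = 0
    · exact ⟨0, by simp, by simp [hb, hv0]⟩
    have hp := norm_pos_iff.2 hv0
    have hc : ContinuousOn (fun t : ℝ => (1 - δ (t • v) / 4) * t) (Icc 0 ‖v‖⁻¹) := by fun_prop
    have hz : δ (‖v‖⁻¹ • v) = 0 := (δz _).1 (Or.inr (by
      rw [mem_ofPred_eq, norm_smul, norm_inv, norm_norm, inv_mul_cancel₀ hp.ne']))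
    obtain ⟨t, ht, ht'⟩ := intermediate_value_Icc (inv_pos.2 hp).le hc (show (1:ℝ) ∈ Icc _ _ by
      simp only [hz]; constructor
      · norm_num
      · simpa using (one_le_inv₀ hp).2 hv)
    refine ⟨t • v, ?_, ?_⟩
    · rw [norm_smul, Real.norm_of_nonneg ht.1]
      calc _ ≤ ‖v‖⁻¹ * ‖v‖ := by gcongr; exact ht.2
        _ = 1 := inv_mul_cancel₀ hp.ne'
    · simp only at ht'
      rw [hb]; simp only; rw [smul_smul, ht', one_smul]
  have bC : ∀ w, w ∉ C → ‖w‖ ≤ 1 → b w ∉ C := fun w hw h1 h => by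
    have h2 := binj (by simpa using (ble w).trans h1) (by simpa using h1) (bz (b w) (Or.inl h))
    exact hw (h2 ▸ h)
  have iC : ∀ w, ins w ∈ C ↔ w ∈ C := fun w =>
    ⟨fun h => by by_contra h'; exact h' (iid w h' ▸ h), imaps w⟩
  have in1 : ∀ w, ‖w‖ ≤ 1 → ‖ins w‖ ≤ 1 := fun w hw => by
    by_cases h : w ∈ C
    · linarith [hCs _ (imaps w h)]
    · rwa [iid w h]
  have dead : ∀ w, w ∉ C → ‖w‖ ≤ 1 → ‖b w‖ ≤ 3/4 →
      ins (τ (b w)) ∉ C ∧ ‖ins (τ (b w))‖ ≤ 3/4 := fun w hw h1 h2 => by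
    have := bC w hw h1
    rw [tid _ h2, iid _ this]; exact ⟨this, h2⟩
  have isph : ∀ w, ‖w‖ = 1 → w ∉ C := fun w hw h => by linarith [hCs w h]
  refine ⟨fun w => ins (τ (b w)), fun w => ‖b w‖, by fun_prop, fun w hw => ?_, fun w hw => ?_,
    fun w hw => ?_, fun h2 => ?_, by fun_prop, fun w hw => ?_, fun w hw hw1 => ?_,
    fun w hw hw1 => dead w hw (by linarith) ((ble w).trans hw1), fun h1 w hw hw1 => ?_⟩
  · exact in1 _ ((tn _).trans ((ble w).trans hw))
  · obtain ⟨w1, h1, h1'⟩ : ∃ w1, ‖w1‖ ≤ 1 ∧ ins w1 = w := by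
      by_cases h : w ∈ C
      · obtain ⟨w', h', e⟩ := isurj w h
        exact ⟨w', by linarith [hCs w' h'], e⟩
      · exact ⟨w, hw, iid w h⟩
    obtain ⟨w2, h2, h2'⟩ := tsurj w1 h1
    obtain ⟨w3, h3, h3'⟩ := bsurj w2 h2
    exact ⟨w3, h3, by simp only [h3', h2', h1']⟩
  · have h1 : b w = w := bz w (Or.inr hw.ge)
    simp only [h1]
    have h2 : ‖τ w‖ = 1 := by
      rw [tsph w hw, norm_smul, norm_inv, norm_norm, inv_mul_cancel₀]
      rw [Ne, norm_eq_zero, EmbeddingLike.map_eq_zero_iff]; rintro rfl; simp at hw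
    rw [iid _ (isph _ h2), tsph w hw]
  · intro w hw w' hw' h
    exact binj hw hw' (tinj h2 (iinj h2 h))
  · have h1 : b w = w := bz w (Or.inl hw)
    simp only [h1, tid w (by linarith [hCs w hw])]
  · have hz : 0 < δ w := lt_of_le_of_ne (δ0 w) fun h => by
      rcases (δz w).2 h.symm with h | h
      · exact hw h
      · exact absurd hw1 (not_lt.2 h)
    have hp : 0 < ‖w‖ := hz.trans_le (δle w)
    refine ⟨?_, ?_⟩
    · simp only [bn]; nlinarith
    · by_cases h : τ (b w) ∈ C
      · exact Or.inl (imaps _ h)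
      · right; simp only [iid _ h]; exact tn _
  · by_cases h : ‖b w‖ ≤ 3/4
    · exact Or.inl (dead w hw hw1.le h)
    right
    push Not at h
    have hbw := (ble w).trans_lt hw1
    obtain ⟨A1, hA1, hA1'⟩ := tdiff h1 (b w) h hbw
    subst h1
    have hw34 : 3/4 < ‖w‖ := h.trans_le (ble w)
    have hloc : ∀ w : Eucl 1, 3/4 < ‖w‖ → ‖w‖ < 1 → δ w = 1 - ‖w‖ := by
      intro w h1 h2
      apply le_antisymm
      · have := Metric.infDist_le_dist_of_mem (x := w) (s := Z) (y := ‖w‖⁻¹ • w) (Or.inr (by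
          rw [mem_ofPred_eq, norm_smul, norm_inv, norm_norm, inv_mul_cancel₀ (by linarith)]))
        refine this.trans_eq ?_
        rw [dist_comm, dist_eq_norm, show ‖w‖⁻¹ • w - w = (‖w‖⁻¹ - 1) • w by module, norm_smul,
          Real.norm_of_nonneg (sub_nonneg.2 ((one_le_inv₀ (by linarith)).2 h2.le)), sub_mul,
          inv_mul_cancel₀ (by linarith), one_mul]
      · refine (Metric.le_infDist hZn).2 fun z hz => ?_
        rw [dist_eq_norm]
        rcases hz with hz | hz
        · have := norm_sub_norm_le w z; linarith [hCs z hz]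
        · have := norm_sub_norm_le z w; rw [norm_sub_rev] at this
          have hz : 1 ≤ ‖z‖ := hz
          linarith
    obtain ⟨A2, hA2, hA2'⟩ := deriv1 (w := w) (ψ := fun r => 1 - (1 - r) / 4) (ψ' := 1/4)
      (by rintro rfl; norm_num at hw34)
      (by have h := (((hasDerivAt_id ‖w‖).const_sub 1).div_const 4).const_sub 1
          norm_num at h; norm_num; exact h)
      (by intro h; nlinarith)
    have hA3 : HasFDerivAt b A2 w := by
      refine hA2'.congr_of_eventuallyEq ?_
      have o : IsOpen {w : Eucl 1 | 3/4 < ‖w‖ ∧ ‖w‖ < 1} :=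
        (isOpen_lt continuous_const continuous_norm).inter (isOpen_lt continuous_norm continuous_const)
      filter_upwards [o.mem_nhds ⟨hw34, hw1⟩] with v hv
      simp only [hb, hloc v hv.1 hv.2]
    exact ⟨τ ∘ b, A1.comp A2, hA1.comp hA2, hA1'.comp w hA3, fun _ => rfl⟩

open Filter Topology Set MeasureTheory Dynamics
open scoped ENNReal

structure XT (d : ℕ) (T : Eucl d → Eucl d) : Prop where
  cont : Continuous T
  far : ∀ x, 1 ≤ ‖x‖ → T x = x
  maps : ∀ x, ‖x‖ ≤ 1 → ‖T x‖ ≤ 1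
  surj : ∀ x, ‖x‖ ≤ 1 → ∃ x', ‖x'‖ ≤ 1 ∧ T x' = x
  inj : d = 2 → Function.Injective T

lemma XT.iter {d : ℕ} {T : Eucl d → Eucl d} (h : XT d T) (n : ℕ) : XT d T^[n] := by
  induction n with
  | zero => exact ⟨continuous_id, fun _ _ => rfl, fun _ h => h, fun x h => ⟨x, h, rfl⟩,
      fun _ => Function.injective_id⟩
  | succ n ih =>
    refine ⟨ih.cont.comp h.cont, fun x hx => ?_, fun x hx => ?_, fun x hx => ?_,
      fun h2 => (ih.inj h2).comp (h.inj h2)⟩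
    · rw [Function.iterate_succ_apply, h.far x hx, ih.far x hx]
    · rw [Function.iterate_succ_apply]; exact ih.maps _ (h.maps x hx)
    · obtain ⟨y, hy, e⟩ := ih.surj x hx
      obtain ⟨z, hz, e'⟩ := h.surj y hy
      exact ⟨z, hz, by rw [Function.iterate_succ_apply, e', e]⟩

structure KD (d : ℕ) extends QD d where
  hd : d = 1 ∨ d = 2
  ft : Eucl d → Eucl d
  ft_ext : XT d ft
  nx : ℕ → ℕ
  ft_q : ∀ k, ft (q k) = q (nx k)
  preQ : ∀ x k, ft x = q k → ∃ j, x = q j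
  A : ℕ → Eucl d ≃L[ℝ] Eucl d
  hA : ∀ k, HasFDerivAt ft (A k : Eucl d →L[ℝ] Eucl d) (q k)
  hdet : ∀ k, d = 2 → 0 < LinearMap.det ((A k : Eucl d →L[ℝ] Eucl d) : Eucl d →ₗ[ℝ] Eucl d)
  κ : ℕ → ℕ → ℕ
  per : ℕ → ℕ
  ξ : ℕ → ℕ
  χ : ℕ → Eucl d → Eucl d
  P : ℕ → Set (Eucl d)
  per_pos : ∀ m, 0 < per m
  ξ_pos : ∀ m, 0 < ξ m
  χ_ext : ∀ m, XT d (χ m)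
  κ_succ : ∀ m i, nx (κ m i) = κ m (i + 1)
  κ_per : ∀ m i, κ m (i + per m) = κ m i
  κ_inj : ∀ m i j, i < per m → j < per m → κ m i = κ m j → i = j
  fin : ∀ k, {m | ∃ i, κ m i = k}.Finite
  evper : ∀ k, ∃ n m i, nx^[n] k = κ m i
  P_back : ∀ m x, χ m x ∈ P m → x ∈ P m
  P_fwd : ∀ m x, x ∈ P m → χ m x ∈ P m
  P_lt : ∀ m x, x ∈ P m → ‖x‖ < 1
  P_diff : ∀ m x, x ∈ P m → ∃ A', InvD d A' ∧ HasFDerivAt (χ m) A' x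

namespace KD
variable {d : ℕ} (Q : KD d)

def Pk (k : ℕ) : Prop := ∃ m i, Q.κ m i = k

lemma κ_add (m i n) : Q.nx^[n] (Q.κ m i) = Q.κ m (i + n) := by
  induction n with
  | zero => rfl
  | succ n ih => rw [Function.iterate_succ_apply', ih, Q.κ_succ]; rfl
lemma κ_mul (m i n) : Q.κ m (i + n * Q.per m) = Q.κ m i := by
  induction n with
  | zero => simp
  | succ n ih => rw [Nat.succ_mul, ← add_assoc, Q.κ_per, ih]
lemma κ_mod (m i) : Q.κ m (i % Q.per m) = Q.κ m i := by
  conv_rhs => rw [← Nat.mod_add_div' i (Q.per m), Q.κ_mul]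
lemma cls {m m' i j} (h : Q.κ m i = Q.κ m' j) (i') : ∃ j', Q.κ m i' = Q.κ m' j' := by
  obtain ⟨n, hn⟩ : ∃ n, i' + i * Q.per m = i + n :=
    Nat.exists_eq_add_of_le ((Nat.le_mul_of_pos_right i (Q.per_pos m)).trans (Nat.le_add_left _ _))
  exact ⟨j + n, by rw [← Q.κ_add, ← h, Q.κ_add, ← hn, Q.κ_mul]⟩
lemma cls_lt {k} (h : Q.Pk k) : ∃ m i, i < Q.per m ∧ Q.κ m i = k := by
  obtain ⟨m, i, rfl⟩ := h
  exact ⟨m, _, Nat.mod_lt _ (Q.per_pos m), Q.κ_mod m i⟩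
lemma Pk_ret {k n} (hn : 1 ≤ n) (h : Q.nx^[n] k = k) : Q.Pk k := by
  obtain ⟨j, m, i, e⟩ := Q.evper k
  have h1 : Q.nx^[n * j] k = k := by
    rw [Function.iterate_mul]; exact Function.iterate_fixed h j
  obtain ⟨l, hl⟩ := Nat.exists_eq_add_of_le (Nat.le_mul_of_pos_left j hn)
  rw [hl, add_comm, Function.iterate_add_apply, e, Q.κ_add] at h1
  exact ⟨m, _, h1⟩

open Classical in
noncomputable def e (m : ℕ) : Eucl d :=
  if ∀ m' < m, ∀ i j, Q.κ m' i ≠ Q.κ m j then 0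
  else (1/8 * (1 - (1/2)^m) : ℝ) • (WithLp.toLp 2 (fun i : Fin d => if (i : ℕ) = 0 then (1:ℝ) else 0) : Eucl d)
noncomputable def ρ (_ : KD d) (m : ℕ) : ℝ := (1/2)^m / 64

lemma norm_v0 (hd : d = 1 ∨ d = 2) :
    ‖(WithLp.toLp 2 (fun i : Fin d => if (i : ℕ) = 0 then (1:ℝ) else 0) : Eucl d)‖ = 1 := by
  rcases hd with rfl | rfl <;> simp [EuclideanSpace.norm_eq]

lemma ρ_pos (m) : 0 < Q.ρ m := by unfold ρ; positivity
lemma ρ_le (m) : Q.ρ m ≤ 1/64 := by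
  unfold ρ; have : ((1:ℝ)/2)^m ≤ 1 := pow_le_one₀ (by norm_num) (by norm_num)
  linarith
lemma e_le (m) : ‖Q.e m‖ ≤ 1/8 := by
  unfold e
  have h1 : ((1:ℝ)/2)^m ≤ 1 := pow_le_one₀ (by norm_num) (by norm_num)
  have h2 : 0 < ((1:ℝ)/2)^m := by positivity
  split_ifs
  · simp
  · rw [norm_smul, norm_v0 Q.hd, Real.norm_of_nonneg (by linarith)]; linarith

def B (m : ℕ) : Set (Eucl d) := Metric.closedBall (Q.e m) (Q.ρ m)
lemma B_lt {m w} (h : w ∈ Q.B m) : ‖w‖ < 1/4 := by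
  have h1 : ‖w - Q.e m‖ ≤ Q.ρ m := by simpa [B, dist_eq_norm] using h
  have := norm_sub_norm_le w (Q.e m)
  linarith [Q.ρ_le m, Q.e_le m]
lemma B_coord {m w} : w ∈ Q.B m ↔ ‖(Q.ρ m)⁻¹ • (w - Q.e m)‖ ≤ 1 := by
  rw [norm_smul, norm_inv, Real.norm_of_nonneg (Q.ρ_pos m).le, inv_mul_le_iff₀ (Q.ρ_pos m), mul_one,
    B, Metric.mem_closedBall, dist_eq_norm]
lemma coord (m w) : Q.e m + Q.ρ m • ((Q.ρ m)⁻¹ • (w - Q.e m)) = w := by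
  rw [smul_smul, mul_inv_cancel₀ (Q.ρ_pos m).ne']; simp
lemma coord' (m x) : (Q.ρ m)⁻¹ • (Q.e m + Q.ρ m • x - Q.e m) = x := by
  rw [add_sub_cancel_left, smul_smul, inv_mul_cancel₀ (Q.ρ_pos m).ne', one_smul]
lemma B_iff {m w} : w ∈ Q.B m ↔ ∃ x, ‖x‖ ≤ 1 ∧ w = Q.e m + Q.ρ m • x :=
  ⟨fun h => ⟨_, Q.B_coord.1 h, (Q.coord m w).symm⟩, fun ⟨x, hx, e⟩ => by
    rw [B_coord, e, coord']; exact hx⟩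

lemma e_sep {m m' : ℕ} (hlt : m < m') {i j} (h : Q.κ m i = Q.κ m' j) :
    Q.ρ m + Q.ρ m' < ‖Q.e m - Q.e m'‖ := by
  have hn := norm_v0 Q.hd
  have e2 : Q.e m' = _ := if_neg (fun H => H m hlt _ _ h)
  have p1 : 0 < ((1:ℝ)/2)^m := by positivity
  have p2 : ((1:ℝ)/2)^m' ≤ (1/2)^(m+1) := pow_le_pow_of_le_one (by norm_num) (by norm_num) hlt
  have p3 : ((1:ℝ)/2)^m ≤ 1 := pow_le_one₀ (by norm_num) (by norm_num)
  rw [pow_succ] at p2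
  rw [e2]
  unfold ρ e
  split_ifs
  · rw [zero_sub, norm_neg, norm_smul, hn, Real.norm_of_nonneg (by linarith)]; linarith
  · rw [← sub_smul, norm_smul, hn, Real.norm_eq_abs, abs_of_neg (by linarith)]; linarith

lemma B_disj {m m' i j w} (h : Q.κ m i = Q.κ m' j) (hw : w ∈ Q.B m) (hw' : w ∈ Q.B m') : m = m' := by
  by_contra hne
  simp only [B, Metric.mem_closedBall] at hw hw'
  have := dist_triangle_left (Q.e m) (Q.e m') w
  rw [dist_eq_norm (Q.e m)] at this
  rcases lt_or_gt_of_ne hne with h' | h'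
  · linarith [Q.e_sep h' h]
  · rw [norm_sub_rev] at this; linarith [Q.e_sep h' h.symm]

def C (k : ℕ) : Set (Eucl d) := {w | ∃ m i, Q.κ m i = k ∧ w ∈ Q.B m}

lemma C_closed (k) : IsClosed (Q.C k) := by
  have : Q.C k = ⋃ m ∈ {m | ∃ i, Q.κ m i = k}, Q.B m := by
    ext w; simp [C]
  rw [this]
  exact (Q.fin k).isClosed_biUnion fun m _ => Metric.isClosed_closedBall
lemma C_nx {k} (h : Q.Pk k) : Q.C (Q.nx k) = Q.C k := by
  obtain ⟨m, i, rfl⟩ := h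
  rw [Q.κ_succ]
  ext w
  constructor <;> rintro ⟨m', j, e, hw⟩
  · obtain ⟨j', e'⟩ := Q.cls e.symm i; exact ⟨m', j', e'.symm, hw⟩
  · obtain ⟨j', e'⟩ := Q.cls e.symm (i+1); exact ⟨m', j', e'.symm, hw⟩
lemma C0 {k} (h : Q.Pk k) : (0 : Eucl d) ∈ Q.C k := by
  classical
  obtain ⟨i, e⟩ := Nat.find_spec h
  refine ⟨Nat.find h, i, e, ?_⟩
  have : Q.e (Nat.find h) = 0 := if_pos fun m' hm' i' j' h' => by
    obtain ⟨j2, e2⟩ := Q.cls h'.symm i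
    exact Nat.find_min h hm' ⟨j2, e2 ▸ e⟩
  simp [B, this, (Q.ρ_pos _).le]

noncomputable def hm (m : ℕ) (w : Eucl d) : Eucl d :=
  Q.e m + Q.ρ m • (Q.χ m)^[Q.ξ m] ((Q.ρ m)⁻¹ • (w - Q.e m))

lemma hm_off {m w} (h : w ∉ Q.B m) : Q.hm m w = w := by
  rw [B_coord, not_le] at h
  rw [hm, ((Q.χ_ext m).iter _).far _ h.le, coord]
lemma hm_maps {m w} (h : w ∈ Q.B m) : Q.hm m w ∈ Q.B m :=
  Q.B_iff.2 ⟨_, ((Q.χ_ext m).iter _).maps _ (Q.B_coord.1 h), rfl⟩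
lemma hm_cont (m) : Continuous (Q.hm m) := by
  have := ((Q.χ_ext m).iter (Q.ξ m)).cont
  unfold hm; fun_prop

open Classical in
noncomputable def ins (k : ℕ) (w : Eucl d) : Eucl d :=
  w + ∑ m ∈ (Q.fin k).toFinset with Q.κ m (Q.per m - 1) = k, (Q.hm m w - w)

lemma ins_on {k m w} (h : Q.κ m (Q.per m - 1) = k) (hw : w ∈ Q.B m) : Q.ins k w = Q.hm m w := by
  classical
  rw [ins, Finset.sum_eq_single_of_mem m]
  · abel
  · simp only [Finset.mem_filter, Finite.mem_toFinset]; exact ⟨⟨_, h⟩, h⟩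
  · intro m' hm' hne
    simp only [Finset.mem_filter, Finite.mem_toFinset] at hm'
    rw [Q.hm_off, sub_self]
    exact fun hw' => hne (Q.B_disj (hm'.2.trans h.symm) hw' hw)
lemma ins_off {k w} (h : ∀ m, Q.κ m (Q.per m - 1) = k → w ∉ Q.B m) : Q.ins k w = w := by
  classical
  rw [ins, Finset.sum_eq_zero, add_zero]
  intro m hm
  simp only [Finset.mem_filter, Finite.mem_toFinset] at hm
  rw [Q.hm_off (h m hm.2), sub_self]
lemma ins_cont (k) : Continuous (Q.ins k) := by
  have := Q.hm_cont
  unfold ins; fun_prop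
lemma ins_mid {k m i w} (h : Q.κ m i = k) (hk : Q.κ m (Q.per m - 1) ≠ k) (hw : w ∈ Q.B m) :
    Q.ins k w = w := Q.ins_off fun m' h' hw' => by
  obtain rfl := Q.B_disj (h.trans h'.symm) hw hw'; exact hk h'
lemma ins_B {k m i w} (h : Q.κ m i = k) (hw : w ∈ Q.B m) : Q.ins k w ∈ Q.B m := by
  by_cases hk : Q.κ m (Q.per m - 1) = k
  · rw [Q.ins_on hk hw]; exact Q.hm_maps hw
  · rwa [Q.ins_mid h hk hw]
lemma ins_id {k w} (h : w ∉ Q.C k) : Q.ins k w = w :=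
  Q.ins_off fun m hm hw => h ⟨m, _, hm, hw⟩
lemma ins_surj {k w} (h : w ∈ Q.C k) : ∃ w' ∈ Q.C k, Q.ins k w' = w := by
  obtain ⟨m, i, e, hw⟩ := h
  by_cases hk : Q.κ m (Q.per m - 1) = k
  · obtain ⟨x, hx, hx'⟩ := ((Q.χ_ext m).iter (Q.ξ m)).surj _ (Q.B_coord.1 hw)
    have hB : Q.e m + Q.ρ m • x ∈ Q.B m := Q.B_iff.2 ⟨x, hx, rfl⟩
    exact ⟨_, ⟨m, i, e, hB⟩, by rw [Q.ins_on hk hB, hm, coord', hx', coord]⟩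
  · exact ⟨w, ⟨m, i, e, hw⟩, Q.ins_mid e hk hw⟩
lemma ins_inj (h2 : d = 2) (k) : Function.Injective (Q.ins k) := by
  have key : ∀ w w', w ∈ Q.C k → Q.ins k w = Q.ins k w' → w = w' := by
    rintro w w' ⟨m, i, e, hw⟩ h
    have h1 := Q.ins_B e hw
    have hw' : w' ∈ Q.B m := by
      by_cases hc : w' ∈ Q.C k
      · obtain ⟨m', i', e', hw'⟩ := hc
        have h3 := Q.ins_B e' hw'
        rw [← h] at h3
        rwa [Q.B_disj (e.trans e'.symm) h1 h3]
      · rwa [h, Q.ins_id hc] at h1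
    by_cases hk : Q.κ m (Q.per m - 1) = k
    · rw [Q.ins_on hk hw, Q.ins_on hk hw', hm, hm] at h
      have h3 := smul_right_injective _ (Q.ρ_pos m).ne' (add_left_cancel h)
      have h4 := smul_right_injective _ (inv_pos.2 (Q.ρ_pos m)).ne'
        (((Q.χ_ext m).iter (Q.ξ m)).inj h2 h3)
      exact sub_left_injective h4
    · rwa [Q.ins_mid e hk hw, Q.ins_mid e hk hw'] at h
  intro w w' h
  by_cases hc : w ∈ Q.C k
  · exact key w w' hc h
  by_cases hc' : w' ∈ Q.C k
  · exact (key w' w hc' h.symm).symm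
  · rwa [Q.ins_id hc, Q.ins_id hc'] at h
lemma iter_diff (m n) {x} (hx : x ∈ Q.P m) :
    (Q.χ m)^[n] x ∈ Q.P m ∧ ∃ A', InvD d A' ∧ HasFDerivAt (Q.χ m)^[n] A' x := by
  induction n with
  | zero => exact ⟨hx, _, InvD.id, hasFDerivAt_id x⟩
  | succ n ih =>
    obtain ⟨h1, A1, i1, d1⟩ := ih
    obtain ⟨A2, i2, d2⟩ := Q.P_diff m _ h1
    rw [Function.iterate_succ_apply']
    exact ⟨Q.P_fwd _ _ h1, _, i2.comp i1, by rw [Function.iterate_succ']; exact d2.comp x d1⟩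
lemma B_nhds {m x} (hx : ‖x‖ < 1) : Q.B m ∈ 𝓝 (Q.e m + Q.ρ m • x) := by
  refine mem_of_superset (Metric.isOpen_ball.mem_nhds ?_) (Metric.ball_subset_closedBall)
  rw [Metric.mem_ball, dist_eq_norm, add_sub_cancel_left, norm_smul,
    Real.norm_of_nonneg (Q.ρ_pos m).le]
  have := Q.ρ_pos m; nlinarith
lemma ins_diff {k m i x} (h : Q.κ m i = k) (hx : x ∈ Q.P m) :
    ∃ A', InvD d A' ∧ HasFDerivAt (Q.ins k) A' (Q.e m + Q.ρ m • x) := by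
  have hB := Q.B_nhds (m := m) (Q.P_lt m x hx)
  by_cases hk : Q.κ m (Q.per m - 1) = k
  · obtain ⟨-, A1, i1, d1⟩ := Q.iter_diff m (Q.ξ m) hx
    have hρ := (Q.ρ_pos m).ne'
    have a1 : HasFDerivAt (fun w : Eucl d => (Q.ρ m)⁻¹ • (w - Q.e m))
        ((Q.ρ m)⁻¹ • ContinuousLinearMap.id ℝ (Eucl d)) (Q.e m + Q.ρ m • x) :=
      ((hasFDerivAt_id (𝕜 := ℝ) (Q.e m + Q.ρ m • x)).sub_const (Q.e m)).const_smul (Q.ρ m)⁻¹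
    rw [← Q.coord' m x] at d1
    have a2 := ((HasFDerivAt.comp (Q.e m + Q.ρ m • x)
      (f := fun w : Eucl d => (Q.ρ m)⁻¹ • (w - Q.e m)) d1 a1).const_smul (Q.ρ m)).const_add (Q.e m)
    refine ⟨_, ?_, a2.congr_of_eventuallyEq (mem_of_superset hB fun w hw => Q.ins_on hk hw)⟩
    rw [ContinuousLinearMap.comp_smul, smul_smul, mul_inv_cancel₀ hρ, one_smul]
    exact i1
  · exact ⟨_, InvD.id, (hasFDerivAt_id _).congr_of_eventuallyEq
      (mem_of_superset hB fun w hw => Q.ins_mid h hk hw)⟩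
end KD

open Filter Topology Set MeasureTheory Dynamics
open scoped ENNReal

structure TD (d : ℕ) extends KD d, BD d where
  N : ℕ → Eucl d → ℝ
  Dd : ℕ → Set (Eucl d)
  g_C : ∀ k, toKD.Pk k → ∀ w ∈ toKD.C k, g k w = toKD.ins k w
  N_cont : ∀ k, toKD.Pk k → Continuous (N k)
  lyap : ∀ k, toKD.Pk k → ∀ w, w ∉ toKD.C k → ‖w‖ < 1 →
    N k w < ‖w‖ ∧ (g k w ∈ toKD.C k ∨ ‖g k w‖ ≤ N k w)
  Dd_C : ∀ k w, w ∈ Dd k → w ∉ toKD.C k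
  Dd_1 : ∀ k w, w ∈ Dd k → ‖w‖ ≤ 1
  Dd_maps : ∀ k w, w ∈ Dd k → g k w ∈ Dd (nx k)
  g_diff : ∀ k w, ‖w‖ < 1 → w ∈ Dd k ∨ (∃ A', InvD d A' ∧ HasFDerivAt (g k) A' w) ∨
    ∃ m i x, i < per m ∧ κ m i = k ∧ ‖x‖ ≤ 1 ∧ g k w = g k (toKD.e m + toKD.ρ m • x) ∧
      (x ∈ P m → ∃ A', InvD d A' ∧ HasFDerivAt (g k) A' w)
  g_inj : d = 2 → ∀ k, InjOn (g k) (Metric.closedBall 0 1)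

lemma KD.all_Pk {d : ℕ} (Q : KD d) (h2 : d = 2) (k) : Q.Pk k := by
  obtain ⟨n, m, i, e⟩ := Q.evper k
  have hit : ∀ n j, Q.ft^[n] (Q.q j) = Q.q (Q.nx^[n] j) := by
    intro n j
    induction n with
    | zero => rfl
    | succ n ih => rw [Function.iterate_succ_apply', Function.iterate_succ_apply', ih, Q.ft_q]
  obtain ⟨l, hl⟩ := Nat.exists_eq_add_of_le
    ((Nat.le_mul_of_pos_right n (Q.per_pos m)).trans (Nat.le_add_left _ i))
  refine ⟨m, l, Q.inj ((Q.ft_ext.inj h2).iterate n ?_)⟩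
  rw [hit, hit, e, Q.κ_add, add_comm l, ← hl, Q.κ_mul]

lemma KD.exists_TD {d : ℕ} (Q : KD d) : ∃ T : TD d, T.toKD = Q := by
  have H : ∀ k, ∃ (g : Eucl d → Eucl d) (N : Eucl d → ℝ), Continuous g ∧
      (∀ w, ‖w‖ ≤ 1 → ‖g w‖ ≤ 1) ∧ (∀ w, ‖w‖ ≤ 1 → ∃ w', ‖w'‖ ≤ 1 ∧ g w' = w) ∧
      (∀ w, ‖w‖ = 1 → g w = ‖Q.A k w‖⁻¹ • Q.A k w) ∧
      (d = 2 → InjOn g (Metric.closedBall 0 1)) ∧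
      (Q.Pk k → Continuous N ∧ (∀ w ∈ Q.C k, g w = Q.ins k w) ∧
      (∀ w, w ∉ Q.C k → ‖w‖ < 1 → N w < ‖w‖ ∧ (g w ∈ Q.C k ∨ ‖g w‖ ≤ N w)) ∧
      (∀ w, w ∉ Q.C k → ‖w‖ ≤ 3/4 → g w ∉ Q.C k ∧ ‖g w‖ ≤ 3/4) ∧
      (d = 1 → ∀ w, w ∉ Q.C k → ‖w‖ < 1 → (g w ∉ Q.C k ∧ ‖g w‖ ≤ 3/4) ∨
        ∃ (pre : Eucl d → Eucl d) (A' : Eucl d →L[ℝ] Eucl d), InvD d A' ∧ HasFDerivAt pre A' w ∧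
          ∀ w, g w = Q.ins k (pre w))) ∧
      (¬ Q.Pk k → ∀ w, ∃ A', InvD d A' ∧ HasFDerivAt g A' w) := by
    intro k
    by_cases hk : Q.Pk k
    · obtain ⟨g, N, h1, h2, h3, h4, h5, h⟩ := exists_g Q.hd (Q.A k) (Q.hdet k) (Q.C_closed k)
        (by rintro w ⟨m, i, -, hw⟩; exact Q.B_lt hw) (Q.C0 hk) (Q.ins_cont k)
        (fun w => Q.ins_id) (by rintro w ⟨m, i, e, hw⟩; exact ⟨m, i, e, Q.ins_B e hw⟩)
        (fun w => Q.ins_surj) (fun h2 => Q.ins_inj h2 k)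
      exact ⟨g, N, h1, h2, h3, h4, h5, fun _ => h, fun h => absurd hk h⟩
    · have h1 : d = 1 := Q.hd.resolve_right fun h2 => hk (Q.all_Pk h2 k)
      have : ∃ α : ℝ, ∀ w, Q.A k w = α • w := by
        have := (Q.A k : Eucl d →L[ℝ] Eucl d)
        subst h1
        exact dim1_smul (Q.A k : Eucl 1 →L[ℝ] Eucl 1)
      obtain ⟨α, hα⟩ := this
      have hα0 : α ≠ 0 := by
        rintro rfl
        have hv := KD.norm_v0 Q.hd
        have hz : ∀ w, w = (0 : Eucl d) := fun w =>
          (Q.A k).injective ((hα _).trans ((zero_smul _ _).trans (map_zero (Q.A k)).symm))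
        rw [hz (WithLp.toLp 2 _)] at hv
        simp at hv
      have hs : |(|α|⁻¹ * α)| = 1 := by
        rw [abs_mul, abs_inv, abs_abs, inv_mul_cancel₀ (abs_ne_zero.2 hα0)]
      have hs2 : (|α|⁻¹ * α) * (|α|⁻¹ * α) = 1 := by rw [← abs_mul_abs_self, hs, one_mul]
      refine ⟨fun w => (|α|⁻¹ * α) • w, 0, by fun_prop, fun w hw => ?_, fun w hw => ?_,
        fun w hw => ?_, by omega, fun h => absurd h hk, fun _ w => ?_⟩
      · rwa [norm_smul, Real.norm_eq_abs, hs, one_mul]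
      · refine ⟨(|α|⁻¹ * α) • w, by rwa [norm_smul, Real.norm_eq_abs, hs, one_mul], ?_⟩
        simp only [smul_smul, hs2, one_smul]
      · simp only [hα, norm_smul, hw, Real.norm_eq_abs, mul_one, smul_smul]
      · exact ⟨_, InvD.smul (r := |α|⁻¹ * α) (by intro h; simp [h] at hs) (by omega),
          (hasFDerivAt_id (𝕜 := ℝ) w).const_smul (|α|⁻¹ * α)⟩
  choose g N gc gm gs gsph ginj gP gnP using H
  let Dd : ℕ → Set (Eucl d) := fun k => {w | ‖w‖ ≤ 1 ∧ Q.Pk k ∧ w ∉ Q.C k ∧ g k w ∉ Q.C k ∧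
    (d = 2 ∨ ‖g k w‖ ≤ 3/4)}
  have key2 : d = 2 → ∀ k w, ‖w‖ ≤ 1 → w ∉ Q.C k → g k w ∉ Q.C k := fun h2 k w h1 hw hg => by
    have hk := Q.all_Pk h2 k
    obtain ⟨w', hw', e⟩ := Q.ins_surj hg
    rw [← (gP k hk).2.1 w' hw'] at e
    have : ‖w'‖ ≤ 1 := by obtain ⟨m, i, -, h⟩ := hw'; linarith [Q.B_lt h]
    have := ginj k h2 (by simpa using this) (by simpa using h1) e
    exact hw (this ▸ hw')
  refine ⟨{ Q with
    ft_cont := Q.ft_ext.cont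
    ft_far := Q.ft_ext.far
    ft_maps := Q.ft_ext.maps
    ft_surj := Q.ft_ext.surj
    g := g
    g_cont := fun k => (gc k).continuousOn
    g_maps := gm
    g_surj := gs
    g_sph := gsph
    N := N
    Dd := Dd
    g_C := fun k hk => (gP k hk).2.1
    N_cont := fun k hk => (gP k hk).1
    lyap := fun k hk => (gP k hk).2.2.1
    Dd_C := fun k w h => h.2.2.1
    Dd_1 := fun k w h => h.1
    Dd_maps := ?_
    g_diff := ?_
    g_inj := fun h2 k => ginj k h2 }, rfl⟩
  · rintro k w ⟨h1, hk, hw, hg, h⟩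
    have hk' : Q.Pk (Q.nx k) := by obtain ⟨m, i, rfl⟩ := hk; exact ⟨m, _, (Q.κ_succ m i).symm⟩
    have hg1 := gm k w h1
    rw [← Q.C_nx hk] at hg
    rcases h with h | h
    · exact ⟨hg1, hk', hg, key2 h _ _ hg1 hg, Or.inl h⟩
    · have := (gP _ hk').2.2.2.1 _ hg h
      exact ⟨hg1, hk', hg, this.1, Or.inr this.2⟩
  · intro k w hw
    by_cases hk : Q.Pk k
    swap
    · exact Or.inr (Or.inl (gnP k hk w))
    by_cases hC : w ∈ Q.C k
    · right; right
      obtain ⟨m, i, e, hB⟩ := hC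
      obtain ⟨x, hx, rfl⟩ := Q.B_iff.1 hB
      refine ⟨m, i % Q.per m, x, Nat.mod_lt _ (Q.per_pos m), (Q.κ_mod m i).trans e, hx, rfl,
        fun hP => ?_⟩
      obtain ⟨A', h1, h2⟩ := Q.ins_diff e hP
      exact ⟨A', h1, h2.congr_of_eventuallyEq (mem_of_superset (Q.B_nhds (Q.P_lt m x hP))
        fun w hw => (gP k hk).2.1 w ⟨m, i, e, hw⟩)⟩
    rcases Q.hd with h1 | h2
    swap
    · exact Or.inl ⟨hw.le, hk, hC, key2 h2 k w hw.le hC, Or.inl h2⟩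
    rcases (gP k hk).2.2.2.2 h1 w hC hw with h | ⟨pre, A', hA', hp, hg⟩
    · exact Or.inl ⟨hw.le, hk, hC, h.1, Or.inr h.2⟩
    right
    have hfun : g k = Q.ins k ∘ pre := funext hg
    by_cases hv : pre w ∈ Q.C k
    · right
      obtain ⟨m, i, e, hB⟩ := hv
      obtain ⟨x, hx, hx'⟩ := Q.B_iff.1 hB
      refine ⟨m, i % Q.per m, x, Nat.mod_lt _ (Q.per_pos m), (Q.κ_mod m i).trans e, hx, ?_,
        fun hP => ?_⟩
      · show g k w = g k (Q.e m + Q.ρ m • x)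
        rw [← hx', (gP k hk).2.1 _ ⟨m, i, e, hB⟩, hg]
      obtain ⟨A2, h1, h2⟩ := Q.ins_diff e hP
      rw [← hx'] at h2
      exact ⟨_, h1.comp hA', by show HasFDerivAt (g k) _ w; rw [hfun]; exact h2.comp w hp⟩
    · left
      refine ⟨_, hA', hp.congr_of_eventuallyEq ?_⟩
      filter_upwards [hp.continuousAt.eventually ((Q.C_closed k).isOpen_compl.mem_nhds hv)] with v hv
      show g k v = _
      rw [hg, Q.ins_id hv]

open Filter Topology Set MeasureTheory Dynamics
open scoped ENNReal

lemma per_eq {X : Type*} {T : X → X} {x : X} {n : ℕ} (h : IsPeriodicOrbitPt T x n) :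
    n = Function.minimalPeriod T x := by
  obtain ⟨h0, h1, h2⟩ := h
  have h1 : Function.IsPeriodicPt T n x := h1
  refine le_antisymm ?_ (h1.minimalPeriod_le h0)
  by_contra hlt
  exact h2 _ (h1.minimalPeriod_pos h0) (not_le.1 hlt) (Function.iterate_minimalPeriod)
lemma per_of {X : Type*} {T : X → X} {x : X} (h : x ∈ Function.periodicPts T) :
    IsPeriodicOrbitPt T x (Function.minimalPeriod T x) :=
  ⟨Function.minimalPeriod_pos_of_mem_periodicPts h, Function.iterate_minimalPeriod,
    fun j hj hlt e => by
      have e : Function.IsPeriodicPt T j x := e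
      exact absurd (e.minimalPeriod_le hj) (not_le.2 hlt)⟩
lemma per_mem {X : Type*} {T : X → X} {x : X} {n : ℕ} (h : IsPeriodicOrbitPt T x n) :
    x ∈ Function.periodicPts T := ⟨n, h.1, h.2.1⟩
lemma mem_orbit {X : Type*} {T : X → X} {x : X} {n : ℕ} (h : IsPeriodicOrbitPt T x n) (i : ℕ) :
    T^[i] x ∈ orbitSet T x n :=
  ⟨i % n, Nat.mod_lt _ h.1, Function.IsPeriodicPt.iterate_mod_apply (n := n) h.2.1 i⟩
lemma orbM_shift {X : Type*} [MeasurableSpace X] {T : X → X} {x : X} {n : ℕ}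
    (h : IsPeriodicOrbitPt T x n) (i : ℕ) : orbitMeasure T (T^[i] x) n = orbitMeasure T x n := by
  have hn : max n 1 = n := max_eq_left h.1
  simp only [orbitMeasure, hn]
  congr 1
  induction i with
  | zero => rfl
  | succ i ih =>
    rw [← ih]
    have e := Finset.sum_range_succ (fun j => Measure.dirac (T^[j] (T^[i] x))) n
    rw [Finset.sum_range_succ'] at e
    have e2 : T^[n] (T^[i] x) = T^[i] x := by
      rw [← Function.iterate_add_apply, add_comm, Function.iterate_add_apply, h.2.1]
    rw [e2] at e
    ext s hs
    have e3 := congrArg (fun μ : Measure X => μ s) e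
    simp only [Measure.add_apply, Function.iterate_zero_apply] at e3
    rw [ENNReal.add_left_inj (measure_ne_top _ _)] at e3
    rw [← e3]
    simp only [Function.iterate_succ_apply', Function.iterate_succ_apply]
    simp only [← Function.iterate_succ_apply', Function.iterate_succ_apply]
lemma orb_shift {X : Type*} [MeasurableSpace X] {T : X → X} {x x' : X} {n n' : ℕ}
    (h : IsPeriodicOrbitPt T x n) (h' : IsPeriodicOrbitPt T x' n') {i j : ℕ}
    (e : T^[i] x = T^[j] x') : orbitProb T x n = orbitProb T x' n' := by
  have hn : n = n' := by
    rw [per_eq h, per_eq h', ← Function.minimalPeriod_apply_iterate (per_mem h) i, e,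
      Function.minimalPeriod_apply_iterate (per_mem h') j]
  subst hn
  apply Subtype.ext
  show orbitMeasure T x n = orbitMeasure T x' n
  rw [← orbM_shift h i, e, orbM_shift h' j]
lemma orb_full {X : Type*} [MeasurableSpace X] [MeasurableSingletonClass X] {T : X → X} {x : X} {n : ℕ}
    (h : IsPeriodicOrbitPt T x n) {S : Set X} (hS : orbitSet T x n ⊆ S) :
    orbitMeasure T x n Sᶜ = 0 := by
  have hn : max n 1 = n := max_eq_left h.1
  rw [orbitMeasure, Measure.smul_apply, Measure.finset_sum_apply, Finset.sum_eq_zero, smul_zero]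
  intro i _
  rw [Measure.dirac_apply, indicator_of_notMem]
  exact fun hc => hc (hS (mem_orbit h i))

lemma sat_fwd {X : Type*} {T : X → X} {x : ℕ → X} {n : ℕ → ℕ} (h : ∀ m, IsPeriodicOrbitPt T (x m) (n m))
    {y : X} (hy : y ∈ preimageSat T (⋃ m, orbitSet T (x m) (n m))) :
    T y ∈ preimageSat T (⋃ m, orbitSet T (x m) (n m)) := by
  obtain ⟨k, hk⟩ := hy
  obtain ⟨m, i, -, e⟩ := mem_iUnion.1 hk
  refine ⟨k, mem_iUnion.2 ⟨m, ?_⟩⟩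
  rw [← Function.iterate_succ_apply, Function.iterate_succ_apply', ← e]
  simp only []
  rw [← Function.iterate_succ_apply' T]
  exact mem_orbit (h m) _
lemma sat_back {X : Type*} {T : X → X} {S : Set X} {y : X} (hy : T y ∈ preimageSat T S) :
    y ∈ preimageSat T S := by
  obtain ⟨k, hk⟩ := hy; exact ⟨k + 1, hk⟩
lemma sat_orb {X : Type*} {T : X → X} {x : ℕ → X} {n : ℕ → ℕ} (h : ∀ m, IsPeriodicOrbitPt T (x m) (n m))
    (m i) : T^[i] (x m) ∈ preimageSat T (⋃ m, orbitSet T (x m) (n m)) :=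
  ⟨0, mem_iUnion.2 ⟨m, mem_orbit (h m) i⟩⟩

open Classical in
noncomputable def ext1 {d : ℕ} (T : Eucl d → Eucl d) (x : Eucl d) : Eucl d := if ‖x‖ ≤ 1 then T x else x
lemma ext1_in {d : ℕ} {T : Eucl d → Eucl d} {x : Eucl d} (h : ‖x‖ ≤ 1) : ext1 T x = T x := if_pos h

lemma mem_uD {d : ℕ} {x : Eucl d} : x ∈ unitDisc d ↔ ‖x‖ ≤ 1 := by simp [unitDisc]
lemma mem_iD {d : ℕ} {x : Eucl d} : x ∈ interior (unitDisc d) ↔ ‖x‖ < 1 := by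
  rw [unitDisc, interior_closedBall _ one_ne_zero, mem_ball_zero_iff]

lemma MemCd.XT {d : ℕ} {T : Eucl d → Eucl d} (h : MemCd d T) : XT d (ext1 T) := by
  have far : ∀ x, 1 ≤ ‖x‖ → ext1 T x = x := fun x hx => by
    unfold ext1; split_ifs with h1
    · exact h.boundary_id (by simpa using le_antisymm h1 hx)
    · rfl
  have maps : ∀ x, ‖x‖ ≤ 1 → ‖ext1 T x‖ ≤ 1 := fun x hx => by
    rw [ext1_in hx]; exact mem_uD.1 (h.mapsTo (mem_uD.2 hx))
  refine ⟨?_, far, maps, fun x hx => ?_, fun h2 x y e => ?_⟩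
  · refine continuous_if_le continuous_norm continuous_const ?_ continuousOn_id fun x hx => ?_
    · convert h.contOn using 1; ext x; simp [unitDisc]
    · exact h.boundary_id (by simpa using hx)
  · obtain ⟨y, hy, e⟩ := h.surjOn.symm ▸ (mem_uD.2 hx)
    exact ⟨y, mem_uD.1 hy, (ext1_in (mem_uD.1 hy)).trans e⟩
  · rcases le_or_gt ‖x‖ 1 with hx | hx <;> rcases le_or_gt ‖y‖ 1 with hy | hy
    · rw [ext1_in hx, ext1_in hy] at e
      exact h.injOn_of_dim2 h2 (mem_uD.2 hx) (mem_uD.2 hy) e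
    · have := maps x hx; rw [e, far y hy.le] at this; linarith
    · have := maps y hy; rw [← e, far x hx.le] at this; linarith
    · rwa [far x hx.le, far y hy.le] at e

lemma ext1_diff {d : ℕ} {T : Eucl d → Eucl d} {x : Eucl d} (hx : ‖x‖ < 1) {A : Eucl d →L[ℝ] Eucl d}
    (h : HasFDerivAt T A x) : HasFDerivAt (ext1 T) A x := by
  refine h.congr_of_eventuallyEq ?_
  filter_upwards [Metric.isOpen_ball.mem_nhds (mem_ball_zero_iff.2 hx)] with y hy
  exact ext1_in (mem_ball_zero_iff.1 hy).le

lemma exists_KD (d : ℕ) (hd : d = 1 ∨ d = 2)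
    (f : Eucl d → Eucl d) (hf : MemCd d f)
    (xper : ℕ → Eucl d) (per : ℕ → ℕ) (hready : ReadyForOperation d f xper per)
    (χ : ℕ → Eucl d → Eucl d) (hχ : ∀ m, MemCd d (χ m))
    (xperχ : ℕ → ℕ → Eucl d) (perχ : ℕ → ℕ → ℕ)
    (hreadyχ : ∀ m, ReadyForOperation d (χ m) (xperχ m) (perχ m))
    (ξ : ℕ → ℕ) (hξ : ∀ m, 1 ≤ ξ m ∧ ξ m ≤ per m)
    (q : ℕ → Eucl d) (hqinj : Function.Injective q)
    (hqrange : Set.range q = preimageSat f (⋃ m, orbitSet f (xper m) (per m))) :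
    ∃ Q : KD d, Q.q = q ∧ Q.ft = ext1 f ∧ Q.per = per ∧ Q.ξ = ξ ∧ Q.χ = (fun m => ext1 (χ m)) ∧
      (∀ m, Q.P m = preimageSat (χ m) (⋃ ℓ, orbitSet (χ m) (xperχ m ℓ) (perχ m ℓ))) ∧
      ∀ m i, q (Q.κ m i) = f^[i] (xper m) := by
  have hp := hready.periodic
  have qQ : ∀ k, q k ∈ preimageSat f (⋃ m, orbitSet f (xper m) (per m)) := fun k =>
    hqrange ▸ mem_range_self k
  have qlt : ∀ k, ‖q k‖ < 1 := fun k => mem_iD.1 (hready.subset_int (qQ k))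
  have hnx : ∀ k, ∃ j, f (q k) = q j := fun k => by
    obtain ⟨j, hj⟩ : f (q k) ∈ range q := hqrange ▸ sat_fwd hp (qQ k)
    exact ⟨j, hj.symm⟩
  choose nx hnx using hnx
  have hκ : ∀ m i, ∃ k, q k = f^[i] (xper m) := fun m i => by
    have : f^[i] (xper m) ∈ range q := hqrange ▸ sat_orb hp m i
    exact this
  choose κ hκ using hκ
  have hA : ∀ k, ∃ A : Eucl d ≃L[ℝ] Eucl d, HasFDerivAt f (A : Eucl d →L[ℝ] Eucl d) (q k) ∧
      (d = 2 → 0 < LinearMap.det ((A : Eucl d →L[ℝ] Eucl d) : Eucl d →ₗ[ℝ] Eucl d)) := fun k => by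
    obtain ⟨A, h1, ⟨B, h2, h3⟩, h4⟩ := hready.deriv _ (qQ k)
    exact ⟨ContinuousLinearEquiv.equivOfInverse A B (fun x => DFunLike.congr_fun h3 x)
      (fun x => DFunLike.congr_fun h2 x), h1, h4⟩
  choose A hA hdet using hA
  have Plt : ∀ m, ∀ x ∈ preimageSat (χ m) (⋃ ℓ, orbitSet (χ m) (xperχ m ℓ) (perχ m ℓ)), ‖x‖ < 1 :=
    fun m x hx => mem_iD.1 ((hreadyχ m).subset_int hx)
  have κ_succ : ∀ m i, nx (κ m i) = κ m (i + 1) := fun m i => hqinj (by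
    rw [hκ, ← hnx, hκ, Function.iterate_succ_apply'])
  refine ⟨{
    q := q
    inj := hqinj
    lt := qlt
    hd := hd
    ft := ext1 f
    ft_ext := hf.XT
    nx := nx
    ft_q := fun k => (ext1_in (qlt k).le).trans (hnx k)
    preQ := ?_
    A := A
    hA := fun k => ext1_diff (qlt k) (hA k)
    hdet := hdet
    κ := κ
    per := per
    ξ := ξ
    χ := fun m => ext1 (χ m)
    P := fun m => preimageSat (χ m) (⋃ ℓ, orbitSet (χ m) (xperχ m ℓ) (perχ m ℓ))
    per_pos := fun m => (hp m).1
    ξ_pos := fun m => (hξ m).1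
    χ_ext := fun m => (hχ m).XT
    κ_succ := κ_succ
    κ_per := fun m i => hqinj (by rw [hκ, hκ, Function.iterate_add_apply, (hp m).2.1])
    κ_inj := ?_
    fin := ?_
    evper := ?_
    P_back := ?_
    P_fwd := fun m x hx => by
      show ext1 (χ m) x ∈ _
      rw [ext1_in (Plt m x hx).le]; exact sat_fwd (hreadyχ m).periodic hx
    P_lt := Plt
    P_diff := fun m x hx => by
      obtain ⟨A, h1, h2⟩ := (hreadyχ m).deriv x hx
      exact ⟨A, h2, ext1_diff (Plt m x hx) h1⟩ }, rfl, rfl, rfl, rfl, rfl, fun m => rfl, hκ⟩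
  · intro x k h
    have hx : ‖x‖ ≤ 1 := by
      by_contra hx
      rw [hf.XT.far x (not_le.1 hx).le] at h
      exact hx (h ▸ (qlt k).le)
    rw [ext1_in hx] at h
    obtain ⟨j, hj⟩ : x ∈ range q := hqrange ▸ sat_back (h ▸ qQ k)
    exact ⟨j, hj.symm⟩
  · intro m i j hi hj h
    have e : f^[i] (xper m) = f^[j] (xper m) := by rw [← hκ, ← hκ, h]
    rw [per_eq (hp m)] at hi hj
    exact Function.iterate_injOn_Iio_minimalPeriod hi hj e
  · intro k
    by_contra hinf
    obtain ⟨m0, i0, hi0⟩ := Set.Infinite.nonempty hinf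
    have h1 := hready.limit_null (orbitProb f (xper m0) (per m0)) (mem_iInter.2 fun N => by
      obtain ⟨m, ⟨i, hi⟩, hm⟩ := Set.Infinite.exists_gt hinf N
      exact subset_closure ⟨m, hm.le, orb_shift (hp m) (hp m0) (i := i) (j := i0)
        (by rw [← hκ, ← hκ, hi, hi0])⟩)
    have h2 := orb_full (hp m0) (subset_iUnion (fun m => orbitSet f (xper m) (per m)) m0)
    have h3 : (orbitProb f (xper m0) (per m0) : Measure (Eucl d)) univ = 0 := by
      rw [← union_compl_self (⋃ m, orbitSet f (xper m) (per m))]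
      exact measure_union_null h1 h2
    simp at h3
  · intro k
    obtain ⟨n, hn⟩ := qQ k
    obtain ⟨m, i, -, e⟩ := mem_iUnion.1 hn
    refine ⟨n, m, i, hqinj ?_⟩
    rw [hκ]
    refine Eq.trans ?_ e.symm
    clear e hn
    induction n with
    | zero => rfl
    | succ n ih => rw [Function.iterate_succ_apply', Function.iterate_succ_apply', ← ih, hnx]
  · intro m x hx
    rcases le_or_gt ‖x‖ 1 with h | h
    · simp only [ext1_in h] at hx; exact sat_back hx
    · simp only [(hχ m).XT.far x h.le] at hx; exact hx

open Filter Topology Set MeasureTheory Dynamics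
open scoped ENNReal

namespace TD
variable {d : ℕ} (Q : TD d)

noncomputable def F (y : Eucl d) : Eucl d := Q.toBD.F y
lemma F_q {k y} (h : Q.pi y = Q.q k) : Q.F y = Q.W (Q.nx k) (Q.g k (Q.W' k y)) := Q.toBD.F_q h
lemma F_nq {y} (h : ∀ k, Q.pi y ≠ Q.q k) : Q.F y = Q.S (Q.ft (Q.pi y)) := Q.toBD.F_nq h
lemma F_W {k w} (h : ‖w‖ ≤ 1) : Q.F (Q.W k w) = Q.W (Q.nx k) (Q.g k w) := Q.toBD.F_W h
lemma pi_F (y) : Q.pi (Q.F y) = Q.ft (Q.pi y) := Q.toBD.pi_F y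
lemma F_far {y} (h : 1 ≤ ‖y‖) : Q.F y = y := Q.toBD.F_far h
lemma F_maps {y} (h : ‖y‖ ≤ 1) : ‖Q.F y‖ ≤ 1 := Q.toBD.F_maps h
lemma F_surj {y} (h : ‖y‖ ≤ 1) : ∃ y', ‖y'‖ ≤ 1 ∧ Q.F y' = y := Q.toBD.F_surj h
lemma continuous_F : Continuous Q.F := Q.toBD.continuous_F
lemma asym_nq {z} (h : ∀ k, z ≠ Q.q k) : Tendsto id (comap Q.pi (𝓝 z)) (𝓝 (Q.S z)) :=
  Q.toBD.asym_nq h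

noncomputable def φ (m i : ℕ) (x : Eucl d) : Eucl d := Q.W (Q.κ m i) (Q.e m + Q.ρ m • x)
def Ks (m : ℕ) : Set (Eucl d) := ⋃ i ∈ Set.Iio (Q.per m), Q.φ m i '' unitDisc d
def Ls (k : ℕ) : Set (Eucl d) := Metric.closedBall (Q.c k) (Q.a k)
def K0 : Set (Eucl d) := {y | ‖y‖ ≤ 1 ∧ ∀ k, Q.pi y = Q.q k → ‖Q.W' k y‖ = 1}

lemma mem_B {m x} (hx : ‖x‖ ≤ 1) : Q.e m + Q.ρ m • x ∈ Q.B m := Q.B_iff.2 ⟨x, hx, rfl⟩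
lemma B1 {m x} (hx : ‖x‖ ≤ 1) : ‖Q.e m + Q.ρ m • x‖ < 1 := by linarith [Q.B_lt (Q.mem_B (m := m) hx)]
lemma mem_Ls {k y} : y ∈ Q.Ls k ↔ Q.pi y = Q.q k := by
  rw [Q.pi_q, Ls, Metric.mem_closedBall, dist_eq_norm]
lemma mem_int {k y} : y ∈ interior (Q.Ls k) ↔ ‖Q.W' k y‖ < 1 := by
  rw [Ls, interior_closedBall _ (Q.a_pos k).ne', Q.norm_W', inv_mul_lt_iff₀ (Q.a_pos k), mul_one,
    Metric.mem_ball, dist_eq_norm]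
lemma mem_fr {k y} : y ∈ frontier (Q.Ls k) ↔ ‖Q.W' k y‖ = 1 := by
  rw [Ls, frontier_closedBall _ (Q.a_pos k).ne', Q.norm_W', inv_mul_eq_iff_eq_mul₀ (Q.a_pos k).ne',
    mul_one, mem_sphere_iff_norm]
lemma Ls_sub (k) : Q.Ls k ⊆ unitDisc d := fun y hy => mem_uD.2 (by
  have := Q.pi_q'.1 (Q.mem_Ls.1 hy)
  rw [← Q.W_W' k y]; exact (Q.W_lt this).le)
lemma K0_eq : Q.K0 = unitDisc d \ ⋃ k, interior (Q.Ls k) := by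
  ext y
  simp only [K0, Set.mem_sdiff, mem_uD, mem_iUnion, mem_int, not_exists, not_lt, mem_ofPred_eq, Q.pi_q']
  exact and_congr_right fun _ => forall_congr' fun k =>
    ⟨fun h => by by_contra hc; push Not at hc; linarith [h hc.le], fun h h' => le_antisymm h' h⟩
lemma K0_compact : IsCompact Q.K0 := by
  rw [K0_eq]
  exact (isCompact_closedBall _ _).diff (isOpen_iUnion fun k => isOpen_interior)

lemma F_mid {m i x} (hi : i + 1 < Q.per m) (hx : ‖x‖ ≤ 1) : Q.F (Q.φ m i x) = Q.φ m (i + 1) x := by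
  rw [φ, Q.F_W (Q.B1 hx).le, Q.g_C _ ⟨m, i, rfl⟩ _ ⟨m, i, rfl, Q.mem_B hx⟩,
    Q.ins_mid rfl (fun h => by have := Q.κ_inj _ _ _ (by omega) (by omega) h; omega) (Q.mem_B hx), φ,
    Q.κ_succ]
lemma F_last {m x} (hx : ‖x‖ ≤ 1) :
    Q.F (Q.φ m (Q.per m - 1) x) = Q.φ m 0 ((Q.χ m)^[Q.ξ m] x) := by
  have hp := Q.per_pos m
  rw [φ, Q.F_W (Q.B1 hx).le, Q.g_C _ ⟨m, _, rfl⟩ _ ⟨m, _, rfl, Q.mem_B hx⟩,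
    Q.ins_on rfl (Q.mem_B hx), φ, Q.κ_succ, KD.hm, Q.coord']
  congr 1
  rw [show Q.per m - 1 + 1 = 0 + Q.per m by omega, Q.κ_per]
lemma F_step {m i x} (hi : i < Q.per m) (hx : ‖x‖ ≤ 1) :
    ∃ i' < Q.per m, ∃ c, Q.F (Q.φ m i x) = Q.φ m i' ((Q.χ m)^[c] x) := by
  by_cases h : i + 1 < Q.per m
  · exact ⟨i + 1, h, 0, Q.F_mid h hx⟩
  · obtain rfl : i = Q.per m - 1 := by omega
    exact ⟨0, Q.per_pos m, _, Q.F_last hx⟩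
lemma F_iter {m i x} (hi : i < Q.per m) (hx : ‖x‖ ≤ 1) (n : ℕ) :
    ∃ i' < Q.per m, ∃ c, Q.F^[n] (Q.φ m i x) = Q.φ m i' ((Q.χ m)^[c] x) := by
  induction n with
  | zero => exact ⟨i, hi, 0, rfl⟩
  | succ n ih =>
    obtain ⟨i', hi', c, e⟩ := ih
    obtain ⟨i2, h2, c2, e2⟩ := Q.F_step hi' (((Q.χ_ext m).iter c).maps x hx)
    exact ⟨i2, h2, c2 + c, by rw [Function.iterate_succ_apply', e, e2, Function.iterate_add_apply]⟩
lemma pi_φ {m i x} (hx : ‖x‖ ≤ 1) : Q.pi (Q.φ m i x) = Q.q (Q.κ m i) := Q.pi_W.2 (Q.B1 hx).le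
lemma φ_cross {m i x m' i' x'} (hi : i < Q.per m) (hi' : i' < Q.per m') (hx : ‖x‖ ≤ 1) (hx' : ‖x'‖ ≤ 1)
    (h : Q.φ m i x = Q.φ m' i' x') : m = m' ∧ i = i' ∧ x = x' := by
  have hk : Q.κ m i = Q.κ m' i' := Q.inj (by rw [← Q.pi_φ hx, h, Q.pi_φ hx'])
  unfold φ at h
  rw [hk] at h
  have h2 := Q.W_inj _ h
  obtain rfl := Q.B_disj hk (Q.mem_B hx) (h2 ▸ Q.mem_B hx')
  exact ⟨rfl, Q.κ_inj _ _ _ hi hi' hk,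
    smul_right_injective _ (Q.ρ_pos m).ne' (add_left_cancel h2)⟩
lemma continuous_φ (m i) : Continuous (Q.φ m i) := (Q.continuous_W _).comp (by fun_prop)
lemma mem_Ks {m y} : y ∈ Q.Ks m ↔ ∃ i < Q.per m, ∃ x, ‖x‖ ≤ 1 ∧ Q.φ m i x = y := by
  simp [Ks, mem_uD]
lemma Ks_compact (m) : IsCompact (Q.Ks m) :=
  (finite_Iio _).isCompact_biUnion fun i _ => (isCompact_closedBall _ _).image (Q.continuous_φ m i)
lemma Ks_disj {m m'} (h : m ≠ m') : Disjoint (Q.Ks m) (Q.Ks m') := by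
  rw [Set.disjoint_left]
  intro y hy hy'
  obtain ⟨i, hi, x, hx, rfl⟩ := Q.mem_Ks.1 hy
  obtain ⟨i', hi', x', hx', e⟩ := Q.mem_Ks.1 hy'
  exact h (Q.φ_cross hi hi' hx hx' e.symm).1
lemma φ_int {m i x} (hx : ‖x‖ ≤ 1) : Q.φ m i x ∈ interior (Q.Ls (Q.κ m i)) := by
  rw [mem_int, φ, Q.W'_W]; exact Q.B1 hx
lemma K0_disj (m) : Disjoint Q.K0 (Q.Ks m) := by
  rw [Set.disjoint_right]
  intro y hy
  obtain ⟨i, hi, x, hx, rfl⟩ := Q.mem_Ks.1 hy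
  rw [K0_eq]
  exact fun h => h.2 (mem_iUnion.2 ⟨_, Q.φ_int hx⟩)
lemma F_Ks (m) : Q.F '' Q.Ks m = Q.Ks m := by
  have hp := Q.per_pos m
  apply Subset.antisymm
  · rintro _ ⟨y, hy, rfl⟩
    obtain ⟨i, hi, x, hx, rfl⟩ := Q.mem_Ks.1 hy
    obtain ⟨i', hi', c, e⟩ := Q.F_step hi hx
    exact Q.mem_Ks.2 ⟨i', hi', _, ((Q.χ_ext m).iter c).maps x hx, e.symm⟩
  · intro y hy
    obtain ⟨i, hi, x, hx, rfl⟩ := Q.mem_Ks.1 hy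
    by_cases h : i = 0
    · subst h
      obtain ⟨x', hx', e⟩ := ((Q.χ_ext m).iter (Q.ξ m)).surj x hx
      exact ⟨_, Q.mem_Ks.2 ⟨Q.per m - 1, by omega, x', hx', rfl⟩, by rw [Q.F_last hx', e]⟩
    · exact ⟨_, Q.mem_Ks.2 ⟨i - 1, by omega, x, hx, rfl⟩, by
        rw [Q.F_mid (by omega) hx, Nat.sub_add_cancel (by omega)]⟩

lemma A_ne {k w} (hw : ‖w‖ = 1) : ‖Q.A k w‖ ≠ 0 := by
  rw [Ne, norm_eq_zero, EmbeddingLike.map_eq_zero_iff]; rintro rfl; simp at hw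
lemma g_sph1 {k w} (hw : ‖w‖ = 1) : ‖Q.g k w‖ = 1 := by
  rw [Q.g_sph k w hw, norm_smul, norm_inv, norm_norm, inv_mul_cancel₀ (Q.A_ne hw)]
lemma g_sph_inj {k w w'} (hw : ‖w‖ = 1) (hw' : ‖w'‖ = 1) (h : Q.g k w = Q.g k w') : w = w' := by
  rw [Q.g_sph k w hw, Q.g_sph k w' hw', ← map_smul, ← map_smul] at h
  have h := (Q.A k).injective h
  have h2 := congrArg norm h
  rw [norm_smul, norm_smul, hw, hw', norm_inv, norm_norm, norm_inv, norm_norm, mul_one, mul_one] at h2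
  rw [h2] at h
  exact smul_right_injective _ (inv_ne_zero (Q.A_ne hw')) h
lemma fr_maps {k y} (h : ‖Q.W' k y‖ = 1) : ‖Q.W' (Q.nx k) (Q.F y)‖ = 1 := by
  rw [Q.F_q (Q.pi_q'.2 h.le), Q.W'_W]; exact Q.g_sph1 h
lemma F_K0 : Q.F '' Q.K0 = Q.K0 := by
  apply Subset.antisymm
  · rintro _ ⟨y, ⟨h1, h2⟩, rfl⟩
    refine ⟨Q.F_maps h1, fun k hk => ?_⟩
    rw [Q.pi_F] at hk
    obtain ⟨j, hj⟩ := Q.preQ _ _ hk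
    rw [hj, Q.ft_q] at hk
    rw [← Q.inj hk]
    exact Q.fr_maps (h2 j hj)
  · rintro y ⟨h1, h2⟩
    obtain ⟨x, hx, hx'⟩ := Q.ft_surj _ (Q.pi_maps h1)
    by_cases hh : ∃ k, Q.pi y = Q.q k
    · obtain ⟨k, hh⟩ := hh
      obtain ⟨j, rfl⟩ := Q.preQ x k (hx'.trans hh)
      rw [hh, Q.ft_q] at hx'
      have hk := Q.inj hx'
      set v := Q.W' k y with hv
      have hv1 := h2 k hh
      set z := (Q.A j).symm v with hz
      have hz0 : ‖z‖ ≠ 0 := by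
        rw [hz, Ne, norm_eq_zero, EmbeddingLike.map_eq_zero_iff]; intro h; rw [show ‖Q.W' k y‖ = ‖v‖ from rfl, h, norm_zero] at hv1; norm_num at hv1
      have hw : ‖‖z‖⁻¹ • z‖ = 1 := by rw [norm_smul, norm_inv, norm_norm, inv_mul_cancel₀ hz0]
      have hpi : Q.pi (Q.W j (‖z‖⁻¹ • z)) = Q.q j := Q.pi_W.2 hw.le
      refine ⟨Q.W j (‖z‖⁻¹ • z), ⟨(Q.W_lt hw.le).le, fun i hi => ?_⟩, ?_⟩
      · rw [← Q.inj (hpi.symm.trans hi), Q.W'_W, hw]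
      · rw [Q.F_W hw.le, hk, Q.g_sph _ _ hw, map_smul, hz, ContinuousLinearEquiv.apply_symm_apply,
          norm_smul, ← hz, norm_inv, norm_norm, show ‖v‖ = 1 from hv1, mul_one, inv_inv, smul_smul,
          mul_inv_cancel₀ hz0, one_smul, hv, Q.W_W']
    · push Not at hh
      have hxq : ∀ j, x ≠ Q.q j := by
        rintro j rfl; exact hh _ (hx'.symm.trans (Q.ft_q j))
      refine ⟨Q.S x, ⟨Q.S_maps hx, fun k hk => absurd ((Q.pi_S x).symm.trans hk) (hxq k)⟩, ?_⟩
      rw [Q.F_nq (by rw [Q.pi_S]; exact hxq), Q.pi_S, hx', ← (Q.pi_notQ hh).1 rfl]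

lemma it_W {k w} (hw : ‖w‖ ≤ 1) (n : ℕ) : ∃ w', ‖w'‖ ≤ 1 ∧ Q.F^[n] (Q.W k w) = Q.W (Q.nx^[n] k) w' := by
  induction n with
  | zero => exact ⟨w, hw, rfl⟩
  | succ n ih =>
    obtain ⟨w', h, e⟩ := ih
    exact ⟨_, Q.g_maps _ _ h, by
      rw [Function.iterate_succ_apply', e, Q.F_W h, Function.iterate_succ_apply']⟩
lemma cases {y} (h : ‖y‖ ≤ 1) (h0 : y ∉ Q.K0) : ∃ k w, ‖w‖ < 1 ∧ Q.W k w = y := by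
  simp only [K0, mem_ofPred_eq, not_and, not_forall] at h0
  obtain ⟨k, hk, h1⟩ := h0 h
  exact ⟨k, Q.W' k y, lt_of_le_of_ne (Q.pi_q'.1 hk) h1, Q.W_W' k y⟩
lemma C_Ks {k w} (h : w ∈ Q.C k) : ∃ m, Q.W k w ∈ Q.Ks m := by
  obtain ⟨m, i, rfl, hB⟩ := h
  obtain ⟨x, hx, rfl⟩ := Q.B_iff.1 hB
  exact ⟨m, Q.mem_Ks.2 ⟨i % Q.per m, Nat.mod_lt _ (Q.per_pos m), x, hx, by rw [φ, Q.κ_mod]⟩⟩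
lemma Pk_nx {k} (h : Q.Pk k) : Q.Pk (Q.nx k) := by
  obtain ⟨m, i, rfl⟩ := h; exact ⟨m, _, (Q.κ_succ m i).symm⟩

lemma NW {y} (h : ‖y‖ ≤ 1) (h0 : y ∉ Q.K0) (hm : ∀ m, y ∉ Q.Ks m) :
    ∃ U, IsOpen U ∧ y ∈ U ∧ ∀ n ≥ 1, ∀ y' ∈ U, Q.F^[n] y' ∉ U := by
  obtain ⟨k, w, hw, rfl⟩ := Q.cases h h0
  have hC : w ∉ Q.C k := fun hc => (Q.C_Ks hc).elim hm
  by_cases hk : Q.Pk k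
  · obtain ⟨s, hs1, hs2⟩ := exists_between (Q.lyap k hk w hC hw).1
    have cW := Q.continuous_W' k
    refine ⟨{y | ‖Q.W' k y‖ < 1} ∩ (Q.W' k ⁻¹' (Q.C k)ᶜ ∩ ({y | s < ‖Q.W' k y‖} ∩
      {y | Q.N k (Q.W' k y) < s})), ?_, ?_, ?_⟩
    · exact (isOpen_lt cW.norm continuous_const).inter
        (((Q.C_closed k).isOpen_compl.preimage cW).inter
        ((isOpen_lt continuous_const cW.norm).inter
        (isOpen_lt ((Q.N_cont k hk).comp cW) continuous_const)))
    · simp only [mem_inter_iff, mem_ofPred_eq, mem_preimage, Q.W'_W]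
      exact ⟨hw, hC, hs2, hs1⟩
    · rintro n hn y' ⟨h1, h2, h3, h4⟩ ⟨h5, h6, h7, -⟩
      have key : ∀ n, ∃ k' w', Q.Pk k' ∧ Q.C k' = Q.C k ∧ ‖w'‖ < 1 ∧ Q.F^[n+1] y' = Q.W k' w' ∧
          (w' ∈ Q.C k ∨ ‖w'‖ < s) := by
        intro n
        induction n with
        | zero =>
          have hg := (Q.lyap k hk _ h2 h1).2
          have h4 : Q.N k (Q.W' k y') < s := h4
          have h1' : ‖Q.W' k y'‖ < 1 := h1
          have h3' : s < ‖Q.W' k y'‖ := h3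
          refine ⟨Q.nx k, Q.g k (Q.W' k y'), Q.Pk_nx hk, Q.C_nx hk, ?_,
            Q.F_q (Q.pi_q'.2 h1'.le), hg.imp_right fun h => h.trans_lt h4⟩
          rcases hg with ⟨m, i, -, hg⟩ | hg
          · linarith [Q.B_lt hg]
          · linarith
        | succ n ih =>
          obtain ⟨k', w', hk', hCk, hw1, e, hor⟩ := ih
          have hF : Q.F^[n+1+1] y' = Q.W (Q.nx k') (Q.g k' w') := by
            rw [Function.iterate_succ_apply', e, Q.F_W hw1.le]
          have hl := (Q.lyap k' hk' w')
          by_cases hc : w' ∈ Q.C k'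
          · obtain ⟨m, i, ei, hB⟩ := hc
            have hB' := Q.ins_B ei hB
            rw [← Q.g_C k' hk' w' ⟨m, i, ei, hB⟩] at hB'
            exact ⟨_, _, Q.Pk_nx hk', (Q.C_nx hk').trans hCk, by linarith [Q.B_lt hB'], hF,
              Or.inl (hCk ▸ ⟨m, i, ei, hB'⟩)⟩
          · obtain ⟨l1, l2⟩ := hl hc hw1
            have hs' := hor.resolve_left (hCk ▸ hc)
            rw [hCk] at l2
            refine ⟨_, _, Q.Pk_nx hk', (Q.C_nx hk').trans hCk, ?_, hF,
              l2.imp_right fun h => by linarith⟩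
            rcases l2 with ⟨m, i, -, hg⟩ | hg
            · linarith [Q.B_lt hg]
            · linarith
      obtain ⟨n, rfl⟩ := Nat.exists_eq_add_of_le' hn
      obtain ⟨k', w', -, -, hw1, e, hor⟩ := key n
      have h5 : ‖Q.W' k (Q.F^[n+1] y')‖ < 1 := h5
      have ek : k' = k := Q.inj (by rw [← Q.pi_W.2 hw1.le, ← e, Q.pi_q'.2 h5.le])
      subst ek
      have h7 : s < ‖Q.W' k' (Q.F^[n+1] y')‖ := h7
      have h6 : Q.W' k' (Q.F^[n+1] y') ∉ Q.C k' := h6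
      rw [e, Q.W'_W] at h6 h7
      rcases hor with h | h
      · exact h6 h
      · linarith
  · refine ⟨{y | ‖Q.W' k y‖ < 1}, isOpen_lt (Q.continuous_W' k).norm continuous_const, ?_, ?_⟩
    · rw [mem_ofPred_eq, Q.W'_W]; exact hw
    · intro n hn y' (h1 : ‖Q.W' k y'‖ < 1) (h2 : ‖Q.W' k (Q.F^[n] y')‖ < 1)
      obtain ⟨w', hw', e⟩ := Q.it_W h1.le n
      rw [Q.W_W'] at e
      exact hk (Q.Pk_ret hn (Q.inj (by rw [← Q.pi_W.2 hw', ← e, Q.pi_q'.2 h2.le])))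

lemma P_iter {m c x} (h : (Q.χ m)^[c] x ∈ Q.P m) : x ∈ Q.P m := by
  induction c with
  | zero => exact h
  | succ c ih => rw [Function.iterate_succ_apply'] at h; exact ih (Q.P_back _ _ h)

lemma F_diff {y n m i z} (hi : i < Q.per m) (hz : z ∈ Q.P m) (h : Q.F^[n] y = Q.φ m i z) :
    (∃ k w, ‖w‖ < 1 ∧ Q.W k w = y) ∧ ∃ A', InvD d A' ∧ HasFDerivAt Q.F A' y := by
  have hz1 := (Q.P_lt m z hz).le
  obtain ⟨k, w, hw, rfl⟩ : ∃ k w, ‖w‖ < 1 ∧ Q.W k w = y := by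
    have key : ∀ n y k w, ‖w‖ < 1 → Q.F^[n] y = Q.W k w → ∃ k w, ‖w‖ < 1 ∧ Q.W k w = y := by
      intro n
      induction n with
      | zero => intro y k w hw e; exact ⟨k, w, hw, e.symm⟩
      | succ n ih =>
        intro y k w hw e
        obtain ⟨k', w', hw', e'⟩ := ih (Q.F y) k w hw e
        have hp : Q.ft (Q.pi y) = Q.q k' := by rw [← Q.pi_F, ← e', Q.pi_W.2 hw'.le]
        obtain ⟨j, hj⟩ := Q.preQ _ _ hp
        refine ⟨j, Q.W' j y, lt_of_le_of_ne (Q.pi_q'.1 hj) fun h1 => ?_, Q.W_W' j y⟩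
        have h2 := Q.fr_maps h1
        rw [hj, Q.ft_q] at hp
        rw [Q.inj hp, ← e', Q.W'_W] at h2
        linarith
    exact key n y _ _ (Q.B1 hz1) h
  refine ⟨⟨k, w, hw, rfl⟩, ?_⟩
  have fin : (∃ A', InvD d A' ∧ HasFDerivAt (Q.g k) A' w) →
      ∃ A', InvD d A' ∧ HasFDerivAt Q.F A' (Q.W k w) := by
    rintro ⟨A', h1, h2⟩
    have a1 : HasFDerivAt (Q.W' k) ((Q.a k)⁻¹ • ContinuousLinearMap.id ℝ (Eucl d)) (Q.W k w) :=
      ((hasFDerivAt_id (𝕜 := ℝ) (Q.W k w)).sub_const (Q.c k)).const_smul (Q.a k)⁻¹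
    have a2 : HasFDerivAt (Q.W (Q.nx k)) (Q.a (Q.nx k) • ContinuousLinearMap.id ℝ (Eucl d)) (Q.g k w) :=
      ((hasFDerivAt_id (𝕜 := ℝ) (Q.g k w)).const_smul (Q.a (Q.nx k))).const_add (Q.c (Q.nx k))
    have p1 := Q.a_pos k
    have p2 := Q.a_pos (Q.nx k)
    have h2' : HasFDerivAt (Q.g k) A' (Q.W' k (Q.W k w)) := by rwa [Q.W'_W]
    have a3 : HasFDerivAt (Q.g k ∘ Q.W' k) _ (Q.W k w) := h2'.comp _ a1
    have a2' : HasFDerivAt (Q.W (Q.nx k)) (Q.a (Q.nx k) • ContinuousLinearMap.id ℝ (Eucl d))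
      ((Q.g k ∘ Q.W' k) (Q.W k w)) := by rwa [Function.comp_apply, Q.W'_W]
    refine ⟨_, (InvD.smul p2.ne' fun _ => p2).comp
      (h1.comp (InvD.smul (inv_pos.2 p1).ne' fun _ => inv_pos.2 p1)),
      (a2'.comp _ a3).congr_of_eventuallyEq ?_⟩
    have : {y | ‖Q.W' k y‖ < 1} ∈ 𝓝 (Q.W k w) :=
      (isOpen_lt (Q.continuous_W' k).norm continuous_const).mem_nhds (by
        rw [mem_ofPred_eq, Q.W'_W]; exact hw)
    filter_upwards [this] with y (hy : ‖Q.W' k y‖ < 1)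
    exact Q.F_q (Q.pi_q'.2 hy.le)
  rcases Q.g_diff k w hw with hD | hA | ⟨m', i', x, hi', hk, hx, hg, hP⟩
  · exfalso
    have key : ∀ n, ∃ w', w' ∈ Q.Dd (Q.nx^[n] k) ∧ Q.F^[n] (Q.W k w) = Q.W (Q.nx^[n] k) w' := by
      intro n
      induction n with
      | zero => exact ⟨w, hD, rfl⟩
      | succ n ih =>
        obtain ⟨w', h1, h2⟩ := ih
        rw [Function.iterate_succ_apply', Function.iterate_succ_apply']
        exact ⟨_, Q.Dd_maps _ _ h1, by rw [h2, Q.F_W (Q.Dd_1 _ _ h1)]⟩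
    obtain ⟨w', h1, h2⟩ := key n
    rw [h, φ] at h2
    have hk : Q.κ m i = Q.nx^[n] k :=
      Q.inj ((Q.pi_φ hz1).symm.trans ((congrArg Q.pi h2).trans (Q.pi_W.2 (Q.Dd_1 _ _ h1))))
    rw [← hk] at h2 h1
    rw [← Q.W_inj _ h2] at h1
    exact Q.Dd_C _ _ h1 ⟨m, i, rfl, Q.mem_B hz1⟩
  · exact fin hA
  · have hF : Q.F (Q.W k w) = Q.F (Q.φ m' i' x) := by
      rw [φ, hk, Q.F_W hw.le, Q.F_W (Q.B1 hx).le, hg]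
    obtain ⟨n', i2, z2, hi2, hz2, h2⟩ : ∃ n' i2 z2, i2 < Q.per m ∧ z2 ∈ Q.P m ∧
        Q.F^[n'+1] (Q.W k w) = Q.φ m i2 z2 := by
      rcases n with _ | n
      · obtain ⟨i2, hi2, c, e⟩ := Q.F_step hi hz1
        exact ⟨0, i2, _, hi2, (Q.iter_diff m c hz).1, (congrArg Q.F h).trans e⟩
      · exact ⟨n, i, z, hi, hz, h⟩
    rw [Function.iterate_succ_apply, hF, ← Function.iterate_succ_apply] at h2
    obtain ⟨i3, hi3, c, e⟩ := Q.F_iter hi' hx (n'+1)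
    obtain ⟨rfl, -, e2⟩ := Q.φ_cross hi3 hi2 (((Q.χ_ext m').iter c).maps x hx) (Q.P_lt m z2 hz2).le
      (e.symm.trans h2)
    exact fin (hP (Q.P_iter (e2 ▸ hz2)))
end TD

open Filter Topology Set MeasureTheory Dynamics
open scoped ENNReal

def Col {α E : Type*} [PseudoMetricSpace E] (g : ℕ → α → E) (X : Set α) (ε : ℝ) (n : ℕ) (c : ℝ) : Prop :=
  ∃ (ι : Type) (_ : Fintype ι) (P : ι → Set α), (Fintype.card ι : ℝ) ≤ c ∧ X ⊆ ⋃ j, P j ∧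
    ∀ j, ∀ x ∈ P j, ∀ y ∈ P j, ∀ i < n, dist (g i x) (g i y) ≤ ε

def Cov {E : Type*} [PseudoMetricSpace E] (T : E → E) (X : Set E) (a : ℝ) : Prop :=
  ∀ ε > 0, ∃ C, ∀ n : ℕ, Col (fun i => T^[i]) X ε n (C * Real.exp (a * n))

namespace Col
variable {α β E E' : Type*} [PseudoMetricSpace E] [PseudoMetricSpace E'] {g : ℕ → α → E} {X Y : Set α}
  {ε c c' : ℝ} {n : ℕ}

lemma nonneg (h : Col g X ε n c) : 0 ≤ c := by
  obtain ⟨ι, _, P, h, -⟩ := h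
  exact (Nat.cast_nonneg _).trans h
lemma mono_c (h : Col g X ε n c) (hc : c ≤ c') : Col g X ε n c' := by
  obtain ⟨ι, i, P, h, h'⟩ := h
  exact ⟨ι, i, P, h.trans hc, h'⟩
/-- pull back a coloring, possibly along a choice relation -/
lemma pull {g' : ℕ → β → E'} {X' : Set β} {ε' : ℝ} {n' : ℕ} (h : Col g X ε n c) (R : β → α → Prop)
    (hX : ∀ y ∈ X', ∃ x ∈ X, R y x)
    (hd : ∀ y y' x x', R y x → R y' x' → (∀ i < n, dist (g i x) (g i x') ≤ ε) →
      ∀ i < n', dist (g' i y) (g' i y') ≤ ε') : Col g' X' ε' n' c := by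
  obtain ⟨ι, i, P, h, hP, h'⟩ := h
  refine ⟨ι, i, fun j => {y | ∃ x ∈ P j, R y x}, h, fun y hy => ?_, ?_⟩
  · obtain ⟨x, hx, hR⟩ := hX y hy
    obtain ⟨j, hj⟩ := mem_iUnion.1 (hP hx)
    exact mem_iUnion.2 ⟨j, x, hj, hR⟩
  · rintro j y ⟨x, hx, hR⟩ y' ⟨x', hx', hR'⟩
    exact hd _ _ _ _ hR hR' (h' j x hx x' hx')
lemma mono {n' : ℕ} {ε' : ℝ} (h : Col g X ε n c) (hX : Y ⊆ X) (he : ε ≤ ε') (hn : n' ≤ n) :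
    Col g Y ε' n' c :=
  h.pull (fun y x => y = x) (fun y hy => ⟨y, hX hy, rfl⟩) (by
    rintro y y' _ _ rfl rfl h i hi; exact (h i (hi.trans_le hn)).trans he)
lemma fin_union {κ : Type} [Fintype κ] {Z : κ → Set α} {cc : κ → ℝ} (h : ∀ k, Col g (Z k) ε n (cc k))
    (hX : X ⊆ ⋃ k, Z k) : Col g X ε n (∑ k, cc k) := by
  choose ι i P h1 h2 h3 using h
  refine ⟨(k : κ) × ι k, inferInstance, fun z => P z.1 z.2, ?_, fun x hx => ?_, fun j => h3 _ _⟩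
  · rw [Fintype.card_sigma]; push_cast; exact Finset.sum_le_sum fun k _ => h1 k
  · obtain ⟨k, hk⟩ := mem_iUnion.1 (hX hx)
    obtain ⟨j, hj⟩ := mem_iUnion.1 (h2 k hk)
    exact mem_iUnion.2 ⟨⟨k, j⟩, hj⟩
lemma union (h : Col g X ε n c) (h' : Col g Y ε n c') : Col g (X ∪ Y) ε n (c + c') := by
  have := fin_union (κ := Bool) (Z := fun b => bif b then X else Y) (X := X ∪ Y) (g := g) (ε := ε) (n := n)
    (cc := fun b => bif b then c else c') (by rintro (_ | _) <;> assumption)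
    (by rintro x (hx | hx); exacts [mem_iUnion.2 ⟨true, hx⟩, mem_iUnion.2 ⟨false, hx⟩])
  simpa using this
/-- fiberwise refinement -/
lemma refine {g' : ℕ → α → E'} {ε' : ℝ} {n' : ℕ} (h : Col g X ε n c) (hc' : 0 ≤ c')
    (h' : ∀ Z ⊆ X, (∀ x ∈ Z, ∀ y ∈ Z, ∀ i < n, dist (g i x) (g i y) ≤ ε) → Col g' Z ε' n' c') :
    Col g' X ε' n' (c * c') := by
  obtain ⟨ι, i, P, h, hP, h3⟩ := h
  have := fin_union (Z := fun j => X ∩ P j) (X := X) (cc := fun _ => c')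
    (fun j => h' (X ∩ P j) inter_subset_left fun x hx y hy => h3 j x hx.2 y hy.2)
    (fun x hx => by rw [← inter_iUnion]; exact ⟨hx, hP hx⟩)
  refine this.mono_c ?_
  rw [Finset.sum_const, nsmul_eq_mul]
  exact mul_le_mul_of_nonneg_right h hc'
lemma one (hX : ∀ x ∈ X, ∀ y ∈ X, ∀ i < n, dist (g i x) (g i y) ≤ ε) : Col g X ε n 1 :=
  ⟨Unit, inferInstance, fun _ => X, by simp, fun x hx => mem_iUnion.2 ⟨(), hx⟩, fun _ => hX⟩
lemma shadow {δ : ℝ} (h : Col g X ε n c) (hY : ∀ y ∈ Y, ∃ x ∈ X, ∀ i < n, dist (g i y) (g i x) ≤ δ) :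
    Col g Y (ε + 2 * δ) n c :=
  h.pull (fun y x => ∀ i < n, dist (g i y) (g i x) ≤ δ) hY fun y y' x x' h1 h2 h3 i hi => by
    linarith [dist_triangle4_right (g i y) (g i y') (g i x) (g i x'), h1 i hi, h2 i hi, h3 i hi]
lemma concat {T : E → E} {X Y : Set E} {k : ℕ} (h : Col (fun i => T^[i]) X ε n c)
    (h' : Col (fun i => T^[i]) Y ε k c')
    (hT : ∀ x ∈ X, T^[n] x ∈ Y) : Col (fun i => T^[i]) X ε (n + k) (c * c') := by
  obtain ⟨ι, i, P, h, hP, h3⟩ := h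
  obtain ⟨ι', i', P', h', hP', h3'⟩ := h'
  refine ⟨ι × ι', inferInstance, fun z => P z.1 ∩ T^[n] ⁻¹' P' z.2, ?_, fun x hx => ?_, ?_⟩
  · rw [Fintype.card_prod]; push_cast; gcongr; exact (Nat.cast_nonneg _).trans h
  · obtain ⟨j, hj⟩ := mem_iUnion.1 (hP hx)
    obtain ⟨j', hj'⟩ := mem_iUnion.1 (hP' (hT x hx))
    exact mem_iUnion.2 ⟨(j, j'), hj, hj'⟩
  · rintro ⟨j, j'⟩ x ⟨hx, hx'⟩ y ⟨hy, hy'⟩ l hl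
    by_cases hln : l < n
    · exact h3 j x hx y hy l hln
    · have := h3' j' _ hx' _ hy' (l - n) (by omega)
      simp only [← Function.iterate_add_apply] at this
      rwa [Nat.sub_add_cancel (by omega)] at this
end Col

namespace Cov
variable {E : Type*} [PseudoMetricSpace E] {T : E → E} {X Y : Set E} {a : ℝ}
lemma mono (h : Cov T X a) (hY : Y ⊆ X) : Cov T Y a := fun ε he => by
  obtain ⟨C, h⟩ := h ε he
  exact ⟨C, fun n => (h n).mono hY le_rfl le_rfl⟩
lemma mono_a {b : ℝ} (h : Cov T X a) (hb : a ≤ b) : Cov T X b := fun ε he => by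
  obtain ⟨C, h⟩ := h ε he
  have hC : 0 ≤ C := by simpa using (h 0).nonneg
  exact ⟨C, fun n => (h n).mono_c (by gcongr)⟩
lemma union (h : Cov T X a) (h' : Cov T Y a) : Cov T (X ∪ Y) a := fun ε he => by
  obtain ⟨C, h⟩ := h ε he
  obtain ⟨C', h'⟩ := h' ε he
  exact ⟨C + C', fun n => ((h n).union (h' n)).mono_c (by rw [add_mul])⟩
lemma biUnion {κ : Type*} {Z : κ → Set E} {s : Set κ} (hs : s.Finite) (h : ∀ k, Cov T (Z k) a) :
    Cov T (⋃ k ∈ s, Z k) a := by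
  induction s, hs using Set.Finite.induction_on with
  | empty => exact fun ε he => ⟨0, fun n => ⟨Empty, inferInstance, fun _ => ∅, by simp, by simp, by simp⟩⟩
  | insert _ _ ih => rw [biUnion_insert]; exact (h _).union ih
lemma image (i : ℕ) (h : Cov T X a) : Cov T (T^[i] '' X) a := fun ε he => by
  obtain ⟨C, h⟩ := h ε he
  refine ⟨C * Real.exp (a * i), fun n => ?_⟩
  rw [mul_assoc, ← Real.exp_add, ← mul_add, ← Nat.cast_add]
  refine (h (i + n)).pull (fun y x => T^[i] x = y) (fun y ⟨x, hx, e⟩ => ⟨x, hx, e⟩) ?_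
  rintro _ _ x x' rfl rfl h j hj
  simpa only [← Function.iterate_add_apply] using h (j + i) (by omega)

lemma congr {T' : E → E} (h : Cov T X a) (hX : MapsTo T X X) (e : EqOn T T' X) : Cov T' X a := by
  have key : ∀ i, ∀ x ∈ X, T^[i] x = T'^[i] x ∧ T^[i] x ∈ X := by
    intro i
    induction i with
    | zero => exact fun x hx => ⟨rfl, hx⟩
    | succ i ih =>
      intro x hx
      obtain ⟨h1, h2⟩ := ih x hx
      rw [Function.iterate_succ_apply', Function.iterate_succ_apply', ← h1]
      exact ⟨e h2, hX h2⟩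
  intro ε he
  obtain ⟨C, h⟩ := h ε he
  refine ⟨C, fun n => (h n).pull (fun y x => y = x ∧ x ∈ X) (fun y hy => ⟨y, hy, rfl, hy⟩) ?_⟩
  rintro y y' _ _ ⟨rfl, h1⟩ ⟨rfl, h2⟩ h i hi
  rw [← (key i y h1).1, ← (key i y' h2).1]; exact h i hi

lemma le (h : Cov T X a) : coverEntropy T X ≤ a := by
  refine iSup₂_le fun U hU => ?_
  obtain ⟨ε, he, hU⟩ := Metric.mem_uniformity_dist.1 hU
  obtain ⟨C, h⟩ := h (ε / 2) (by linarith)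
  have hC : 0 ≤ C := by simpa using (h 0).nonneg
  rw [coverEntropyEntourage]
  refine (ExpGrowth.expGrowthSup_le_of_eventually_le (b := ENNReal.ofReal C) (v := fun n : ℕ => EReal.exp ((a : EReal) * n))
    ENNReal.ofReal_ne_top (Eventually.of_forall fun n => ?_)).trans_eq ExpGrowth.expGrowthSup_exp
  obtain ⟨ι, _, P, hc, hP, hd⟩ := h n
  have : ∃ s : Finset E, s.card ≤ Fintype.card ι ∧ IsDynCoverOf T X U n s := by
    classical
    by_cases hE : Nonempty E
    · obtain ⟨x0⟩ := hE
      refine ⟨Finset.univ.image fun j => if h : (P j).Nonempty then h.some else x0,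
        Finset.card_image_le.trans (by simp), fun x hx => ?_⟩
      obtain ⟨j, hj⟩ := mem_iUnion.1 (hP hx)
      have hne : (P j).Nonempty := ⟨x, hj⟩
      refine ⟨hne.some, by simpa using ⟨j, by rw [dif_pos hne]⟩, ?_⟩
      rw [mem_dynEntourage]
      exact fun i hi => hU (by linarith [hd j x hj _ hne.some_mem i hi])
    · exact ⟨∅, by simp, fun x => (hE ⟨x⟩).elim⟩
  obtain ⟨s, hs, hcov⟩ := this
  calc ((coverMincard T X U n : ℕ∞) : ℝ≥0∞) ≤ (Fintype.card ι : ℝ≥0∞) := by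
        have := hcov.coverMincard_le_card.trans (Nat.cast_le.2 hs)
        exact_mod_cast ENat.toENNReal_mono this
    _ = ENNReal.ofReal (Fintype.card ι : ℝ) := (ENNReal.ofReal_natCast _).symm
    _ ≤ ENNReal.ofReal (C * Real.exp (a * n)) := ENNReal.ofReal_le_ofReal hc
    _ = ENNReal.ofReal C * EReal.exp ((a : EReal) * n) := by
        rw [ENNReal.ofReal_mul hC, show (a : EReal) * n = ((a * n : ℝ) : EReal) by push_cast; rfl, EReal.exp_coe]

lemma of_lt (h : coverEntropy T X < a) : Cov T X a := by
  intro ε he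
  set U : Set (E × E) := {p | dist p.1 p.2 < ε / 2} with hU
  have h1 : coverEntropyEntourage T X U < a :=
    (coverEntropyEntourage_le_coverEntropy T X (Metric.dist_mem_uniformity (by linarith))).trans_lt h
  rw [coverEntropyEntourage] at h1
  obtain ⟨n0, hn0⟩ := eventually_atTop.1 (ExpGrowth.eventually_le_exp h1)
  refine ⟨Real.exp (a * n0), fun n => ?_⟩
  have h2 := hn0 (n + n0) (by omega)
  rw [show (a : EReal) * ((n + n0 : ℕ) : EReal) = ((a * (n + n0 : ℕ) : ℝ) : EReal) by push_cast; rfl,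
    EReal.exp_coe] at h2
  have hfin : coverMincard T X U (n + n0) < ⊤ := by
    rw [← ENat.toENNReal_lt, ENat.toENNReal_top]; exact h2.trans_lt ENNReal.ofReal_lt_top
  obtain ⟨s, hs, hc⟩ := (coverMincard_finite_iff T X U (n + n0)).1 hfin
  rw [← hc] at h2
  refine Col.mono (n := n + n0) ?_ Subset.rfl le_rfl (by omega)
  have hn : ((s.card : ℕ) : ℝ) ≤ Real.exp (a * (n + n0 : ℕ)) := by
    rw [← ENNReal.ofReal_le_ofReal_iff (Real.exp_pos _).le, ENNReal.ofReal_natCast]; exact_mod_cast h2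
  have hcol : Col (fun i => T^[i]) (s : Set E) 0 (n + n0) (s.card : ℝ) := by
    refine ⟨Fin s.card, inferInstance, fun j => {(s.equivFin.symm j : E)}, by simp, fun x hx => ?_, ?_⟩
    · exact mem_iUnion.2 ⟨s.equivFin ⟨x, hx⟩, by simp⟩
    · rintro j x rfl y rfl i -; simp
  rw [← Real.exp_add, ← mul_add, add_comm (n0 : ℝ), ← Nat.cast_add]
  have := (hcol.shadow (Y := X) (δ := ε / 2) fun y hy => ?_).mono_c hn
  · rwa [zero_add, mul_div_cancel₀ _ two_ne_zero] at this
  · obtain ⟨x, hx, hd⟩ := hs hy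
    rw [mem_dynEntourage] at hd
    exact ⟨x, hx, fun i hi => (show dist _ _ < _ from hd i hi).le⟩
end Cov

open Filter Topology Set MeasureTheory Dynamics
open scoped ENNReal

noncomputable def gam (t : ℝ) : Eucl 2 := !₂[Real.cos t, Real.sin t]
lemma gam_cont : Continuous gam := by
  unfold gam
  refine (PiLp.continuous_toLp 2 _).comp (continuous_pi fun i => ?_)
  fin_cases i
  exacts [Real.continuous_cos, Real.continuous_sin]
lemma gam_norm (t) : ‖gam t‖ = 1 := by
  rw [EuclideanSpace.norm_eq, Real.sqrt_eq_one]
  simp [gam, Fin.sum_univ_two]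
lemma gam_inj : InjOn gam (Ioc (-Real.pi) Real.pi) := by
  intro t ht s hs h
  have h0 : Real.cos t = Real.cos s := congrArg (fun w : Eucl 2 => w 0) h
  have h1 : Real.sin t = Real.sin s := congrArg (fun w : Eucl 2 => w 1) h
  rw [← Complex.arg_cos_add_sin_mul_I ht, ← Complex.arg_cos_add_sin_mul_I hs, ← Complex.ofReal_cos,
    ← Complex.ofReal_sin, h0, h1]
  simp
lemma gam_surj {w : Eucl 2} (h : ‖w‖ = 1) : ∃ t ∈ Ioc (-Real.pi) Real.pi, gam t = w := by
  have hz : ‖(⟨w 0, w 1⟩ : ℂ)‖ = 1 := by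
    rw [← h, EuclideanSpace.norm_eq, Complex.norm_eq_sqrt_sq_add_sq]; simp [Fin.sum_univ_two]
  have hne : (⟨w 0, w 1⟩ : ℂ) ≠ 0 := by intro h0; rw [h0] at hz; simp at hz
  refine ⟨Complex.arg ⟨w 0, w 1⟩, Complex.arg_mem_Ioc _, ?_⟩
  ext i
  fin_cases i
  · simp [gam, Complex.cos_arg hne, hz]
  · simp [gam, Complex.sin_arg, hz]

lemma grid_fin {e : ℝ} (he : 0 < e) : {w : Eucl 2 | ‖w‖ = 1 ∧ ∃ (j : Fin 2) (k : ℤ), w j = e * k}.Finite := by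
  obtain ⟨N, hN⟩ := exists_nat_gt (1 / e)
  set R : Set ℝ := ⋃ k ∈ Icc (-(N : ℤ)) N, {e * k, √(1 - (e * k) ^ 2), -√(1 - (e * k) ^ 2)}
  have hR : R.Finite := (finite_Icc _ _).biUnion fun k _ => by simp
  refine (hR.image2 (fun a b => (!₂[a, b] : Eucl 2)) hR).subset ?_
  rintro w ⟨hw, j, k, hk⟩
  have hs : w 0 ^ 2 + w 1 ^ 2 = 1 := by
    have := EuclideanSpace.norm_sq_eq w
    rw [hw] at this; simpa [Fin.sum_univ_two] using this.symm
  have key : ∀ a b : ℝ, a ^ 2 + b ^ 2 = 1 → a = e * k → a ∈ R ∧ b ∈ R := by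
    intro a b h1 h2
    have hk : k ∈ Icc (-(N : ℤ)) N := by
      have h3 : |e * k| ≤ 1 := by rw [← h2, ← sq_le_one_iff_abs_le_one]; nlinarith
      rw [abs_mul, abs_of_pos he] at h3
      have h4 : |(k : ℝ)| ≤ N := by
        rw [div_lt_iff₀ he] at hN
        by_contra hc; push Not at hc; nlinarith
      rw [abs_le] at h4
      exact ⟨by exact_mod_cast h4.1, by exact_mod_cast h4.2⟩
    refine ⟨mem_biUnion hk (by simp [h2]), mem_biUnion hk ?_⟩
    have : b ^ 2 = 1 - (e * k) ^ 2 := by rw [← h2]; linarith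
    rw [← this, Real.sqrt_sq_eq_abs]
    rcases abs_choice b with h | h <;> simp [h]
  have he2 : (!₂[w 0, w 1] : Eucl 2) = w := by ext i; fin_cases i <;> simp
  fin_cases j
  · obtain ⟨h1, h2⟩ := key _ _ hs hk
    exact ⟨_, h1, _, h2, he2⟩
  · obtain ⟨h1, h2⟩ := key _ _ ((add_comm _ _).trans hs) hk
    exact ⟨_, h2, _, h1, he2⟩

lemma grid_ivt {u : ℝ → ℝ} {e t t' : ℝ} (he : 0 < e) (htt : t ≤ t') (hu : ContinuousOn u (Icc t t'))
    (h : ∀ s ∈ Icc t t', ∀ k : ℤ, u s ≠ e * k) : |u t - u t'| ≤ e := by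
  by_contra hc
  push Not at hc
  have key : ∀ x y, x + e < y → ∃ k : ℤ, e * k ∈ Icc x y := by
    intro x y hxy
    refine ⟨⌈x / e⌉, ?_, ?_⟩
    · have := Int.le_ceil (x / e); rw [div_le_iff₀ he] at this; linarith
    · have := (Int.ceil_lt_add_one (x / e)).le
      have := mul_le_mul_of_nonneg_left this he.le
      rw [mul_add, mul_div_cancel₀ _ he.ne'] at this; linarith
  rcases lt_abs.1 hc with hc | hc
  · obtain ⟨k, hk⟩ := key (u t') (u t) (by linarith)
    obtain ⟨s, hs, e1⟩ := intermediate_value_Icc' htt hu hk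
    exact h s hs k e1
  · obtain ⟨k, hk⟩ := key (u t) (u t') (by linarith)
    obtain ⟨s, hs, e1⟩ := intermediate_value_Icc htt hu hk
    exact h s hs k e1

lemma circle_col {G : ℕ → Eucl 2 → Eucl 2} (hc : ∀ i, ContinuousOn (G i) (Metric.sphere 0 1))
    (hi : ∀ i, InjOn (G i) (Metric.sphere 0 1)) (hm : ∀ i w, ‖w‖ = 1 → ‖G i w‖ = 1) {ε : ℝ} (he : 0 < ε) :
    ∃ C, ∀ n : ℕ, Col G (Metric.sphere 0 1) ε n (C * (n + 1)) := by
  classical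
  have he2 : 0 < ε / 2 := by linarith
  set I := Ioc (-Real.pi) Real.pi
  have hZ := grid_fin he2
  set Z := {w : Eucl 2 | ‖w‖ = 1 ∧ ∃ (j : Fin 2) (k : ℤ), w j = ε / 2 * k} with hZd
  have gs : ∀ t, gam t ∈ Metric.sphere (0 : Eucl 2) 1 := fun t => by simp [gam_norm]
  have hmi : ∀ i, MapsTo (fun t => G i (gam t)) {t | t ∈ I ∧ G i (gam t) ∈ Z} Z := fun i t h => h.2
  have hii : ∀ i, InjOn (fun t => G i (gam t)) {t | t ∈ I ∧ G i (gam t) ∈ Z} :=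
    fun i t h s h' e => gam_inj h.1 h'.1 (hi i (gs t) (gs s) e)
  have hfi : ∀ i, {t | t ∈ I ∧ G i (gam t) ∈ Z}.Finite := fun i => Set.Finite.of_injOn (hmi i) (hii i) hZ
  set p := hZ.toFinset.card
  refine ⟨2 * (p + 1), fun n => ?_⟩
  set τ := (Finset.range n).biUnion fun i => (hfi i).toFinset with hτ
  have hcard : τ.card ≤ n * p := by
    have := Finset.card_biUnion_le_card_mul (Finset.range n) (fun i => (hfi i).toFinset) p fun i _ =>
      Finset.card_le_card_of_injOn _ (by simpa using hmi i) (by simpa using hii i)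
    simpa using this
  have hτm : ∀ t, t ∈ τ ↔ ∃ i < n, t ∈ I ∧ G i (gam t) ∈ Z := by simp [hτ]
  refine ⟨Fin (n * p + 1) × Bool, inferInstance, fun z => {w | ∃ t ∈ I, gam t = w ∧
    (τ.filter (· < t)).card = z.1 ∧ (t ∈ τ ↔ z.2 = true)}, ?_, fun w hw => ?_, ?_⟩
  · simp only [Fintype.card_prod, Fintype.card_fin, Fintype.card_bool]
    push_cast
    nlinarith [(Nat.cast_nonneg p : (0 : ℝ) ≤ p), (Nat.cast_nonneg n : (0 : ℝ) ≤ n)]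
  · obtain ⟨t, ht, rfl⟩ := gam_surj (mem_sphere_zero_iff_norm.1 hw)
    exact mem_iUnion.2 ⟨(⟨(τ.filter (· < t)).card, by
      have := Finset.card_filter_le τ (· < t); omega⟩, decide (t ∈ τ)), t, ht, rfl, rfl, by simp⟩
  · have key : ∀ t ∈ I, ∀ t' ∈ I, t ≤ t' → (τ.filter (· < t)).card = (τ.filter (· < t')).card →
        (t ∈ τ ↔ t' ∈ τ) → ∀ i < n, dist (G i (gam t)) (G i (gam t')) ≤ ε := by
      intro t ht t' ht' htt h1 h2 i hi'
      rcases htt.eq_or_lt with rfl | hlt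
      · simpa using he.le
      have no : ∀ s ∈ Ico t t', s ∉ τ := by
        intro s hs hsτ
        refine h1.not_lt (Finset.card_lt_card ⟨fun x hx => ?_, fun h => ?_⟩)
        · rw [Finset.mem_filter] at hx ⊢; exact ⟨hx.1, hx.2.trans_le htt⟩
        · have := (Finset.mem_filter.1 (h (Finset.mem_filter.2 ⟨hsτ, hs.2⟩))).2
          linarith [hs.1]
      have no' : ∀ s ∈ Icc t t', s ∉ τ := by
        intro s hs
        rcases hs.2.eq_or_lt with rfl | h
        · rw [← h2]; exact no t ⟨le_rfl, hlt⟩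
        · exact no s ⟨hs.1, h⟩
      have hj : ∀ j : Fin 2, |G i (gam t) j - G i (gam t') j| ≤ ε / 2 := fun j => by
        refine grid_ivt (u := fun s => G i (gam s) j) he2 htt ?_ fun s hs k hk => no' s hs ((hτm s).2
          ⟨i, hi', ⟨ht.1.trans_le hs.1, hs.2.trans ht'.2⟩, hm _ _ (gam_norm s), j, k, hk⟩)
        have h5 : ContinuousOn (fun s => G i (gam s)) (Icc t t') :=
          (hc i).comp gam_cont.continuousOn fun s _ => gs s
        exact (EuclideanSpace.proj (𝕜 := ℝ) j).continuous.comp_continuousOn h5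
      rw [EuclideanSpace.dist_eq]
      refine Real.sqrt_le_iff.2 ⟨he.le, ?_⟩
      rw [Fin.sum_univ_two, Real.dist_eq, Real.dist_eq]
      nlinarith [hj 0, hj 1, abs_nonneg (G i (gam t) 0 - G i (gam t') 0), abs_nonneg (G i (gam t) 1 - G i (gam t') 1)]
    rintro z _ ⟨t, ht, rfl, a1, a2⟩ _ ⟨t', ht', rfl, b1, b2⟩ i hi'
    rcases le_total t t' with h | h
    · exact key t ht t' ht' h (a1.trans b1.symm) (a2.trans b2.symm) i hi'
    · rw [dist_comm]; exact key t' ht' t ht h (b1.trans a1.symm) (b2.trans a2.symm) i hi'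

lemma sph_col {d : ℕ} (hd : d = 1 ∨ d = 2) {G : ℕ → Eucl d → Eucl d}
    (hc : ∀ i, ContinuousOn (G i) (Metric.sphere 0 1))
    (hi : ∀ i, InjOn (G i) (Metric.sphere 0 1)) (hm : ∀ i w, ‖w‖ = 1 → ‖G i w‖ = 1) {ε : ℝ} (he : 0 < ε) :
    ∃ C, ∀ n : ℕ, Col G (Metric.sphere 0 1) ε n (C * (n + 1)) := by
  rcases hd with rfl | rfl
  · refine ⟨2, fun n => ⟨Bool, inferInstance, fun b => {w | ‖w‖ = 1 ∧ (0 < w 0 ↔ b = true)}, ?_, fun w hw => ?_, ?_⟩⟩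
    · simp only [Fintype.card_bool]; push_cast; linarith [(Nat.cast_nonneg n : (0 : ℝ) ≤ n)]
    · exact mem_iUnion.2 ⟨decide (0 < w 0), by simpa using hw⟩
    · rintro b w ⟨h1, h2⟩ w' ⟨h1', h2'⟩ i -
      have : w = w' := by
        rw [EuclideanSpace.norm_eq] at h1 h1'
        simp only [Fin.sum_univ_one, Real.norm_eq_abs, sq_abs, Real.sqrt_sq_eq_abs] at h1 h1'
        ext j
        obtain rfl : j = 0 := Subsingleton.elim _ _
        by_cases h : 0 < w 0
        · rw [abs_of_pos h] at h1
          rw [abs_of_pos (h2'.2 (h2.1 h))] at h1'; linarith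
        · have h' : ¬ 0 < w' 0 := fun hh => h (h2.2 (h2'.1 hh))
          rw [abs_of_nonpos (not_lt.1 h)] at h1
          rw [abs_of_nonpos (not_lt.1 h')] at h1'; linarith
      subst this; simpa using he.le
  · exact circle_col hc hi hm he

open Filter Topology Set MeasureTheory Dynamics
open scoped ENNReal

lemma dynBall_open {E : Type*} [PseudoMetricSpace E] {F : E → E} (hF : Continuous F) (X : Set E) (r : ℝ) (n : ℕ) :
    IsOpen {y | ∃ z ∈ X, ∀ i < n, dist (F^[i] y) (F^[i] z) < r} := by
  have : {y | ∃ z ∈ X, ∀ i < n, dist (F^[i] y) (F^[i] z) < r} =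
      ⋃ z ∈ X, ⋂ i ∈ Iio n, {y | dist (F^[i] y) (F^[i] z) < r} := by ext; simp
  rw [this]
  exact isOpen_biUnion fun z _ => (finite_Iio n).isOpen_biInter fun i _ =>
    isOpen_lt ((hF.iterate i).dist continuous_const) continuous_const

lemma bowen {E : Type} [MetricSpace E] {F f p : E → E} (hF : Continuous F) (hp : Continuous p)
    (hs : ∀ y, p (F y) = f (p y)) {K D : Set E} (hK : IsCompact K) (hFK : MapsTo F K K)
    (hD : IsCompact D) (hpD : MapsTo p K D) (hfD : MapsTo f D D)
    (fib : ∀ x ∈ D, ∀ ε > 0, ∀ α > 0, ∃ n ≥ 1, Col (fun i => F^[i]) (K ∩ p ⁻¹' {x}) ε n (Real.exp (α * n)))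
    {a a' : ℝ} (haa : a < a') (hcov : Cov f D a) : Cov F K a' := by
  have hsi : ∀ i y, p (F^[i] y) = f^[i] (p y) := fun i => (Function.Semiconj.iterate_right hs i)
  intro ε he
  set α := a' - a with hα
  have hα0 : 0 < α := by linarith
  choose! nn hn1 hcol using fun x hx => fib x hx (ε / 3) (by linarith) α hα0
  set O : E → Set E := fun x => {y | ∃ z ∈ K ∩ p ⁻¹' {x}, ∀ i < nn x, dist (F^[i] y) (F^[i] z) < ε / 3}
  have hO : ∀ x ∈ D, ∃ δ > 0, ∀ y ∈ K, dist (p y) x < δ → y ∈ O x := by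
    intro x hx
    have hcl : IsClosed (p '' (K \ O x)) := ((hK.diff (dynBall_open hF _ _ _)).image hp).isClosed
    have hxn : x ∈ (p '' (K \ O x))ᶜ := by
      rintro ⟨y, ⟨hy, hyO⟩, rfl⟩
      exact hyO ⟨y, ⟨hy, rfl⟩, fun i _ => by simpa using by linarith⟩
    obtain ⟨δ, hδ, hb⟩ := Metric.isOpen_iff.1 hcl.isOpen_compl x hxn
    exact ⟨δ, hδ, fun y hy hd => by_contra fun hyO => hb hd ⟨y, ⟨hy, hyO⟩, rfl⟩⟩
  choose! δx hδx hO using hO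
  obtain ⟨t, htD, ht⟩ := hD.elim_nhds_subcover (fun x => Metric.ball x (δx x)) fun x hx =>
    Metric.ball_mem_nhds x (hδx x hx)
  obtain ⟨δ, hδ, hleb⟩ := lebesgue_number_lemma_of_metric (ι := t) hD (c := fun x => Metric.ball x.1 (δx x.1))
    (fun _ => Metric.isOpen_ball) (fun x hx => by obtain ⟨y, hy, h⟩ := mem_iUnion₂.1 (ht hx); exact mem_iUnion.2 ⟨⟨y, hy⟩, h⟩)
  set M := t.sup nn
  have claim : ∀ n, ∀ x0 ∈ D, Col (fun i => F^[i]) {y ∈ K | ∀ i < n, dist (f^[i] (p y)) (f^[i] x0) ≤ δ / 2} ε n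
      (Real.exp (α * (n + M))) := by
    intro n
    induction n using Nat.strong_induction_on with
    | _ n ih =>
    intro x0 hx0
    rcases Nat.eq_zero_or_pos n with rfl | hn
    · exact (Col.one (by simp)).mono_c (Real.one_le_exp (by positivity))
    obtain ⟨⟨x, hxt⟩, hx⟩ := hleb x0 hx0
    have hxD := htD x hxt
    have hsub : {y ∈ K | ∀ i < n, dist (f^[i] (p y)) (f^[i] x0) ≤ δ / 2} ⊆ O x := fun y hy =>
      hO x hxD y hy.1 (hx (Metric.mem_ball.2 ((hy.2 0 hn).trans_lt (by linarith))))
    have h1 : Col (fun i => F^[i]) {y ∈ K | ∀ i < n, dist (f^[i] (p y)) (f^[i] x0) ≤ δ / 2} ε (nn x)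
        (Real.exp (α * nn x)) := by
      have := (hcol x hxD).shadow (Y := O x) (δ := ε / 3) fun y ⟨z, hz, h⟩ => ⟨z, hz, fun i hi => (h i hi).le⟩
      exact this.mono hsub (by linarith) le_rfl
    have hnM : nn x ≤ M := Finset.le_sup (f := nn) hxt
    have hnM' : (nn x : ℝ) ≤ M := by exact_mod_cast hnM
    have h1x := hn1 x hxD
    by_cases hle : n ≤ nn x
    · exact (h1.mono Subset.rfl le_rfl hle).mono_c (Real.exp_le_exp.2 (by gcongr; linarith [(Nat.cast_nonneg n : (0:ℝ) ≤ n)]))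
    · have h2 := ih (n - nn x) (by omega) (f^[nn x] x0) (hfD.iterate _ hx0)
      have h3 := h1.concat h2 (by
        rintro y ⟨hy, hy'⟩
        refine ⟨hFK.iterate _ hy, fun i hi => ?_⟩
        rw [hsi, ← Function.iterate_add_apply, ← Function.iterate_add_apply]
        exact hy' _ (by omega))
      rw [Nat.add_sub_cancel' (by omega), ← Real.exp_add, Nat.cast_sub (by omega)] at h3
      convert h3 using 2
      ring
  obtain ⟨C, hC⟩ := hcov (δ / 2) (by linarith)
  refine ⟨C * Real.exp (α * M), fun n => ?_⟩
  have h1 : Col (fun i y => f^[i] (p y)) K (δ / 2) n (C * Real.exp (a * n)) :=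
    (hC n).pull (fun y x => x = p y) (fun y hy => ⟨_, hpD hy, rfl⟩) (by rintro y y' _ _ rfl rfl h; exact h)
  have h2 := h1.refine (g' := fun i => F^[i]) (ε' := ε) (n' := n) (c' := Real.exp (α * (n + M))) (Real.exp_pos _).le (by
    intro Z hZ hd
    rcases Z.eq_empty_or_nonempty with rfl | ⟨z, hz⟩
    · exact (Col.one (by simp)).mono_c (Real.one_le_exp (by positivity))
    · exact (claim n (p z) (hpD (hZ hz))).mono (fun y hy => ⟨hZ hy, hd y hy z hz⟩) le_rfl le_rfl)
  refine h2.mono_c (le_of_eq ?_)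
  rw [mul_assoc, mul_assoc, ← Real.exp_add, ← Real.exp_add]
  congr 2
  rw [hα]; ring

lemma wander {E : Type} [PseudoMetricSpace E] {F : E → E} (hF : Continuous F) {D X : Set E} (hD : IsCompact D)
    (hm : MapsTo F D D) {ε a c : ℝ} {M : ℕ} (he : 0 < ε) (ha : 0 ≤ a)
    (hX : Col (fun i => F^[i]) X ε M c) (hc : c ≤ Real.exp (a * M) / 2)
    (hcov : ∀ y ∈ D, (∃ x ∈ X, ∀ i < M, dist (F^[i] y) (F^[i] x) < 3 * ε) ∨
      ∃ U, IsOpen U ∧ y ∈ U ∧ ∀ n ≥ 1, ∀ y' ∈ U, F^[n] y' ∉ U) (hM : 1 ≤ M) :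
    ∃ C, ∀ n : ℕ, Col (fun i => F^[i]) D (7 * ε) n (C * Real.exp (a * n)) := by
  classical
  set V := {y | ∃ x ∈ X, ∀ i < M, dist (F^[i] y) (F^[i] x) < 3 * ε} with hV
  have hVc : Col (fun i => F^[i]) V (7 * ε) M c := by
    have := hX.shadow (Y := V) (δ := 3 * ε) fun y ⟨x, hx, h⟩ => ⟨x, hx, fun i hi => (h i hi).le⟩
    exact this.mono Subset.rfl (by linarith) le_rfl
  have hc0 := hX.nonneg
  have hU : ∀ y ∈ D \ V, ∃ U, IsOpen U ∧ y ∈ U ∧ (∀ n ≥ 1, ∀ y' ∈ U, F^[n] y' ∉ U) ∧ U ⊆ Metric.ball y ε := by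
    rintro y ⟨h1, h2⟩
    obtain ⟨U, h3, h4, h5⟩ := (hcov y h1).resolve_left h2
    exact ⟨U ∩ Metric.ball y ε, h3.inter Metric.isOpen_ball, ⟨h4, Metric.mem_ball_self he⟩,
      fun n hn y' hy' h => h5 n hn y' hy'.1 h.1, inter_subset_right⟩
  choose! U hUo hyU hUw hUb using hU
  obtain ⟨t, htD, ht⟩ := (hD.diff (dynBall_open hF X (3 * ε) M)).elim_nhds_subcover U fun y hy =>
    (hUo y hy).mem_nhds (hyU y hy)
  set DJ : Finset E → Set E := fun J => {y ∈ D | ∀ i, ∀ j ∈ t, F^[i] y ∈ U j → j ∈ J} with hDJ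
  have claim : ∀ J : Finset E, J ⊆ t → ∃ C, ∀ n : ℕ, Col (fun i => F^[i]) (DJ J) (7 * ε) n (C * Real.exp (a * n)) := by
    intro J
    induction J using Finset.strongInduction with
    | _ J ih =>
    intro hJ
    choose Cj hCj using fun j : J => ih (J.erase j) (Finset.erase_ssubset j.2) ((Finset.erase_subset _ _).trans hJ)
    have hCj0 : ∀ j, 0 ≤ Cj j := fun j => by simpa using (hCj j 0).nonneg
    have hS : 0 ≤ ∑ j, Cj j := Finset.sum_nonneg fun j _ => hCj0 j
    set C := 2 * (c + 1 + ∑ j, Cj j) with hC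
    have hC0 : 0 ≤ C := by positivity
    refine ⟨C, fun n => ?_⟩
    induction n using Nat.strong_induction_on with
    | _ n ihn =>
    rcases Nat.eq_zero_or_pos n with rfl | hn
    · exact (Col.one (by simp)).mono_c (by simp only [Nat.cast_zero, mul_zero, Real.exp_zero]; linarith)
    have hen : 1 ≤ Real.exp (a * n) := Real.one_le_exp (by positivity)
    have p1 : Col (fun i => F^[i]) (DJ J ∩ V) (7 * ε) n (C / 2 * Real.exp (a * n)) := by
      by_cases hle : n ≤ M
      · refine (hVc.mono inter_subset_right le_rfl hle).mono_c ?_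
        have : c ≤ C / 2 := by linarith
        nlinarith
      · have h2 := ihn (n - M) (by omega)
        have h3 := (hVc.mono (Y := DJ J ∩ V) inter_subset_right le_rfl le_rfl).concat h2 (by
          rintro y ⟨⟨h1, h2⟩, -⟩
          refine ⟨hm.iterate _ h1, fun i j hj h => h2 (i + M) j hj ?_⟩
          rwa [Function.iterate_add_apply])
        rw [Nat.add_sub_cancel' (by omega)] at h3
        refine h3.mono_c ?_
        rw [Nat.cast_sub (by omega), mul_sub, Real.exp_sub]
        calc c * (C * (Real.exp (a * n) / Real.exp (a * M))) ≤
            (Real.exp (a * M) / 2) * (C * (Real.exp (a * n) / Real.exp (a * M))) := by gcongr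
          _ = C / 2 * Real.exp (a * n) := by field_simp
    have p2 : ∀ j : J, Col (fun i => F^[i]) (DJ J ∩ U j) (7 * ε) n (Cj j * Real.exp (a * n)) := by
      intro j
      have hjt := hJ j.2
      have h1 : Col (fun i => F^[i]) (DJ J ∩ U j) (7 * ε) 1 1 := Col.one (by
        rintro x ⟨-, hx⟩ y ⟨-, hy⟩ i hi
        obtain rfl : i = 0 := by omega
        have h1 := Metric.mem_ball.1 (hUb _ (htD j hjt) hx)
        have h2 := Metric.mem_ball'.1 (hUb _ (htD j hjt) hy)
        simp only [Function.iterate_zero, id]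
        linarith [dist_triangle x j y])
      have h3 := h1.concat (hCj j (n - 1)) (by
        rintro y ⟨⟨h1, h2⟩, hy⟩
        refine ⟨hm.iterate _ h1, fun i j' hj h => Finset.mem_erase.2 ⟨?_, h2 (i + 1) j' hj ?_⟩⟩
        · rintro rfl
          rw [← Function.iterate_add_apply] at h
          exact hUw _ (htD _ hjt) (i + 1) (by omega) y hy h
        · rwa [Function.iterate_add_apply])
      rw [Nat.add_sub_cancel' (by omega)] at h3
      refine h3.mono_c ?_
      rw [one_mul]
      have := hCj0 j
      gcongr
      omega
    have p3 := p1.union (Col.fin_union p2 Subset.rfl)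
    refine (p3.mono ?_ le_rfl le_rfl).mono_c ?_
    · intro y hy
      by_cases hyV : y ∈ V
      · exact Or.inl ⟨hy, hyV⟩
      · obtain ⟨j, hj, hyj⟩ := mem_iUnion₂.1 (ht ⟨hy.1, hyV⟩)
        exact Or.inr (mem_iUnion.2 ⟨⟨j, hy.2 0 j hj hyj⟩, hy, hyj⟩)
    · rw [← Finset.sum_mul, ← add_mul]
      gcongr
      linarith
  obtain ⟨C, hC⟩ := claim t Subset.rfl
  exact ⟨C, fun n => (hC n).mono (fun y hy => ⟨hy, fun i j hj _ => hj⟩) le_rfl le_rfl⟩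

open Filter Topology Set MeasureTheory Dynamics
open scoped ENNReal

namespace TD
variable {d : ℕ} (Q : TD d)

lemma dist_φ (m i x y) : dist (Q.φ m i x) (Q.φ m i y) = Q.a (Q.κ m i) * (Q.ρ m * dist x y) := by
  rw [φ, φ, Q.dist_W, dist_add_left, dist_smul₀, Real.norm_of_nonneg (Q.ρ_pos m).le]
lemma a_le1 (k) : Q.a k ≤ 1 := (Q.a_le k).trans (pow_le_one₀ (by norm_num) (by norm_num))
lemma φ_mod (m i) : Q.φ m (i % Q.per m) = Q.φ m i := by
  unfold φ; rw [Q.κ_mod]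
lemma φ_iter {m x} (hx : ‖x‖ ≤ 1) (n : ℕ) :
    Q.F^[n] (Q.φ m 0 x) = Q.φ m n ((Q.χ m)^[Q.ξ m * (n / Q.per m)] x) := by
  have hp := Q.per_pos m
  induction n with
  | zero => simp
  | succ n ih =>
    rw [Function.iterate_succ_apply', ih, ← Q.φ_mod m n]
    have hm := Nat.mod_lt n hp
    have hx' := ((Q.χ_ext m).iter (Q.ξ m * (n / Q.per m))).maps x hx
    by_cases h : n % Q.per m + 1 < Q.per m
    · rw [Q.F_mid h hx', ← Q.φ_mod m (n + 1), Nat.succ_div_of_not_dvd, Nat.add_mod_eq_ite,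
        Nat.mod_eq_of_lt (by omega : 1 < Q.per m), if_neg (by omega)]
      rw [Nat.dvd_iff_mod_eq_zero, Nat.add_mod_eq_ite, Nat.mod_eq_of_lt (by omega : 1 < Q.per m), if_neg (by omega)]
      omega
    · have hd : Q.per m ∣ n + 1 := ⟨n / Q.per m + 1, by rw [mul_add, mul_one]; have := Nat.mod_add_div n (Q.per m); omega⟩
      rw [show n % Q.per m = Q.per m - 1 by omega, Q.F_last hx', Nat.succ_div_of_dvd hd, ← Q.φ_mod m (n + 1),
        Nat.mod_eq_zero_of_dvd hd, ← Function.iterate_add_apply, mul_add, mul_one, add_comm (Q.ξ m)]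

lemma fib (x : Eucl d) {ε : ℝ} (he : 0 < ε) {α : ℝ} (hα : 0 < α) :
    ∃ n ≥ 1, Col (fun i => Q.F^[i]) (Q.K0 ∩ Q.pi ⁻¹' {x}) ε n (Real.exp (α * n)) := by
  by_cases hx : ∀ k, x ≠ Q.q k
  · refine ⟨1, le_rfl, (Col.one ?_).mono_c (Real.one_le_exp (by positivity))⟩
    rintro y ⟨-, hy⟩ y' ⟨-, hy'⟩ i -
    rw [(Q.pi_notQ hx).1 hy, (Q.pi_notQ hx).1 hy', dist_self]; exact he.le
  push Not at hx
  obtain ⟨k, rfl⟩ := hx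
  let G : ℕ → Eucl d → Eucl d := fun n => n.rec id (fun n r w => Q.g (Q.nx^[n] k) (r w))
  have G1 : ∀ i w, ‖w‖ = 1 → ‖G i w‖ = 1 := by
    intro i w hw
    induction i with
    | zero => exact hw
    | succ i ih => exact Q.g_sph1 ih
  obtain ⟨C, hC⟩ := sph_col Q.hd (G := G) (fun i => by
    induction i with
    | zero => exact continuousOn_id
    | succ i ih => exact (Q.g_cont _).comp ih (fun w hw => mem_closedBall_zero_iff.2
        (G1 i w (by simpa using hw)).le)) (fun i => by
    induction i with
    | zero => exact injOn_id _
    | succ i ih => exact fun w hw w' hw' h => ih hw hw' (Q.g_sph_inj (G1 i w (by simpa using hw))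
        (G1 i w' (by simpa using hw')) h)) G1 he
  have hC0 : 0 ≤ C := by simpa using (hC 0).nonneg
  obtain ⟨n, hn⟩ := exists_nat_ge (4 * C / α ^ 2 + 1)
  have hn1 : (1 : ℝ) ≤ n := le_trans (by simpa using by positivity) hn
  have hGF : ∀ i w, ‖w‖ = 1 → Q.F^[i] (Q.W k w) = Q.W (Q.nx^[i] k) (G i w) := by
    intro i w hw
    induction i with
    | zero => rfl
    | succ i ih => rw [Function.iterate_succ_apply', ih, Q.F_W (G1 i w hw).le, Function.iterate_succ_apply']
  refine ⟨n, by exact_mod_cast hn1, ((hC n).pull (fun y w => ‖w‖ = 1 ∧ y = Q.W k w) ?_ ?_).mono_c ?_⟩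
  · rintro y ⟨⟨-, hy⟩, hy'⟩
    exact ⟨Q.W' k y, by simpa using hy k hy', hy k hy', (Q.W_W' k y).symm⟩
  · rintro y y' w w' ⟨hw, rfl⟩ ⟨hw', rfl⟩ h i hi
    rw [hGF i w hw, hGF i w' hw', Q.dist_W]
    have := h i hi
    have := Q.a_le1 (Q.nx^[i] k)
    have := Q.a_pos (Q.nx^[i] k)
    nlinarith [dist_nonneg (x := G i w) (y := G i w')]
  · have h1 := Real.quadratic_le_exp_of_nonneg (x := α * n) (by positivity)
    have h2 : 4 * C / α ^ 2 ≤ n := by linarith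
    rw [div_le_iff₀ (by positivity)] at h2
    have h3 : 0 ≤ α * n := by positivity
    nlinarith

lemma cov_K0 {a a' : ℝ} (h : Cov Q.ft (unitDisc d) a) (haa : a < a') : Cov Q.F Q.K0 a' :=
  bowen Q.continuous_F Q.continuous_pi Q.pi_F Q.K0_compact (fun y hy => Q.F_K0 ▸ mem_image_of_mem _ hy)
    (isCompact_closedBall _ _) (fun y hy => mem_uD.2 (Q.pi_maps hy.1))
    (fun y hy => mem_uD.2 (Q.ft_ext.maps _ (mem_uD.1 hy))) (fun x _ ε he α hα => Q.fib x he hα) haa h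

lemma cov_Ks {m} {b : ℝ} (hb : 0 ≤ b) (h : Cov (Q.χ m) (unitDisc d) b) : Cov Q.F (Q.Ks m) (b * Q.ξ m / Q.per m) := by
  have hp : (0 : ℝ) < Q.per m := by exact_mod_cast Q.per_pos m
  have h0 : Cov Q.F (Q.φ m 0 '' unitDisc d) (b * Q.ξ m / Q.per m) := by
    intro ε he
    obtain ⟨C, hC⟩ := h ε he
    have hC0 : 0 ≤ C := by simpa using (hC 0).nonneg
    refine ⟨C * Real.exp b, fun n => ((hC (Q.ξ m * (n / Q.per m) + 1)).pull (fun y x => ‖x‖ ≤ 1 ∧ y = Q.φ m 0 x)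
      ?_ ?_).mono_c ?_⟩
    · rintro _ ⟨x, hx, rfl⟩; exact ⟨x, hx, mem_uD.1 hx, rfl⟩
    · rintro _ _ x x' ⟨hx, rfl⟩ ⟨hx', rfl⟩ h i hi
      rw [Q.φ_iter hx, Q.φ_iter hx', Q.dist_φ]
      have h1 := h (Q.ξ m * (i / Q.per m)) (Nat.lt_succ_of_le (Nat.mul_le_mul_left _ (Nat.div_le_div_right hi.le)))
      have h2 : Q.ρ m ≤ 1 := (Q.ρ_le m).trans (by norm_num)
      calc _ ≤ 1 * (1 * dist ((Q.χ m)^[Q.ξ m * (i / Q.per m)] x) ((Q.χ m)^[Q.ξ m * (i / Q.per m)] x')) := by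
            have := Q.ρ_pos m
            gcongr
            exact Q.a_le1 _
        _ ≤ _ := by linarith
    · rw [mul_assoc, ← Real.exp_add]
      have : ((n / Q.per m : ℕ) : ℝ) ≤ n / Q.per m := Nat.cast_div_le
      gcongr
      push_cast
      calc b * (Q.ξ m * (n / Q.per m : ℕ) + 1) ≤ b * (Q.ξ m * (n / Q.per m) + 1) := by gcongr
        _ = _ := by ring
  refine (Cov.biUnion (Z := fun i => Q.F^[i] '' (Q.φ m 0 '' unitDisc d)) (finite_Iio (Q.per m))
    fun i => h0.image i).mono ?_
  refine iUnion₂_mono fun i hi => ?_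
  rintro _ ⟨x, hx, rfl⟩
  refine ⟨_, ⟨x, hx, rfl⟩, ?_⟩
  rw [Q.φ_iter (mem_uD.1 hx), Nat.div_eq_of_lt hi]; rfl

lemma cov_χ {m} {a : ℝ} (ha : 0 ≤ a) (h : Cov Q.F (Q.Ks m) a) : Cov (Q.χ m) (unitDisc d) (a * Q.per m / Q.ξ m) := by
  intro ε he
  have hξ : (0 : ℝ) < Q.ξ m := by exact_mod_cast Q.ξ_pos m
  have huc : UniformContinuousOn (fun x (r : Fin (Q.ξ m)) => (Q.χ m)^[r] x) (unitDisc d) :=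
    (isCompact_closedBall _ _).uniformContinuousOn_of_continuous
      (_root_.continuous_pi fun r : Fin (Q.ξ m) => ((Q.χ_ext m).iter r).cont).continuousOn
  obtain ⟨η, hη, hu⟩ := Metric.uniformContinuousOn_iff.1 huc ε he
  have hap := Q.a_pos (Q.κ m 0)
  have hρp := Q.ρ_pos m
  obtain ⟨C, hC⟩ := h (Q.a (Q.κ m 0) * (Q.ρ m * (η / 2))) (by positivity)
  have hC0 : 0 ≤ C := by simpa using (hC 0).nonneg
  refine ⟨C * Real.exp a, fun n => ((hC (Q.per m * (n / Q.ξ m) + 1)).pull (fun x y => ‖x‖ ≤ 1 ∧ y = Q.φ m 0 x)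
      ?_ ?_).mono_c ?_⟩
  · exact fun x hx => ⟨_, Q.mem_Ks.2 ⟨0, Q.per_pos m, x, mem_uD.1 hx, rfl⟩, mem_uD.1 hx, rfl⟩
  · rintro x x' _ _ ⟨hx, rfl⟩ ⟨hx', rfl⟩ h i hi
    have h1 := h (Q.per m * (i / Q.ξ m)) (Nat.lt_succ_of_le (Nat.mul_le_mul_left _ (Nat.div_le_div_right hi.le)))
    have e : Q.φ m (Q.per m * (i / Q.ξ m)) = Q.φ m 0 := by rw [← Q.φ_mod, Nat.mul_mod_right]
    simp only [Q.φ_iter hx, Q.φ_iter hx', Nat.mul_div_cancel_left _ (Q.per_pos m), e, Q.dist_φ] at h1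
    have h2 := le_of_mul_le_mul_left (le_of_mul_le_mul_left h1 hap) hρp
    have h3 := hu _ (mem_uD.2 (((Q.χ_ext m).iter (Q.ξ m * (i / Q.ξ m))).maps x hx)) _
      (mem_uD.2 (((Q.χ_ext m).iter (Q.ξ m * (i / Q.ξ m))).maps x' hx')) (by linarith)
    have h4 := (dist_pi_lt_iff he).1 h3 ⟨i % Q.ξ m, Nat.mod_lt _ (Q.ξ_pos m)⟩
    simp only [← Function.iterate_add_apply, Nat.mod_add_div] at h4
    exact h4.le
  · rw [mul_assoc, ← Real.exp_add]
    have : ((n / Q.ξ m : ℕ) : ℝ) ≤ n / Q.ξ m := Nat.cast_div_le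
    gcongr
    push_cast
    calc a * (Q.per m * (n / Q.ξ m : ℕ) + 1) ≤ a * (Q.per m * (n / Q.ξ m) + 1) := by gcongr
      _ = _ := by ring

lemma cov_ft {a : ℝ} (h : Cov Q.F (unitDisc d) a) : Cov Q.ft (unitDisc d) a := by
  intro ε he
  have huc : UniformContinuousOn Q.pi (unitDisc d) :=
    (isCompact_closedBall _ _).uniformContinuousOn_of_continuous Q.continuous_pi.continuousOn
  obtain ⟨η, hη, hu⟩ := Metric.uniformContinuousOn_iff.1 huc ε he
  obtain ⟨C, hC⟩ := h (η / 2) (by positivity)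
  have hm : MapsTo Q.F (unitDisc d) (unitDisc d) := fun y hy => mem_uD.2 (Q.F_maps (mem_uD.1 hy))
  refine ⟨C, fun n => (hC n).pull (fun x y => y ∈ unitDisc d ∧ Q.pi y = x) ?_ ?_⟩
  · intro x hx
    obtain ⟨y, hy, e⟩ := Q.pi_surj (mem_uD.1 hx)
    exact ⟨y, mem_uD.2 hy, mem_uD.2 hy, e⟩
  · rintro _ _ y y' ⟨hy, rfl⟩ ⟨hy', rfl⟩ h i hi
    have hs : ∀ y, Q.pi (Q.F^[i] y) = Q.ft^[i] (Q.pi y) := (Function.Semiconj.iterate_right Q.pi_F i)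
    simp only [← hs]
    exact (hu _ (hm.iterate i hy) _ (hm.iterate i hy') ((h i hi).trans_lt (by linarith))).le

lemma big_fin {ε : ℝ} (he : 0 < ε) : {m | ∃ i, ε ≤ Q.a (Q.κ m i)}.Finite := by
  have h1 : {k | ε ≤ Q.a k}.Finite := by
    have := Q.summable_a.tendsto_cofinite_zero.eventually (gt_mem_nhds he)
    simpa using this
  refine (h1.biUnion fun k _ => Q.fin k).subset ?_
  rintro m ⟨i, hi⟩
  exact mem_biUnion hi ⟨i, rfl⟩

lemma exists_sph (Q : TD d) : ∃ v : Eucl d, ‖v‖ = 1 := ⟨_, KD.norm_v0 Q.hd⟩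

lemma W_K0 {k v} (hv : ‖v‖ = 1) : Q.W k v ∈ Q.K0 := by
  refine ⟨(Q.W_lt hv.le).le, fun j h => ?_⟩
  have h2 := Q.pi_W (k := k).2 hv.le
  obtain rfl := Q.inj (h.symm.trans h2)
  rw [Q.W'_W, hv]

lemma cov_up {b b' : ℝ} (hb : 0 ≤ b) (hbb : b < b') (h1 : Cov Q.ft (unitDisc d) b)
    (h2 : ∀ m, Cov (Q.χ m) (unitDisc d) (b * Q.per m / Q.ξ m)) : Cov Q.F (unitDisc d) b' := by
  intro ε' he'
  obtain ⟨ε, rfl⟩ : ∃ ε, ε' = 7 * ε := ⟨ε' / 7, by ring⟩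
  have he : 0 < ε := by linarith
  obtain ⟨b1, hb1, hb1'⟩ := exists_between hbb
  have hKs : ∀ m, Cov Q.F (Q.Ks m) b1 := fun m => by
    have hp : (0 : ℝ) < Q.per m := by exact_mod_cast Q.per_pos m
    have hξ : (0 : ℝ) < Q.ξ m := by exact_mod_cast Q.ξ_pos m
    refine (Q.cov_Ks (by positivity) (h2 m)).mono_a (le_of_eq_of_le ?_ hb1.le)
    field_simp
  obtain ⟨C, hC⟩ := ((Q.cov_K0 h1 hb1).union (Cov.biUnion (Q.big_fin he) hKs)) ε he
  obtain ⟨M, hM⟩ := exists_nat_ge (2 * C / (b' - b1) + 1)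
  have hC0 : 0 ≤ C := by simpa using (hC 0).nonneg
  have hbp : 0 < b' - b1 := by linarith
  have hM1 : (1 : ℝ) ≤ M := le_trans (by simpa using by positivity) hM
  refine wander Q.continuous_F (isCompact_closedBall _ _)
    (fun y hy => mem_uD.2 (Q.F_maps (mem_uD.1 hy))) he (by linarith) (hC M) ?_ ?_ (by exact_mod_cast hM1)
  · have h3 : 2 * C / (b' - b1) ≤ M := by linarith
    rw [div_le_iff₀ hbp] at h3
    have h4 := Real.add_one_le_exp ((b' - b1) * M)
    have h5 : Real.exp (b' * M) = Real.exp (b1 * M) * Real.exp ((b' - b1) * M) := by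
      rw [← Real.exp_add]; ring_nf
    have := Real.exp_pos (b1 * M)
    rw [h5, mul_comm C]
    nlinarith
  · intro y hy
    by_cases h0 : y ∈ Q.K0
    · exact Or.inl ⟨y, Or.inl h0, fun i _ => by simpa using by linarith⟩
    by_cases hm : ∀ m, y ∉ Q.Ks m
    · exact Or.inr (Q.NW (mem_uD.1 hy) h0 hm)
    push Not at hm
    obtain ⟨m, hm⟩ := hm
    by_cases hbig : m ∈ {m | ∃ i, ε ≤ Q.a (Q.κ m i)}
    · exact Or.inl ⟨y, Or.inr (mem_biUnion hbig hm), fun i _ => by simpa using by linarith⟩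
    obtain ⟨v, hv⟩ := Q.exists_sph
    obtain ⟨i, hi, x, hx, rfl⟩ := Q.mem_Ks.1 hm
    refine Or.inl ⟨Q.W (Q.κ m i) v, Or.inl (Q.W_K0 hv), fun j _ => ?_⟩
    obtain ⟨w, hw, e⟩ := Q.it_W (k := Q.κ m i) (Q.B1 (m := m) hx).le j
    obtain ⟨w', hw', e'⟩ := Q.it_W (k := Q.κ m i) hv.le j
    rw [φ, e, e', Q.dist_W, Q.κ_add]
    have : Q.a (Q.κ m (i + j)) < ε := not_le.1 fun h => hbig ⟨_, h⟩
    have h3 : dist w w' ≤ 2 := by rw [dist_eq_norm]; linarith [norm_sub_le w w']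
    nlinarith [Q.a_pos (Q.κ m (i + j))]
end TD

open Filter Topology Set MeasureTheory Dynamics
open scoped ENNReal

lemma uD_ne {d : ℕ} : (unitDisc d).Nonempty := ⟨0, mem_uD.2 (by simp)⟩

lemma ext1_eq {d : ℕ} {T : Eucl d → Eucl d} : EqOn (ext1 T) T (unitDisc d) := fun _ h => ext1_in (mem_uD.1 h)
lemma MemCd.ent_real {d : ℕ} {T : Eucl d → Eucl d} (h : MemCd d T) : ∃ r : ℝ, 0 ≤ r ∧ coverEntropy T (unitDisc d) = r := by
  have h0 := coverEntropy_nonneg T (uD_ne (d := d))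
  have h1 := h.entropy_lt_top
  lift coverEntropy T (unitDisc d) to ℝ using ⟨h1.ne, (EReal.bot_lt_zero.trans_le h0).ne'⟩ with r
  exact ⟨r, by exact_mod_cast h0, rfl⟩
lemma MemCd.cov_ext {d : ℕ} {T : Eucl d → Eucl d} (h : MemCd d T) {a : ℝ} :
    Cov (ext1 T) (unitDisc d) a ↔ Cov T (unitDisc d) a :=
  ⟨fun h' => h'.congr (fun x hx => by rw [ext1_eq hx]; exact h.mapsTo hx) ext1_eq,
   fun h' => h'.congr h.mapsTo ext1_eq.symm⟩

namespace TD
lemma Ks_sub {d : ℕ} (Q : TD d) (m) : Q.Ks m ⊆ unitDisc d := by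
  intro y hy
  obtain ⟨i, hi, x, hx, rfl⟩ := Q.mem_Ks.1 hy
  exact Q.Ls_sub _ (interior_subset (Q.φ_int hx))

lemma entropy {d : ℕ} (Q : TD d) {f : Eucl d → Eucl d} {χ : ℕ → Eucl d → Eucl d} (hf : MemCd d f)
    (hχ : ∀ m, MemCd d (χ m)) (e1 : Q.ft = ext1 f) (e2 : Q.χ = fun m => ext1 (χ m)) :
    coverEntropy Q.F (unitDisc d) = max (coverEntropy f (unitDisc d))
          (⨆ m, (((Q.ξ m : ℝ) / (Q.per m : ℝ) : ℝ) : EReal) * coverEntropy (χ m) (unitDisc d)) := by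
  have hp : ∀ m, (0 : ℝ) < Q.per m := fun m => by exact_mod_cast Q.per_pos m
  have hξ : ∀ m, (0 : ℝ) < Q.ξ m := fun m => by exact_mod_cast Q.ξ_pos m
  choose r hr0 hr using fun m => (hχ m).ent_real
  apply le_antisymm
  · refine le_of_forall_gt_imp_ge_of_dense fun c hc => ?_
    obtain ⟨b', hb1, hb2⟩ := EReal.lt_iff_exists_real_btwn.1 hc
    obtain ⟨b, hb3, hb4⟩ := EReal.lt_iff_exists_real_btwn.1 hb1
    have hb0 : 0 ≤ b := by
      have := (coverEntropy_nonneg f (uD_ne (d := d))).trans ((le_max_left _ _).trans hb3.le)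
      exact_mod_cast this
    refine le_trans (Cov.le (Q.cov_up hb0 (by exact_mod_cast hb4) ?_ fun m => ?_)) hb2.le
    · rw [e1, hf.cov_ext]; exact Cov.of_lt ((le_max_left _ _).trans_lt hb3)
    · rw [e2, (hχ m).cov_ext]
      refine Cov.of_lt ?_
      have h1 := ((le_iSup (fun m => (((Q.ξ m : ℝ) / (Q.per m : ℝ) : ℝ) : EReal) * coverEntropy (χ m) (unitDisc d)) m).trans
        (le_max_right _ _)).trans_lt hb3
      rw [hr, ← EReal.coe_mul, EReal.coe_lt_coe_iff] at h1
      rw [hr, EReal.coe_lt_coe_iff, lt_div_iff₀ (hξ m)]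
      rw [div_mul_eq_mul_div, div_lt_iff₀ (hp m)] at h1
      linarith
  · have key : ∀ c : ℝ, coverEntropy Q.F (unitDisc d) < c → 0 ≤ c := fun c hc => by
      have := (coverEntropy_nonneg Q.F (uD_ne (d := d))).trans hc.le
      exact_mod_cast this
    refine max_le ?_ (iSup_le fun m => ?_) <;> refine le_of_forall_gt_imp_ge_of_dense fun c hc => ?_ <;>
    obtain ⟨b, hb1, hb2⟩ := EReal.lt_iff_exists_real_btwn.1 hc <;> refine le_trans ?_ hb2.le
    · exact (hf.cov_ext.1 (e1 ▸ Q.cov_ft (Cov.of_lt hb1))).le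
    · have h1 := Q.cov_χ (key b hb1) ((Cov.of_lt hb1).mono (Q.Ks_sub m))
      rw [e2, (hχ m).cov_ext] at h1
      have h2 := h1.le
      rw [hr, EReal.coe_le_coe_iff, le_div_iff₀ (hξ m)] at h2
      rw [hr, ← EReal.coe_mul, EReal.coe_le_coe_iff, div_mul_eq_mul_div, div_le_iff₀ (hp m)]
      linarith
end TD

open Filter Topology Set MeasureTheory Dynamics
open scoped ENNReal

lemma MD_compact {d : ℕ} {D : Set (Eucl d)} (hD : IsCompact D) :
    IsCompact {μ : ProbabilityMeasure (Eucl d) | (μ : Measure (Eucl d)) Dᶜ = 0} := by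
  have := isCompact_setOfPred_probabilityMeasure_mass_eq_compl_isCompact_le (E := Eucl d) (u := fun _ => 0)
    (K := fun _ => D) tendsto_const_nhds (fun _ => hD) (Or.inl inferInstance)
  convert this using 1
  ext μ
  simp

lemma open_lt {d : ℕ} {V : Set (Eucl d)} (hV : IsOpen V) (c : ℝ≥0∞) :
    IsOpen {μ : ProbabilityMeasure (Eucl d) | c < (μ : Measure (Eucl d)) V} := by
  refine isOpen_iff_mem_nhds.2 fun μ hμ => ?_
  exact eventually_lt_of_lt_liminf (hμ.trans_le (ProbabilityMeasure.le_liminf_measure_open_of_tendsto tendsto_id hV))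

lemma closed_le {d : ℕ} {C : Set (Eucl d)} (hC : IsClosed C) (c : ℝ≥0∞) :
    IsClosed {μ : ProbabilityMeasure (Eucl d) | c ≤ (μ : Measure (Eucl d)) C} := by
  rcases le_or_gt c 1 with hc | hc
  · have : {μ : ProbabilityMeasure (Eucl d) | c ≤ (μ : Measure (Eucl d)) C} =
      {μ : ProbabilityMeasure (Eucl d) | 1 - c < (μ : Measure (Eucl d)) Cᶜ}ᶜ := by
      ext μ
      have h := measure_add_measure_compl (μ := (μ : Measure (Eucl d))) hC.measurableSet
      rw [measure_univ] at h
      simp only [mem_ofPred_eq, mem_compl_iff, not_lt]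
      rw [← h, ENNReal.le_sub_iff_add_le_left (ne_top_of_le_ne_top ENNReal.one_ne_top hc) (h ▸ hc),
        ENNReal.add_le_add_iff_right (measure_ne_top _ _)]
    rw [this]
    exact (open_lt hC.isOpen_compl _).isClosed_compl
  · convert isClosed_empty
    ext μ
    simpa using prob_le_one.trans_lt hc

lemma inv_closed {d : ℕ} {F : Eucl d → Eucl d} (hF : Continuous F) :
    IsClosed {μ : ProbabilityMeasure (Eucl d) | (μ : Measure (Eucl d)).map F = μ} := by
  convert isClosed_eq (ProbabilityMeasure.continuous_map hF) continuous_id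
  exact ⟨fun h => Subtype.ext h, fun h => congrArg Subtype.val h⟩

lemma orbM_apply {X : Type*} [MeasurableSpace X] (T : X → X) (x : X) {n : ℕ} (hn : 0 < n) {s : Set X} (hs : MeasurableSet s) :
    orbitMeasure T x n s = (n : ℝ≥0∞)⁻¹ * ∑ i ∈ Finset.range n, s.indicator 1 (T^[i] x) := by
  rw [orbitMeasure, max_eq_left hn, Measure.smul_apply, Measure.finsetSum_apply, smul_eq_mul]
  simp only [Measure.dirac_apply' _ hs]

lemma orb_inv {X : Type*} [MeasurableSpace X] {T : X → X} (hT : Measurable T) {x : X} {n : ℕ} (hn : 0 < n)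
    (hx : T^[n] x = x) : (orbitMeasure T x n).map T = orbitMeasure T x n := by
  ext s hs
  rw [Measure.map_apply hT hs, orbM_apply T x hn hs, orbM_apply T x hn (hT hs)]
  congr 1
  have e := Finset.sum_range_succ (fun i => s.indicator (1 : X → ℝ≥0∞) (T^[i] x)) n
  rw [Finset.sum_range_succ', hx, Function.iterate_zero_apply] at e
  have h1 : s.indicator (1 : X → ℝ≥0∞) x ≠ ⊤ := by
    by_cases h : x ∈ s <;> simp [h]
  rw [ENNReal.add_left_inj h1] at e
  rw [← e]
  refine Finset.sum_congr rfl fun i _ => ?_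
  rw [Function.iterate_succ_apply']
  by_cases hi : T (T^[i] x) ∈ s <;> simp [hi]

lemma orb_unique {X : Type*} [MeasurableSpace X] {T : X → X} (hT : Measurable T) {x : X} {n : ℕ}
    (h : IsPeriodicOrbitPt T x n) {μ : Measure X} [IsProbabilityMeasure μ] (hμ : μ.map T = μ)
    (h0 : μ (orbitSet T x n)ᶜ = 0) : μ = orbitMeasure T x n := by
  have hn := h.1
  have hi : ∀ i, μ.map T^[i] = μ := fun i => by
    induction i with
    | zero => exact Measure.map_id
    | succ i ih => rw [Function.iterate_succ, ← Measure.map_map (hT.iterate i) hT, hμ, ih]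
  ext s hs
  have h1 : ∫⁻ y, orbitMeasure T y n s ∂μ = μ s := by
    simp only [orbM_apply T _ hn hs]
    have hm : ∀ i, Measurable fun y => s.indicator (1 : X → ℝ≥0∞) (T^[i] y) := fun i =>
      (measurable_one.indicator hs).comp (hT.iterate i)
    rw [lintegral_const_mul _ (Finset.measurable_sum _ fun i _ => hm i), lintegral_finset_sum _ fun i _ => hm i]
    have : ∀ i ∈ Finset.range n, ∫⁻ y, s.indicator (1 : X → ℝ≥0∞) (T^[i] y) ∂μ = μ s := fun i _ => by
      rw [← lintegral_map (f := s.indicator 1) (measurable_one.indicator hs) (hT.iterate i), hi i, lintegral_indicator_one hs]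
    rw [Finset.sum_congr rfl this, Finset.sum_const, Finset.card_range, nsmul_eq_mul, ← mul_assoc,
      ENNReal.inv_mul_cancel (by exact_mod_cast hn.ne') (by simp), one_mul]
  rw [← h1, lintegral_congr_ae (g := fun _ => orbitMeasure T x n s)]
  · simp
  · refine measure_mono_null ?_ h0
    intro y hy hy'
    obtain ⟨i, -, rfl⟩ := hy'
    exact hy (congrArg (fun m : Measure X => m s) (orbM_shift h i))
lemma orb_inv_supp {X : Type*} [MeasurableSpace X] [MeasurableSingletonClass X] {T : X → X} {x : X} {n : ℕ}
    {S : Set X} (hS : ∀ i, T^[i] x ∈ S) : orbitMeasure T x n Sᶜ = 0 := by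
  rw [orbitMeasure, Measure.smul_apply, Measure.finsetSum_apply, Finset.sum_eq_zero, smul_zero]
  intro i _
  rw [Measure.dirac_apply, indicator_of_notMem]
  exact fun hc => hc (hS i)
lemma orb_mul {X : Type*} [MeasurableSpace X] [MeasurableSingletonClass X] {T : X → X} (hT : Measurable T) {x : X} {n N : ℕ}
    (h : IsPeriodicOrbitPt T x n) (hN : 0 < N) (hx : T^[N] x = x) : orbitMeasure T x N = orbitMeasure T x n := by
  haveI := orbitMeasure_isProbability T x N
  exact orb_unique hT h (orb_inv hT hN hx) (orb_inv_supp fun i => mem_orbit h i)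

open Filter Topology Set MeasureTheory Dynamics
open scoped ENNReal

namespace TD
variable {d : ℕ} (Q : TD d)

noncomputable def θ (m : ℕ) : ProbabilityMeasure (Eucl d) := orbitProb Q.ft (Q.q (Q.κ m 0)) (Q.per m)
def Cf : Set (ProbabilityMeasure (Eucl d)) := ⋂ N : ℕ, closure (Q.θ '' Ici N)
def MK (m : ℕ) : Set (ProbabilityMeasure (Eucl d)) := {μ | (μ : Measure (Eucl d)).map Q.F = (μ : Measure (Eucl d)) ∧
  (μ : Measure (Eucl d)) (Q.Ks m)ᶜ = 0}
def CF : Set (ProbabilityMeasure (Eucl d)) := ⋂ N : ℕ, closure (⋃ m ∈ Ici N, Q.MK m)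
def Cp : Set (ProbabilityMeasure (Eucl d)) := {μ | ((μ : Measure (Eucl d)).map Q.F = (μ : Measure (Eucl d)) ∧
  (μ : Measure (Eucl d)) (unitDisc d)ᶜ = 0) ∧ ∃ ν' ∈ Q.Cf, (μ : Measure (Eucl d)).map Q.pi =
            ((ν' : ProbabilityMeasure (Eucl d)) : Measure (Eucl d))}
def OS : Set (Eucl d) := ⋃ m, orbitSet Q.ft (Q.q (Q.κ m 0)) (Q.per m)
noncomputable def push (μ : ProbabilityMeasure (Eucl d)) : ProbabilityMeasure (Eucl d) :=
  μ.map Q.continuous_pi.measurable.aemeasurable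

lemma continuous_push : Continuous Q.push := ProbabilityMeasure.continuous_map Q.continuous_pi
lemma push_coe (μ) : (Q.push μ : Measure (Eucl d)) = (μ : Measure (Eucl d)).map Q.pi := rfl
lemma ft_it (n k) : Q.ft^[n] (Q.q k) = Q.q (Q.nx^[n] k) := by
  induction n with
  | zero => rfl
  | succ n ih => rw [Function.iterate_succ_apply', ih, Q.ft_q, Function.iterate_succ_apply']
lemma ft_κ (m n) : Q.ft^[n] (Q.q (Q.κ m 0)) = Q.q (Q.κ m n) := by rw [ft_it, Q.κ_add, zero_add]
lemma per_pt (m) : IsPeriodicOrbitPt Q.ft (Q.q (Q.κ m 0)) (Q.per m) := by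
  refine ⟨Q.per_pos m, ?_, fun j hj hj' h => ?_⟩
  · rw [ft_κ, ← zero_add (Q.per m), Q.κ_per]
  · rw [ft_κ] at h
    have := Q.κ_inj m j 0 hj' (Q.per_pos m) (Q.inj h)
    omega
lemma ft_meas : Measurable Q.ft := Q.ft_ext.cont.measurable
lemma F_meas : Measurable Q.F := Q.continuous_F.measurable
lemma pi_meas : Measurable Q.pi := Q.continuous_pi.measurable
lemma θ_inv (m) : (Q.θ m : Measure (Eucl d)).map Q.ft = Q.θ m := orb_inv Q.ft_meas (Q.per_pos m) (Q.per_pt m).2.1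

lemma Q_null {ν : ProbabilityMeasure (Eucl d)} (h : ν ∈ Q.Cf) (h0 : (ν : Measure (Eucl d)) Q.OS = 0) :
    (ν : Measure (Eucl d)) (range Q.q) = 0 := by
  have hi : (ν : Measure (Eucl d)).map Q.ft = ν := by
    refine closure_minimal ?_ (inv_closed Q.ft_ext.cont) (mem_iInter.1 h 0)
    rintro _ ⟨m, -, rfl⟩
    exact Q.θ_inv m
  have hp : MeasurePreserving Q.ft (ν : Measure (Eucl d)) ν := ⟨Q.ft_meas, hi⟩
  have hk : ∀ n, (ν : Measure (Eucl d)) (Q.ft^[n] ⁻¹' Q.OS) = 0 := fun n => by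
    rw [(hp.iterate n).measure_preimage, h0]
    exact (MeasurableSet.iUnion fun m => ((finite_Iio _).image _).measurableSet).nullMeasurableSet
  refine measure_mono_null ?_ (measure_iUnion_null hk)
  rintro _ ⟨k, rfl⟩
  obtain ⟨n, m, i, e⟩ := Q.evper k
  refine mem_iUnion.2 ⟨n, mem_iUnion.2 ⟨m, ?_⟩⟩
  have h := mem_orbit (Q.per_pt m) i
  rw [Q.ft_κ] at h
  rw [ft_it, e]
  exact h

lemma MK_push {m μ} (h : μ ∈ Q.MK m) : Q.push μ = Q.θ m := by
  apply Subtype.ext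
  haveI : IsProbabilityMeasure ((μ : Measure (Eucl d)).map Q.pi) := Measure.isProbabilityMeasure_map Q.pi_meas.aemeasurable
  show (μ : Measure (Eucl d)).map Q.pi = orbitMeasure _ _ _
  refine orb_unique Q.ft_meas (Q.per_pt m) ?_ ?_
  · show ((μ : Measure (Eucl d)).map Q.pi).map Q.ft = (μ : Measure (Eucl d)).map Q.pi
    conv_rhs => rw [← h.1, Measure.map_map Q.pi_meas Q.F_meas]
    rw [Measure.map_map Q.ft_meas Q.pi_meas]
    congr 1
    ext1 y
    exact (Q.pi_F y).symm
  · show ((μ : Measure (Eucl d)).map Q.pi) _ = 0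
    rw [orbitSet, Measure.map_apply Q.pi_meas ((finite_Iio _).image _).measurableSet.compl]
    refine measure_mono_null (t := (Q.Ks m)ᶜ) (fun y hy hy' => hy ?_) h.2
    obtain ⟨i, hi, x, hx, rfl⟩ := Q.mem_Ks.1 hy'
    have h := mem_orbit (Q.per_pt m) i
    rw [Q.ft_κ] at h
    rw [Q.pi_φ hx]
    exact h

lemma F_Ks_it {m y} (h : y ∈ Q.Ks m) (n) : Q.F^[n] y ∈ Q.Ks m :=
  MapsTo.iterate (fun _ hy => Q.F_Ks m ▸ mem_image_of_mem _ hy : MapsTo Q.F (Q.Ks m) (Q.Ks m)) n h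

lemma orb_MK {m y n} (hn : 0 < n) (h : y ∈ Q.Ks m) (hy : Q.F^[n] y = y) : orbitProb Q.F y n ∈ Q.MK m :=
  ⟨orb_inv Q.F_meas hn hy, orb_inv_supp fun i => Q.F_Ks_it h i⟩

lemma MK_ne (m) : (Q.MK m).Nonempty := by
  obtain ⟨v, hv⟩ := Q.exists_sph
  refine ⟨_, Q.orb_MK (Q.per_pos m) (Q.mem_Ks.2 ⟨0, Q.per_pos m, v, hv.le, rfl⟩) ?_⟩
  rw [Q.φ_iter hv.le, ((Q.χ_ext m).iter _).far v hv.ge, ← Q.φ_mod, Nat.mod_self]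

lemma good_eq : (Q.K0 \ ⋃ k, frontier (Q.Ls k)) = unitDisc d \ ⋃ k, Q.Ls k := by
  rw [Q.K0_eq, diff_diff, ← iUnion_union_distrib]
  congr 1
  refine iUnion_congr fun k => ?_
  rw [← closure_eq_interior_union_frontier]
  exact IsClosed.closure_eq Metric.isClosed_closedBall

lemma Cp_null (hn : ∀ ν ∈ Q.Cf, (ν : Measure (Eucl d)) Q.OS = 0) {μ : ProbabilityMeasure (Eucl d)} (h : μ ∈ Q.Cp) :
    (μ : Measure (Eucl d)) (Q.pi ⁻¹' (range Q.q)) = 0 := by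
  obtain ⟨-, ν, hν, e⟩ := h
  rw [← Measure.map_apply Q.pi_meas (countable_range _).measurableSet, e]
  exact Q.Q_null hν (hn ν hν)

lemma Cp_good (hn : ∀ ν ∈ Q.Cf, (ν : Measure (Eucl d)) Q.OS = 0) {μ : ProbabilityMeasure (Eucl d)} (h : μ ∈ Q.Cp) :
    (μ : Measure (Eucl d)) ((Q.K0 \ ⋃ k, frontier (Q.Ls k))ᶜ) = 0 := by
  refine measure_mono_null ?_ (measure_union_null h.1.2 (Q.Cp_null hn h))
  rw [Q.good_eq]
  intro y hy
  by_cases hD : y ∈ unitDisc d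
  · right
    by_contra hq
    exact hy ⟨hD, fun h => by
      obtain ⟨k, hk⟩ := mem_iUnion.1 h
      exact hq ⟨k, (Q.mem_Ls.1 hk).symm⟩⟩
  · exact Or.inl hD

lemma Cp_inj (hn : ∀ ν ∈ Q.Cf, (ν : Measure (Eucl d)) Q.OS = 0) {μ μ' : ProbabilityMeasure (Eucl d)} (h : μ ∈ Q.Cp)
    (h' : μ' ∈ Q.Cp) (e : Q.push μ = Q.push μ') : μ = μ' := by
  have hm : MeasurableSet (Q.pi ⁻¹' (range Q.q))ᶜ := (Q.pi_meas (countable_range _).measurableSet).compl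
  have inj : InjOn Q.pi (Q.pi ⁻¹' (range Q.q))ᶜ := fun y hy y' hy' hyy => by
    have hk : ∀ k, Q.pi y ≠ Q.q k := fun k hk => hy ⟨k, hk.symm⟩
    rw [(Q.pi_notQ hk).1 rfl, (Q.pi_notQ hk).1 hyy.symm]
  have key : ∀ μ : ProbabilityMeasure (Eucl d), μ ∈ Q.Cp → ∀ s, MeasurableSet s → (μ : Measure (Eucl d)) s =
      (Q.push μ : Measure (Eucl d)) (Q.pi '' (s ∩ (Q.pi ⁻¹' (range Q.q))ᶜ)) := by
    intro μ h s hs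
    rw [push_coe, Measure.map_apply Q.pi_meas ((hs.inter hm).image_of_continuousOn_injOn
      Q.continuous_pi.continuousOn (inj.mono inter_subset_right))]
    have : Q.pi ⁻¹' (Q.pi '' (s ∩ (Q.pi ⁻¹' (range Q.q))ᶜ)) = s ∩ (Q.pi ⁻¹' (range Q.q))ᶜ := by
      refine Subset.antisymm ?_ (subset_preimage_image _ _)
      rintro y ⟨z, hz, hzy⟩
      have hy : y ∈ (Q.pi ⁻¹' (range Q.q))ᶜ := fun hy => hz.2 (by rw [mem_preimage, hzy]; exact hy)
      rwa [← inj hz.2 hy hzy]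
    rw [this, ← diff_eq, measure_diff_null (Q.Cp_null hn h)]
  apply Subtype.ext
  ext s hs
  exact (key μ h s hs).trans ((congrArg (fun ν : ProbabilityMeasure (Eucl d) =>
    (ν : Measure (Eucl d)) (Q.pi '' (s ∩ (Q.pi ⁻¹' (range Q.q))ᶜ))) e).trans (key μ' h' s hs).symm)

lemma MK_sub (m) : Q.MK m ⊆ {μ | (μ : Measure (Eucl d)).map Q.F = μ} ∩ {μ | (μ : Measure (Eucl d)) (unitDisc d)ᶜ = 0} :=
  fun _ h => ⟨h.1, measure_mono_null (compl_subset_compl.2 (Q.Ks_sub m)) h.2⟩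

lemma clo_compact (N : ℕ) : IsCompact (closure (⋃ m ∈ Ici N, Q.MK m)) :=
  (MD_compact (isCompact_closedBall _ _)).closure_of_subset (iUnion₂_subset fun m _ => (Q.MK_sub m).trans inter_subset_right)

lemma CF_sub : Q.CF ⊆ Q.Cp := by
  intro μ hμ
  refine ⟨closure_minimal (iUnion₂_subset fun m _ => Q.MK_sub m) ((inv_closed Q.continuous_F).inter
    (MD_compact (isCompact_closedBall _ _)).isClosed) (mem_iInter.1 hμ 0), Q.push μ, mem_iInter.2 fun N => ?_, rfl⟩
  have h1 := image_closure_subset_closure_image Q.continuous_push (mem_image_of_mem Q.push (mem_iInter.1 hμ N))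
  refine closure_mono ?_ h1
  rintro _ ⟨ν, hν, rfl⟩
  obtain ⟨m, hm, hν⟩ := mem_iUnion₂.1 hν
  exact ⟨m, hm, (Q.MK_push hν).symm⟩

lemma lift {ν} (hν : ν ∈ Q.Cf) : ∃ μ ∈ Q.CF, Q.push μ = ν := by
  have hcl : IsClosed (Q.push ⁻¹' {ν}) := isClosed_singleton.preimage Q.continuous_push
  obtain ⟨μ, hμ⟩ := IsCompact.nonempty_iInter_of_directed_nonempty_isCompact_isClosed
    (fun N => closure (⋃ m ∈ Ici N, Q.MK m) ∩ Q.push ⁻¹' {ν})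
    (Antitone.directed_ge fun N N' h => inter_subset_inter_left _ (closure_mono
      (biUnion_subset_biUnion_left (Ici_subset_Ici.2 h))))
    (fun N => by
      have h1 : IsClosed (Q.push '' closure (⋃ m ∈ Ici N, Q.MK m)) := ((Q.clo_compact N).image Q.continuous_push).isClosed
      have h2 : Q.θ '' Ici N ⊆ Q.push '' closure (⋃ m ∈ Ici N, Q.MK m) := by
        rintro _ ⟨m, hm, rfl⟩
        obtain ⟨μ, hμ⟩ := Q.MK_ne m
        exact ⟨μ, subset_closure (mem_biUnion hm hμ), Q.MK_push hμ⟩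
      obtain ⟨μ, hμ, e⟩ := closure_minimal h2 h1 (mem_iInter.1 hν N)
      exact ⟨μ, hμ, e⟩)
    (fun N => (Q.clo_compact N).inter_right hcl) (fun N => isClosed_closure.inter hcl)
  exact ⟨μ, mem_iInter.2 fun N => (mem_iInter.1 hμ N).1, (mem_iInter.1 hμ 0).2⟩

lemma CF_eq (hn : ∀ ν ∈ Q.Cf, (ν : Measure (Eucl d)) Q.OS = 0) : Q.CF = Q.Cp := by
  refine Subset.antisymm Q.CF_sub fun μ hμ => ?_
  obtain ⟨-, ν, hν, e⟩ := id hμ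
  obtain ⟨μ', h', e'⟩ := Q.lift hν
  rwa [Q.Cp_inj hn hμ (Q.CF_sub h') (by rw [e']; exact Subtype.ext e)]

lemma homeo (hn : ∀ ν ∈ Q.Cf, (ν : Measure (Eucl d)) Q.OS = 0) : ∃ e : Q.CF ≃ₜ Q.Cf, ∀ μ : Q.CF,
    ((e μ : ProbabilityMeasure (Eucl d)) : Measure (Eucl d)) =
            ((μ : ProbabilityMeasure (Eucl d)) : Measure (Eucl d)).map Q.pi := by
  have hmem : ∀ μ : Q.CF, Q.push μ ∈ Q.Cf := fun μ => by
    obtain ⟨-, ν, hν, e⟩ := Q.CF_sub μ.2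
    rwa [show Q.push μ = ν from Subtype.ext e]
  let p : Q.CF → Q.Cf := fun μ => ⟨Q.push μ, hmem μ⟩
  have hp : Continuous p := (Q.continuous_push.comp continuous_subtype_val).subtype_mk _
  have hb : Function.Bijective p := ⟨fun μ μ' h => Subtype.ext (Q.Cp_inj hn (Q.CF_sub μ.2) (Q.CF_sub μ'.2)
    (congrArg Subtype.val h)), fun ν => by
      obtain ⟨μ, hμ, e⟩ := Q.lift ν.2
      exact ⟨⟨μ, hμ⟩, Subtype.ext e⟩⟩
  haveI : CompactSpace Q.CF := isCompact_iff_compactSpace.1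
    ((Q.clo_compact 0).of_isClosed_subset (isClosed_iInter fun _ => isClosed_closure) (iInter_subset _ 0))
  have hp' : Continuous (Equiv.ofBijective p hb) := hp
  exact ⟨hp'.homeoOfEquivCompactToT2, fun μ => rfl⟩
end TD

open Filter Topology Set MeasureTheory Dynamics
open scoped ENNReal

namespace TD
variable {d : ℕ} (Q : TD d)

lemma Ls_eq (k) : Q.Ls k = unitDisc d ∩ Q.pi ⁻¹' {Q.q k} := by
  ext y
  exact ⟨fun h => ⟨Q.Ls_sub k h, Q.mem_Ls.1 h⟩, fun h => Q.mem_Ls.2 h.2⟩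

lemma S_contOn : ContinuousOn Q.S (range Q.q)ᶜ := by
  intro z hz
  have h := Q.asym_nq (z := z) (fun k hk => hz ⟨k, hk.symm⟩)
  have : Tendsto Q.S (𝓝 z) (comap Q.pi (𝓝 z)) := by
    rw [tendsto_comap_iff]
    exact tendsto_id.congr fun x => (Q.pi_S x).symm
  exact (h.comp this).mono_left nhdsWithin_le_nhds

lemma prop6 {f : Eucl d → Eucl d} (ef : ∀ x ∈ unitDisc d, f x = Q.ft x) (ν : Measure (Eucl d)) (h1 : IsProbabilityMeasure ν)
    (h2 : ν ((Q.K0 \ ⋃ k, frontier (Q.Ls k))ᶜ) = 0) :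
    ∃ A B : Set (Eucl d), MeasurableSet A ∧ MeasurableSet B ∧
          ν A = 1 ∧ (ν.map Q.pi) B = 1 ∧ Set.MapsTo Q.F A A ∧ Set.MapsTo f B B ∧
          Set.BijOn Q.pi A B ∧ (∀ x ∈ A, Q.pi (Q.F x) = f (Q.pi x)) ∧
          Measurable (fun x : A => Q.pi (x : Eucl d)) ∧
          ∃ σ : Eucl d → Eucl d, Set.InvOn σ Q.pi A B ∧
            Measurable (fun y : B => σ (y : Eucl d)) := by
  rw [Q.good_eq] at h2
  have mD : MeasurableSet (unitDisc d) := Metric.isClosed_closedBall.measurableSet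
  have mA : MeasurableSet (unitDisc d \ ⋃ k, Q.Ls k) :=
    mD.diff (MeasurableSet.iUnion fun k => Metric.isClosed_closedBall.measurableSet)
  have mB : MeasurableSet (unitDisc d \ range Q.q) := mD.diff (countable_range _).measurableSet
  have nA : ∀ {y}, y ∈ unitDisc d \ ⋃ k, Q.Ls k → ∀ k, Q.pi y ≠ Q.q k := fun h k hk =>
    h.2 (mem_iUnion.2 ⟨k, Q.mem_Ls.2 hk⟩)
  have mapA : MapsTo Q.pi (unitDisc d \ ⋃ k, Q.Ls k) (unitDisc d \ range Q.q) := fun y hy =>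
    ⟨mem_uD.2 (Q.pi_maps (mem_uD.1 hy.1)), fun ⟨k, hk⟩ => nA hy k hk.symm⟩
  have mapB : MapsTo Q.S (unitDisc d \ range Q.q) (unitDisc d \ ⋃ k, Q.Ls k) := fun x hx =>
    ⟨mem_uD.2 (Q.S_maps (mem_uD.1 hx.1)), fun h => by
      obtain ⟨k, hk⟩ := mem_iUnion.1 h
      have := Q.mem_Ls.1 hk
      rw [Q.pi_S] at this
      exact hx.2 ⟨k, this.symm⟩⟩
  have inv : InvOn Q.S Q.pi (unitDisc d \ ⋃ k, Q.Ls k) (unitDisc d \ range Q.q) :=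
    ⟨fun y hy => ((Q.pi_notQ (nA hy)).1 rfl).symm, fun x _ => Q.pi_S x⟩
  have eA : ν (unitDisc d \ ⋃ k, Q.Ls k) = 1 := by
    rwa [prob_compl_eq_zero_iff mA] at h2
  have mf : MapsTo f (unitDisc d \ range Q.q) (unitDisc d \ range Q.q) := fun x hx => by
    rw [ef x hx.1]
    refine ⟨mem_uD.2 (Q.ft_ext.maps x (mem_uD.1 hx.1)), fun ⟨k, hk⟩ => ?_⟩
    obtain ⟨j, hj⟩ := Q.toKD.preQ x k hk.symm
    exact hx.2 ⟨j, hj.symm⟩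
  refine ⟨_, _, mA, mB, eA, ?_, ?_, mf, inv.bijOn mapA mapB, ?_, Q.pi_meas.comp measurable_subtype_coe,
    Q.S, inv, ?_⟩
  · rw [Measure.map_apply Q.pi_meas mB]
    haveI : IsProbabilityMeasure ν := h1
    exact le_antisymm prob_le_one (eA ▸ measure_mono mapA)
  · intro y hy
    refine ⟨mem_uD.2 (Q.F_maps (mem_uD.1 hy.1)), fun h => ?_⟩
    obtain ⟨k, hk⟩ := mem_iUnion.1 h
    have h3 := Q.mem_Ls.1 hk
    rw [Q.pi_F] at h3
    obtain ⟨j, hj⟩ := Q.toKD.preQ _ k h3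
    exact nA hy j hj
  · intro y hy
    rw [Q.pi_F, ef _ (mapA hy).1]
  · exact (continuousOn_iff_continuous_restrict.1 (Q.S_contOn.mono fun x hx => hx.2)).measurable

lemma Ls_diffeo (k) : ∃ ψ ψ' : Eucl d → Eucl d, ContDiffOn ℝ (⊤ : ℕ∞) ψ (unitDisc d) ∧
        Set.InjOn ψ (unitDisc d) ∧ ψ '' unitDisc d = Q.Ls k ∧
        ContDiffOn ℝ (⊤ : ℕ∞) ψ' (Q.Ls k) ∧ Set.InvOn ψ' ψ (unitDisc d) (Q.Ls k) := by
  refine ⟨Q.W k, Q.W' k, ?_, fun x _ y _ h => by rw [← Q.W'_W k x, h, Q.W'_W], ?_, ?_,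
    fun x _ => Q.W'_W k x, fun x _ => Q.W_W' k x⟩
  · unfold QD.W; fun_prop
  · ext y
    rw [Q.mem_Ls, Q.pi_q']
    exact ⟨by rintro ⟨x, hx, rfl⟩; rw [Q.W'_W]; exact mem_uD.1 hx, fun h => ⟨_, mem_uD.2 h, Q.W_W' k y⟩⟩
  · unfold QD.W'; fun_prop

noncomputable def φ' (m i : ℕ) (y : Eucl d) : Eucl d := (Q.ρ m)⁻¹ • (Q.W' (Q.κ m i) y - Q.e m)
lemma φ'_φ (m i x) : Q.φ' m i (Q.φ m i x) = x := by
  have : Q.ρ m ≠ 0 := (Q.ρ_pos m).ne'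
  rw [φ', φ, Q.W'_W, add_sub_cancel_left, inv_smul_smul₀ this]
lemma φ_φ' (m i y) : Q.φ m i (Q.φ' m i y) = y := by
  have : Q.ρ m ≠ 0 := (Q.ρ_pos m).ne'
  rw [φ', φ, smul_inv_smul₀ this, add_sub_cancel, Q.W_W']
lemma continuous_φ' (m i) : Continuous (Q.φ' m i) :=
  by unfold φ' QD.W'; fun_prop

lemma φ_diffeo (m i) : ContDiffOn ℝ (⊤ : ℕ∞) (Q.φ m i) (unitDisc d) ∧ Set.InjOn (Q.φ m i) (unitDisc d) ∧
    ∃ φ' : Eucl d → Eucl d, ContDiffOn ℝ (⊤ : ℕ∞) φ' (Q.φ m i '' unitDisc d) ∧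
            Set.InvOn φ' (Q.φ m i) (unitDisc d) (Q.φ m i '' unitDisc d) := by
  refine ⟨?_, fun x _ y _ h => by rw [← Q.φ'_φ m i x, h, Q.φ'_φ], Q.φ' m i, ?_, fun x _ => Q.φ'_φ m i x,
    fun x _ => Q.φ_φ' m i x⟩
  · unfold φ QD.W; fun_prop
  · unfold φ' QD.W'; fun_prop
end TD

open Filter Topology Set MeasureTheory Dynamics
open scoped ENNReal

namespace TD
variable {d : ℕ} (Q : TD d)

structure OD where
  xp : ℕ → ℕ → Eucl d
  pp : ℕ → ℕ → ℕ
  hp : ∀ m l, IsPeriodicOrbitPt (Q.χ m) (xp m l) (pp m l)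
  hP : ∀ m l, xp m l ∈ Q.P m
  hlim : ∀ m (ν : ProbabilityMeasure (Eucl d)),
    ν ∈ ⋂ N : ℕ, closure ((fun l => orbitProb (Q.χ m) (xp m l) (pp m l)) '' Set.Ici N) →
    (ν : Measure (Eucl d)) (⋃ l, orbitSet (Q.χ m) (xp m l) (pp m l)) = 0

namespace OD
variable {Q} (O : Q.OD)

lemma itP (m l t) : (Q.χ m)^[t] (O.xp m l) ∈ Q.P m := by
  induction t with
  | zero => exact O.hP m l
  | succ t ih => rw [Function.iterate_succ_apply']; exact Q.P_fwd _ _ ih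
lemma it1 (m l t) : ‖(Q.χ m)^[t] (O.xp m l)‖ < 1 := Q.P_lt _ _ (O.itP m l t)

abbrev J := (p : ℕ × ℕ) × Fin (O.pp p.1 p.2)
noncomputable def x (j : O.J) : Eucl d := (Q.χ j.1.1)^[j.2] (O.xp j.1.1 j.1.2)
noncomputable def Y (j : O.J) : Eucl d := Q.φ j.1.1 0 (O.x j)
lemma x1 (j) : ‖O.x j‖ ≤ 1 := (O.it1 _ _ _).le
lemma Yit (j : O.J) (n) : Q.F^[n] (O.Y j) =
    Q.φ j.1.1 n ((Q.χ j.1.1)^[Q.ξ j.1.1 * (n / Q.per j.1.1)] (O.x j)) := Q.φ_iter (O.x1 j) n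
lemma xper (j : O.J) (a) : (Q.χ j.1.1)^[a * O.pp j.1.1 j.1.2] (O.x j) = O.x j := by
  have h : Function.IsPeriodicPt (Q.χ j.1.1) (O.pp j.1.1 j.1.2) (O.xp j.1.1 j.1.2) := (O.hp j.1.1 j.1.2).2.1
  exact (h.apply_iterate j.2).const_mul a
lemma Yper (j : O.J) : Q.F^[Q.per j.1.1 * O.pp j.1.1 j.1.2] (O.Y j) = O.Y j := by
  rw [Yit, Nat.mul_div_cancel_left _ (Q.per_pos _), O.xper, ← Q.φ_mod, Nat.mul_mod_right, Y]
lemma Npos (j : O.J) : 0 < Q.per j.1.1 * O.pp j.1.1 j.1.2 := Nat.mul_pos (Q.per_pos _) (O.hp _ _).1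
noncomputable def PER (j : O.J) : ℕ := Function.minimalPeriod Q.F (O.Y j)
lemma hY (j) : IsPeriodicOrbitPt Q.F (O.Y j) (O.PER j) := per_of ⟨_, O.Npos j, O.Yper j⟩

lemma orb_eq : (⋃ j, orbitSet Q.F (O.Y j) (O.PER j)) =
    ⋃ m, ⋃ l, ⋃ i ∈ Set.Iio (Q.per m), Q.φ m i '' orbitSet (Q.χ m) (O.xp m l) (O.pp m l) := by
  apply Subset.antisymm
  · refine iUnion_subset fun j => ?_
    rintro _ ⟨n, -, rfl⟩
    refine mem_iUnion.2 ⟨j.1.1, mem_iUnion.2 ⟨j.1.2, mem_iUnion₂.2 ⟨n % Q.per j.1.1, Nat.mod_lt _ (Q.per_pos _), ?_⟩⟩⟩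
    rw [Q.φ_mod]
    show Q.F^[n] (O.Y j) ∈ _
    rw [Yit, x, ← Function.iterate_add_apply]
    exact mem_image_of_mem _ (mem_orbit (O.hp _ _) _)
  · refine iUnion_subset fun m => iUnion_subset fun l => iUnion₂_subset fun i hi => ?_
    rintro _ ⟨_, ⟨t, ht, rfl⟩, rfl⟩
    refine mem_iUnion.2 ⟨⟨(m, l), ⟨t, ht⟩⟩, ?_⟩
    have h := mem_orbit (O.hY ⟨(m, l), ⟨t, ht⟩⟩) i
    rw [Yit, Nat.div_eq_of_lt hi] at h
    exact h

noncomputable def μ (j : O.J) : ProbabilityMeasure (Eucl d) := orbitProb Q.F (O.Y j) (O.PER j)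
noncomputable def μχ (m l : ℕ) : ProbabilityMeasure (Eucl d) := orbitProb (Q.χ m) (O.xp m l) (O.pp m l)
def V (_ : Q.OD) (m i : ℕ) (U : Set (Eucl d)) : Set (Eucl d) := Q.φ' m i ⁻¹' (U ∩ Metric.ball 0 1)

lemma hit {m i U n} {j : O.J} (hi : i < Q.per m) (h : Q.F^[n] (O.Y j) ∈ O.V m i U) : j.1.1 = m ∧
    n % Q.per m = i ∧ (Q.χ j.1.1)^[Q.ξ j.1.1 * (n / Q.per j.1.1)] (O.x j) ∈ U := by
  have h1 : ‖(Q.χ j.1.1)^[Q.ξ j.1.1 * (n / Q.per j.1.1)] (O.x j)‖ ≤ 1 := ((Q.χ_ext _).iter _).maps _ (O.x1 j)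
  have h2 := mem_ball_zero_iff.1 h.2
  have e := Q.φ_φ' m i (Q.F^[n] (O.Y j))
  conv_rhs at e => rw [Yit, ← Q.φ_mod]
  obtain ⟨e1, e2, e3⟩ := Q.φ_cross hi (Nat.mod_lt _ (Q.per_pos _)) h2.le h1 e
  refine ⟨e1.symm, by rw [e1]; exact e2.symm, ?_⟩
  rw [← e3]
  exact h.1

lemma V_open {m i U} (hU : IsOpen U) : IsOpen (O.V m i U) :=
  (hU.inter Metric.isOpen_ball).preimage (Q.continuous_φ' m i)

lemma μ_eq (j : O.J) : (O.μ j : Measure (Eucl d)) = orbitMeasure Q.F (O.Y j) (Q.per j.1.1 * O.pp j.1.1 j.1.2) :=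
  (orb_mul Q.F_meas (O.hY j) (O.Npos j) (O.Yper j)).symm

lemma μχ_eq (j : O.J) : (O.μχ j.1.1 j.1.2 : Measure (Eucl d)) =
    orbitMeasure (Q.χ j.1.1) (O.x j) (Q.ξ j.1.1 * O.pp j.1.1 j.1.2) := by
  haveI := orbitMeasure_isProbability (Q.χ j.1.1) (O.x j) (Q.ξ j.1.1 * O.pp j.1.1 j.1.2)
  refine (orb_unique (Q.χ_ext _).cont.measurable (O.hp _ _) (orb_inv (Q.χ_ext _).cont.measurable
    (Nat.mul_pos (Q.ξ_pos _) (O.hp _ _).1) (O.xper _ _)) (orb_inv_supp fun i => ?_)).symm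
  rw [x, ← Function.iterate_add_apply]
  exact mem_orbit (O.hp _ _) _

lemma count {m i U} {j : O.J} (hi : i < Q.per m) (hU : IsOpen U) : (O.μ j : Measure (Eucl d)) (O.V m i U) ≤
    if j.1.1 = m then Q.ξ m * (O.μχ m j.1.2 : Measure (Eucl d)) U else 0 := by
  rw [μ_eq, orbM_apply _ _ (O.Npos j) (O.V_open hU).measurableSet]
  split_ifs with hm
  · subst hm
    rw [μχ_eq, orbM_apply _ _ (Nat.mul_pos (Q.ξ_pos _) (O.hp _ _).1) hU.measurableSet]
    set P := Q.per j.1.1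
    set p := O.pp j.1.1 j.1.2
    set X := Q.ξ j.1.1
    have hP : 0 < P := Q.per_pos _
    have hX : 0 < X := Q.ξ_pos _
    have hp : 0 < p := (O.hp _ _).1
    have h1 : ∑ n ∈ Finset.range (P * p), (O.V j.1.1 i U).indicator (1 : Eucl d → ℝ≥0∞) (Q.F^[n] (O.Y j)) ≤
        ∑ b ∈ Finset.range (X * p), U.indicator (1 : Eucl d → ℝ≥0∞) ((Q.χ j.1.1)^[b] (O.x j)) := by
      have h2 : ∀ n ∈ Finset.range (P * p), (O.V j.1.1 i U).indicator (1 : Eucl d → ℝ≥0∞) (Q.F^[n] (O.Y j)) ≤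
          if n % P = i then U.indicator (1 : Eucl d → ℝ≥0∞) ((Q.χ j.1.1)^[X * (n / P)] (O.x j)) else 0 := by
        intro n _
        by_cases hn : Q.F^[n] (O.Y j) ∈ O.V j.1.1 i U
        · obtain ⟨-, e2, e3⟩ := O.hit hi hn
          rw [if_pos e2, indicator_of_mem hn, indicator_of_mem e3]
          rfl
        · rw [indicator_of_notMem hn]; exact zero_le
      refine (Finset.sum_le_sum h2).trans ?_
      rw [← Finset.sum_filter]
      have hinj : InjOn (fun n => X * (n / P)) ({n ∈ Finset.range (P * p) | n % P = i} : Finset ℕ) := by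
        intro n hn n' hn' e
        have e1 := (Finset.mem_filter.1 (Finset.mem_coe.1 hn)).2
        have e2 := (Finset.mem_filter.1 (Finset.mem_coe.1 hn')).2
        have e3 := Nat.eq_of_mul_eq_mul_left hX e
        rw [← Nat.div_add_mod n P, ← Nat.div_add_mod n' P, e1, e2, e3]
      rw [← Finset.sum_image (g := fun n => X * (n / P))
        (f := fun b => U.indicator (1 : Eucl d → ℝ≥0∞) ((Q.χ j.1.1)^[b] (O.x j))) hinj]
      refine Finset.sum_le_sum_of_subset fun b hb => ?_
      obtain ⟨n, hn, rfl⟩ := Finset.mem_image.1 hb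
      have := Finset.mem_range.1 (Finset.mem_filter.1 hn).1
      exact Finset.mem_range.2 (Nat.mul_lt_mul_of_pos_left (Nat.div_lt_of_lt_mul this) hX)
    have h3 : ((P * p : ℕ) : ℝ≥0∞)⁻¹ ≤ X * ((X * p : ℕ) : ℝ≥0∞)⁻¹ := by
      have hX0 : (X : ℝ≥0∞) ≠ 0 := by exact_mod_cast hX.ne'
      push_cast
      rw [ENNReal.mul_inv (Or.inl hX0) (Or.inl (ENNReal.natCast_ne_top _)), ← mul_assoc,
        ENNReal.mul_inv_cancel hX0 (ENNReal.natCast_ne_top _), one_mul]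
      refine ENNReal.inv_le_inv.2 ?_
      exact_mod_cast Nat.le_mul_of_pos_left p hP
    calc _ ≤ (X * ((X * p : ℕ) : ℝ≥0∞)⁻¹) * _ := mul_le_mul' h3 h1
      _ = _ := mul_assoc _ _ _
  · rw [Finset.sum_eq_zero, mul_zero]
    intro n _
    exact indicator_of_notMem (fun h => hm (O.hit hi h).1) _

lemma limit (e : ℕ ≃ O.J) (ν : ProbabilityMeasure (Eucl d)) (hν : ν ∈ ⋂ N : ℕ, closure ((fun n => O.μ (e n)) '' Ici N))
    {m i x} (hi : i < Q.per m) (hx : x ∈ ⋃ l, orbitSet (Q.χ m) (O.xp m l) (O.pp m l)) :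
    (ν : Measure (Eucl d)) {Q.φ m i x} = 0 := by
  by_contra hδ
  have hx1 : ‖x‖ < 1 := by
    obtain ⟨l, t, -, rfl⟩ := mem_iUnion.1 hx
    exact O.it1 m l t
  set δ := (ν : Measure (Eucl d)) {Q.φ m i x}
  have hδt : δ ≠ ⊤ := measure_ne_top _ _
  have hξ0 : (Q.ξ m : ℝ≥0∞) ≠ 0 := by exact_mod_cast (Q.ξ_pos m).ne'
  have hξt : (Q.ξ m : ℝ≥0∞) ≠ ⊤ := ENNReal.natCast_ne_top _
  have key : ∀ U, IsOpen U → x ∈ U → ∀ N, ∃ l ≥ N, δ / 2 / Q.ξ m ≤ (O.μχ m l : Measure (Eucl d)) U := by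
    intro U hU hxU N
    have hfin : {n | (e n).1.1 = m ∧ (e n).1.2 < N}.Finite := by
      have h : (⋃ l ∈ Iio N, range fun s : Fin (O.pp m l) => e.symm ⟨(m, l), s⟩).Finite :=
        (finite_Iio N).biUnion fun l _ => finite_range _
      refine h.subset ?_
      rintro n ⟨h1, h2⟩
      obtain ⟨j, rfl⟩ := e.symm.surjective n
      rw [Equiv.apply_symm_apply] at h1 h2
      obtain ⟨⟨m', l⟩, s⟩ := j
      dsimp at h1 h2
      subst h1
      exact mem_iUnion₂.2 ⟨l, h2, s, rfl⟩
    obtain ⟨B, hB⟩ := hfin.bddAbove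
    have hlt : δ / 2 < (ν : Measure (Eucl d)) (O.V m i U) := by
      refine (ENNReal.half_lt_self hδ hδt).trans_le (measure_mono (singleton_subset_iff.2 ?_))
      rw [V, mem_preimage, Q.φ'_φ]
      exact ⟨hxU, mem_ball_zero_iff.2 hx1⟩
    obtain ⟨_, h1, n, hn, rfl⟩ := mem_closure_iff.1 (mem_iInter.1 hν (B + 1)) _ (open_lt (O.V_open hU) _) hlt
    have h2 := lt_of_lt_of_le h1 (O.count hi hU)
    split_ifs at h2 with hm
    · refine ⟨(e n).1.2, ?_, ENNReal.div_le_of_le_mul' h2.le⟩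
      by_contra hc
      have := hB ⟨hm, not_le.1 hc⟩
      have := mem_Ici.1 hn
      omega
    · exact absurd h2 (not_lt.2 (zero_le))
  have hsub : ∀ N, (O.μχ m) '' Ici N ⊆ {μ : ProbabilityMeasure (Eucl d) | (μ : Measure (Eucl d)) (unitDisc d)ᶜ = 0} := by
    rintro N _ ⟨l, -, rfl⟩
    exact orb_inv_supp fun t => mem_uD.2 (O.it1 m l t).le
  set C : ℕ → Set (Eucl d) := fun n => Metric.closedBall x (1 / (n + 1 : ℝ))
  have hC : Antitone C := fun n n' h => Metric.closedBall_subset_closedBall (Nat.one_div_le_one_div h)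
  have hcc : ∀ n, IsCompact (closure ((O.μχ m) '' Ici n)) := fun n =>
    (MD_compact (isCompact_closedBall _ _)).closure_of_subset (hsub n)
  obtain ⟨ν0, h0⟩ := IsCompact.nonempty_iInter_of_directed_nonempty_isCompact_isClosed
    (fun n => closure ((O.μχ m) '' Ici n) ∩ {μ : ProbabilityMeasure (Eucl d) | δ / 2 / Q.ξ m ≤ (μ : Measure (Eucl d)) (C n)})
    (Antitone.directed_ge fun n n' h => inter_subset_inter (closure_mono (image_mono (Ici_subset_Ici.2 h)))
      fun μ hμ => le_trans hμ (measure_mono (hC h)))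
    (fun n => by
      obtain ⟨l, hl, h⟩ := key (Metric.ball x (1 / (n + 1 : ℝ))) Metric.isOpen_ball
        (Metric.mem_ball_self Nat.one_div_pos_of_nat) n
      exact ⟨_, subset_closure ⟨l, hl, rfl⟩, h.trans (measure_mono Metric.ball_subset_closedBall)⟩)
    (fun n => (hcc n).inter_right (closed_le Metric.isClosed_closedBall _))
    (fun n => isClosed_closure.inter (closed_le Metric.isClosed_closedBall _))
  have h0 := mem_iInter.1 h0
  have hz := O.hlim m ν0 (mem_iInter.2 fun n => (h0 n).1)
  have hz : (ν0 : Measure (Eucl d)) {x} = 0 := measure_mono_null (singleton_subset_iff.2 hx) hz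
  have hI : ⋂ n, C n = {x} := by
    ext z
    simp only [C, mem_iInter, Metric.mem_closedBall, mem_singleton_iff]
    refine ⟨fun h => dist_le_zero.1 (ge_of_tendsto' tendsto_one_div_add_atTop_nhds_zero_nat h), ?_⟩
    rintro rfl n
    rw [dist_self]
    exact Nat.one_div_pos_of_nat.le
  have ht := tendsto_measure_iInter_atTop (μ := (ν0 : Measure (Eucl d))) (s := C)
    (fun n : ℕ => (Metric.isClosed_closedBall (x := x) (ε := 1 / (n + 1 : ℝ))).measurableSet.nullMeasurableSet) hC
    ⟨0, measure_ne_top _ _⟩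
  rw [hI, hz] at ht
  have := ge_of_tendsto' ht fun n => (h0 n).2
  have := ENNReal.div_ne_zero.2 ⟨(ENNReal.half_pos hδ).ne', hξt⟩
  exact this (le_antisymm (by assumption) (zero_le))

def U : Set (Eucl d) := ⋃ m, ⋃ l, ⋃ i ∈ Set.Iio (Q.per m), Q.φ m i '' orbitSet (Q.χ m) (O.xp m l) (O.pp m l)
lemma U_countable : O.U.Countable := countable_iUnion fun m => countable_iUnion fun l =>
  (to_countable _).biUnion fun i _ => (((finite_Iio _).image _).image _).countable
lemma U_diff {y n} (h : Q.F^[n] y ∈ O.U) :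
    (∃ k w, ‖w‖ < 1 ∧ Q.W k w = y) ∧ ∃ A', InvD d A' ∧ HasFDerivAt Q.F A' y := by
  obtain ⟨m, h⟩ := mem_iUnion.1 h
  obtain ⟨l, h⟩ := mem_iUnion.1 h
  obtain ⟨i, hi, _, ⟨t, -, rfl⟩, e⟩ := mem_iUnion₂.1 h
  exact Q.F_diff hi (O.itP m l t) e.symm

lemma Z_countable (n) : {y | Q.F^[n] y ∈ O.U}.Countable := by
  induction n with
  | zero => exact O.U_countable
  | succ n ih =>
    have : {y | Q.F^[n + 1] y ∈ O.U} = ⋃ z ∈ {y | Q.F^[n] y ∈ O.U}, {y | Q.F y = z} := by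
      ext y
      simp [Function.iterate_succ_apply]
    rw [this]
    refine ih.biUnion fun z hz => ?_
    obtain ⟨t, -, ht, hs⟩ := TopologicalSpace.countable_cover_nhdsWithin (s := {y | Q.F y = z}) (f := fun y => {y}) (by
      intro y hy
      obtain ⟨-, A, ⟨⟨B, -, hB⟩, -⟩, hA⟩ := O.U_diff (y := y) (n := n + 1) (by
        rw [Function.iterate_succ_apply, show Q.F y = z from hy]; exact hz)
      have := hA.eventually_ne (c := z) ⟨_, B.lipschitz.to_rightInverse (g := A) fun v =>
        congrArg (fun T : Eucl d →L[ℝ] Eucl d => T v) hB⟩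
      rw [eventually_nhdsWithin_iff] at this
      rw [mem_nhdsWithin_iff_eventually]
      filter_upwards [this] with v hv hv'
      by_contra hc
      exact hv hc hv')
    exact ht.mono (hs.trans (by simp))

lemma ready : ∃ (Y : ℕ → Eucl d) (PER : ℕ → ℕ), ReadyForOperation d Q.F Y PER ∧
        (⋃ j, orbitSet Q.F (Y j) (PER j)) = O.U := by
  haveI : ∀ m l, NeZero (O.pp m l) := fun m l => ⟨(O.hp m l).1.ne'⟩
  haveI : Infinite O.J := Infinite.of_injective (fun n : ℕ => (⟨(n, 0), 0⟩ : O.J)) fun a b h => by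
    have := congrArg (fun j : O.J => j.1.1) h
    exact this
  obtain ⟨e⟩ : Nonempty (ℕ ≃ O.J) := nonempty_equiv_of_countable
  have hU : (⋃ n, orbitSet Q.F (O.Y (e n)) (O.PER (e n))) = O.U := by
    rw [U, ← orb_eq]
    exact e.surjective.iUnion_comp (g := fun j => orbitSet Q.F (O.Y j) (O.PER j))
  refine ⟨fun n => O.Y (e n), fun n => O.PER (e n), ⟨fun n => O.hY _, fun ν hν => ?_, ?_, ?_, ?_⟩, hU⟩
  · rw [hU, U]
    refine measure_iUnion_null fun m => measure_iUnion_null fun l => ?_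
    refine (measure_biUnion_null_iff (to_countable _)).2 fun i hi => ?_
    rw [← biUnion_of_singleton (Q.φ m i '' _)]
    refine (measure_biUnion_null_iff (((finite_Iio _).image _).image _).countable).2 ?_
    rintro _ ⟨x, hx, rfl⟩
    exact O.limit e ν hν hi (mem_iUnion.2 ⟨l, hx⟩)
  · rw [hU]
    exact (countable_iUnion fun n => O.Z_countable n).mono fun y ⟨n, hn⟩ => mem_iUnion.2 ⟨n, hn⟩
  · rw [hU]
    rintro y ⟨n, hn⟩
    obtain ⟨⟨k, w, hw, rfl⟩, -⟩ := O.U_diff hn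
    exact mem_iD.2 (Q.W_lt hw.le)
  · rw [hU]
    rintro y ⟨n, hn⟩
    obtain ⟨-, A, ⟨h1, h2⟩, hA⟩ := O.U_diff hn
    exact ⟨A, hA, h1, h2⟩
end OD
end TD

open Filter Topology Set MeasureTheory Dynamics
open scoped ENNReal

lemma MemCd.it {d : ℕ} {T : Eucl d → Eucl d} (h : MemCd d T) {x} (hx : ‖x‖ ≤ 1) (n) : (ext1 T)^[n] x = T^[n] x := by
  have : T^[n] x ∈ unitDisc d ∧ (ext1 T)^[n] x = T^[n] x := by
    induction n with
    | zero => exact ⟨mem_uD.2 hx, rfl⟩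
    | succ n ih =>
      rw [Function.iterate_succ_apply', Function.iterate_succ_apply', ih.2]
      exact ⟨h.mapsTo ih.1, ext1_eq ih.1⟩
  exact this.2
lemma MemCd.oS {d : ℕ} {T : Eucl d → Eucl d} (h : MemCd d T) {x} (hx : ‖x‖ ≤ 1) (n) :
    orbitSet (ext1 T) x n = orbitSet T x n := image_congr fun i _ => h.it hx i
lemma MemCd.oP {d : ℕ} {T : Eucl d → Eucl d} (h : MemCd d T) {x} (hx : ‖x‖ ≤ 1) (n) :
    orbitProb (ext1 T) x n = orbitProb T x n := by
  apply Subtype.ext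
  show orbitMeasure _ _ _ = orbitMeasure _ _ _
  unfold orbitMeasure
  simp only [h.it hx]

open MeasureTheory in
/-- **The blow-and-sew construction** (Proposition `BlowAndSewProp`): given `f ∈ 𝒞_d`
ready for operation on a sequence of periodic orbits `θ_m` (given by periodic points
`xper m` of minimal period `per m`), maps `χ_m ∈ 𝒞_d` each ready for operation on
sequences of periodic orbits `θ^m_ℓ`, tower heights `1 ≤ ξ_m ≤ |θ_m|` with
`sup_m (ξ_m/|θ_m|)·h_top(χ_m) < ∞`, and an enumeration `q` of the complete preimage `Q`
of `∪_m θ_m`, there exist `F`, a factor map `π : (𝔻,F) → (𝔻,f)`, pairwise disjoint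
compact invariant sets `K_i`, blown-up discs `L_k = π⁻¹({q_k})`, and `C^∞` conjugacies
`φ_m` between `F|_{K_m}` and the `(|θ_m|,ξ_m)` tower over `χ_m`, satisfying properties
(1)–(9) of the proposition and the entropy formula. -/
theorem blow_and_sew (d : ℕ) (hd : d = 1 ∨ d = 2)
    (f : Eucl d → Eucl d) (hf : MemCd d f)
    (xper : ℕ → Eucl d) (per : ℕ → ℕ) (hready : ReadyForOperation d f xper per)
    (χ : ℕ → Eucl d → Eucl d) (hχ : ∀ m, MemCd d (χ m))
    (xperχ : ℕ → ℕ → Eucl d) (perχ : ℕ → ℕ → ℕ)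
    (hreadyχ : ∀ m, ReadyForOperation d (χ m) (xperχ m) (perχ m))
    (ξ : ℕ → ℕ) (hξ : ∀ m, 1 ≤ ξ m ∧ ξ m ≤ per m)
    (hsup : (⨆ m, (((ξ m : ℝ) / (per m : ℝ) : ℝ) : EReal) *
      coverEntropy (χ m) (unitDisc d)) < ⊤)
    (q : ℕ → Eucl d) (hqinj : Function.Injective q)
    (hqrange : Set.range q = preimageSat f (⋃ m, orbitSet f (xper m) (per m))) :
    ∃ (F π : Eucl d → Eucl d) (K : ℕ → Set (Eucl d)) (L : ℕ → Set (Eucl d))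
      (φ : ℕ → ℕ → Eucl d → Eucl d),
      -- L k = π⁻¹({q_k}) (inside 𝔻)
      (∀ k, L k = unitDisc d ∩ π ⁻¹' {q k}) ∧
      (∀ i, IsCompact (K i)) ∧ Pairwise (Function.onFun Disjoint K) ∧
      -- (1) F ∈ 𝒞_d
      MemCd d F ∧
      -- (2) π is a factor map from (𝔻,F) to (𝔻,f)
      ContinuousOn π (unitDisc d) ∧ Set.MapsTo π (unitDisc d) (unitDisc d) ∧
      π '' unitDisc d = unitDisc d ∧ (∀ x ∈ unitDisc d, π (F x) = f (π x)) ∧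
      -- (3) π(K_m) = θ_m, each L_k is C^∞ diffeomorphic to 𝔻, π is injective off the
      -- L_k, and K_m lies in the interiors of the L_k over θ_m
      (∀ m, π '' K (m + 1) = orbitSet f (xper m) (per m)) ∧
      (∀ k, ∃ ψ ψ' : Eucl d → Eucl d, ContDiffOn ℝ (⊤ : ℕ∞) ψ (unitDisc d) ∧
        Set.InjOn ψ (unitDisc d) ∧ ψ '' unitDisc d = L k ∧
        ContDiffOn ℝ (⊤ : ℕ∞) ψ' (L k) ∧ Set.InvOn ψ' ψ (unitDisc d) (L k)) ∧
      Set.InjOn π (unitDisc d \ ⋃ k, L k) ∧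
      (∀ m, K (m + 1) ⊆
        ⋃ k ∈ {k | q k ∈ orbitSet f (xper m) (per m)}, interior (L k)) ∧
      -- (4) each K_i is F-invariant, K_0 = 𝔻 ∖ ∪_k int(L_k), ∪_k ∂L_k is F-invariant
      (∀ i, F '' K i = K i) ∧
      K 0 = unitDisc d \ (⋃ k, interior (L k)) ∧
      Set.MapsTo F (⋃ k, frontier (L k)) (⋃ k, frontier (L k)) ∧
      -- (5) NW(F) ⊆ ∪_i K_i
      nonwanderingOn F (unitDisc d) ⊆ (⋃ i, K i) ∧
      -- (6) for ν ∈ M(K_0 ∖ ∪_k ∂L_k, F), π is a measure-theoretic isomorphism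
      -- between (F,ν) and (f,π_*ν)
      (∀ ν : Measure (Eucl d), IsProbabilityMeasure ν → ν.map F = ν →
        ν ((K 0 \ ⋃ k, frontier (L k))ᶜ) = 0 →
        ∃ A B : Set (Eucl d), MeasurableSet A ∧ MeasurableSet B ∧
          ν A = 1 ∧ (ν.map π) B = 1 ∧ Set.MapsTo F A A ∧ Set.MapsTo f B B ∧
          Set.BijOn π A B ∧ (∀ x ∈ A, π (F x) = f (π x)) ∧
          Measurable (fun x : A => π (x : Eucl d)) ∧
          ∃ σ : Eucl d → Eucl d, Set.InvOn σ π A B ∧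
            Measurable (fun y : B => σ (y : Eucl d))) ∧
      -- (7) φ_m is a C^∞ conjugacy between F|_{K_m} and the (|θ_m|,ξ_m) tower over χ_m
      (∀ m,
        (∀ i, ContDiffOn ℝ (⊤ : ℕ∞) (φ m i) (unitDisc d) ∧
          Set.InjOn (φ m i) (unitDisc d) ∧
          ∃ φ' : Eucl d → Eucl d, ContDiffOn ℝ (⊤ : ℕ∞) φ' (φ m i '' unitDisc d) ∧
            Set.InvOn φ' (φ m i) (unitDisc d) (φ m i '' unitDisc d)) ∧
        (∀ i j, i < per m → j < per m → i ≠ j →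
          Disjoint (φ m i '' unitDisc d) (φ m j '' unitDisc d)) ∧
        K (m + 1) = (⋃ i ∈ Set.Iio (per m), φ m i '' unitDisc d) ∧
        (∀ i, i + 1 < per m → ∀ x ∈ unitDisc d, F (φ m i x) = φ m (i + 1) x) ∧
        (∀ x ∈ unitDisc d, F (φ m (per m - 1) x) = φ m 0 ((χ m)^[ξ m] x))) ∧
      -- (8) ∩_n closure(∪_{m≥n} M(K_m,F)) is the π_*-preimage of
      -- ∩_n closure({μ_{θ_m} : m ≥ n}), lies in M(K_0 ∖ ∪_k ∂L_k, F), and π_* maps it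
      -- homeomorphically onto ∩_n closure({μ_{θ_m} : m ≥ n})
      (∃ CF Cf : Set (ProbabilityMeasure (Eucl d)),
        Cf = (⋂ N : ℕ, closure ((fun m => orbitProb f (xper m) (per m)) '' Set.Ici N)) ∧
        CF = (⋂ N : ℕ, closure (⋃ m ∈ Set.Ici N,
          {μ : ProbabilityMeasure (Eucl d) |
            (μ : Measure (Eucl d)).map F = (μ : Measure (Eucl d)) ∧
            (μ : Measure (Eucl d)) (K (m + 1))ᶜ = 0})) ∧
        CF = {μ : ProbabilityMeasure (Eucl d) |
          ((μ : Measure (Eucl d)).map F = (μ : Measure (Eucl d)) ∧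
            (μ : Measure (Eucl d)) (unitDisc d)ᶜ = 0) ∧
          ∃ ν' ∈ Cf, (μ : Measure (Eucl d)).map π =
            ((ν' : ProbabilityMeasure (Eucl d)) : Measure (Eucl d))} ∧
        (∀ μ ∈ CF, (μ : Measure (Eucl d)) ((K 0 \ ⋃ k, frontier (L k))ᶜ) = 0) ∧
        (∃ e : CF ≃ₜ Cf, ∀ μ : CF,
          ((e μ : ProbabilityMeasure (Eucl d)) : Measure (Eucl d)) =
            ((μ : ProbabilityMeasure (Eucl d)) : Measure (Eucl d)).map π)) ∧
      -- (9) F is ready for operation on ∪_{m,ℓ} φ_m(θ^m_ℓ × {0,…,|θ_m|−1})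
      (∃ (Y : ℕ → Eucl d) (PER : ℕ → ℕ), ReadyForOperation d F Y PER ∧
        (⋃ j, orbitSet F (Y j) (PER j)) =
          ⋃ m, ⋃ ℓ, ⋃ i ∈ Set.Iio (per m),
            φ m i '' orbitSet (χ m) (xperχ m ℓ) (perχ m ℓ)) ∧
      -- (10) h_top(F) = max(h_top(f), sup_m (ξ_m/|θ_m|)·h_top(χ_m))
      coverEntropy F (unitDisc d) =
        max (coverEntropy f (unitDisc d))
          (⨆ m, (((ξ m : ℝ) / (per m : ℝ) : ℝ) : EReal) *
            coverEntropy (χ m) (unitDisc d)) := by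
  have hx1 : ∀ m, ‖xper m‖ ≤ 1 := fun m => (mem_iD.1 (hready.subset_int (sat_orb hready.periodic m 0))).le
  have hxχ : ∀ m l, ‖xperχ m l‖ ≤ 1 := fun m l =>
    (mem_iD.1 ((hreadyχ m).subset_int (sat_orb (hreadyχ m).periodic l 0))).le
  obtain ⟨Q, eq, ef, ep, eξ, eχ, eP, eκ⟩ := exists_KD d hd f hf xper per hready χ hχ xperχ perχ hreadyχ ξ hξ q hqinj hqrange
  obtain ⟨T, rfl⟩ := Q.exists_TD
  subst eq ep eξ
  have e0 : ∀ m, T.q (T.κ m 0) = xper m := fun m => eκ m 0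
  have eθ : ∀ m, T.θ m = orbitProb f (xper m) (T.per m) := fun m => by
    rw [TD.θ, e0]
    show orbitProb T.toKD.ft _ _ = _
    rw [ef, hf.oP (hx1 m)]
  have eCf : T.Cf = ⋂ N : ℕ, closure ((fun m => orbitProb f (xper m) (T.per m)) '' Set.Ici N) := by
    rw [TD.Cf, show T.θ = _ from funext eθ]
  have eO : ∀ m, orbitSet T.ft (T.q (T.κ m 0)) (T.per m) = orbitSet f (xper m) (T.per m) := fun m => by
    rw [e0]
    show orbitSet T.toKD.ft _ _ = _
    rw [ef, hf.oS (hx1 m)]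
  have hn : ∀ ν ∈ T.Cf, (ν : Measure (Eucl d)) T.OS = 0 := fun ν hν => by
    rw [TD.OS]
    simp only [eO]
    exact hready.limit_null ν (eCf ▸ hν)
  have eft : ∀ x ∈ unitDisc d, f x = T.ft x := fun x hx => by
    show _ = T.toKD.ft x
    rw [ef, ext1_eq hx]
  have eχm : ∀ m, T.χ m = ext1 (χ m) := fun m => congrFun eχ m
  have hent := T.entropy hf hχ ef eχ
  have hO : ∃ O : T.OD, O.xp = xperχ ∧ O.pp = perχ := by
    refine ⟨⟨xperχ, perχ, fun m l => ?_, fun m l => ?_, fun m ν hν => ?_⟩, rfl, rfl⟩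
    · rw [eχm]
      obtain ⟨h1, h2, h3⟩ := (hreadyχ m).periodic l
      exact ⟨h1, by rw [(hχ m).it (hxχ m l), h2], fun j hj hj' => by rw [(hχ m).it (hxχ m l)]; exact h3 j hj hj'⟩
    · rw [eP]
      exact sat_orb (hreadyχ m).periodic l 0
    · simp only [eχm, (hχ m).oP (hxχ m _), (hχ m).oS (hxχ m _)] at hν ⊢
      exact (hreadyχ m).limit_null ν hν
  obtain ⟨O, eO1, eO2⟩ := hO
  have hK : ∀ i, (fun i => Nat.casesOn i T.K0 T.Ks : ℕ → Set (Eucl d)) (i + 1) = T.Ks i := fun _ => rfl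
  have qmem : ∀ m i, T.q (T.κ m i) ∈ orbitSet f (xper m) (T.per m) := fun m i => by
    rw [eκ]; exact mem_orbit (hready.periodic m) i
  refine ⟨T.F, T.pi, fun i => Nat.casesOn i T.K0 T.Ks, T.Ls, T.φ, T.Ls_eq, ?_, ?_, ?_, T.continuous_pi.continuousOn,
    fun y hy => mem_uD.2 (T.pi_maps (mem_uD.1 hy)), ?_, ?_, ?_, T.Ls_diffeo, ?_, ?_, ?_, T.K0_eq, ?_, ?_,
    fun ν h1 _ h2 => T.prop6 eft ν h1 h2, fun m => ⟨T.φ_diffeo m, ?_, rfl, ?_, ?_⟩, ?_, ?_, hent⟩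
  · rintro (_ | m)
    · exact T.K0_compact
    · exact T.Ks_compact m
  · rintro (_ | m) (_ | m') h
    · exact absurd rfl h
    · exact T.K0_disj m'
    · exact (T.K0_disj m).symm
    · exact T.Ks_disj fun e => h (by rw [e])
  · refine ⟨fun y hy => mem_uD.2 (T.F_maps (mem_uD.1 hy)), T.continuous_F.continuousOn, ?_, fun h2 => ?_, fun y hy => ?_, ?_⟩
    · apply Subset.antisymm
      · rintro _ ⟨y, hy, rfl⟩
        exact mem_uD.2 (T.F_maps (mem_uD.1 hy))
      · intro y hy
        obtain ⟨z, hz, e⟩ := T.F_surj (mem_uD.1 hy)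
        exact ⟨z, mem_uD.2 hz, e⟩
    · exact (T.toBD.F_inj (T.ft_ext.inj h2) (T.g_inj h2)).injOn
    · exact T.F_far (mem_sphere_zero_iff_norm.1 hy).ge
    · rw [hent]
      exact max_lt hf.entropy_lt_top hsup
  · apply Subset.antisymm
    · rintro _ ⟨y, hy, rfl⟩
      exact mem_uD.2 (T.pi_maps (mem_uD.1 hy))
    · intro x hx
      exact ⟨T.S x, mem_uD.2 (T.S_maps (mem_uD.1 hx)), T.pi_S x⟩
  · intro y hy
    rw [T.pi_F, eft _ (mem_uD.2 (T.pi_maps (mem_uD.1 hy)))]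
  · intro m
    apply Subset.antisymm
    · rintro _ ⟨y, hy, rfl⟩
      obtain ⟨i, hi, x, hx, rfl⟩ := T.mem_Ks.1 hy
      rw [T.pi_φ hx]
      exact qmem m i
    · rintro _ ⟨i, hi, rfl⟩
      have h0 : ‖(0 : Eucl d)‖ ≤ 1 := by simp
      exact ⟨T.φ m i 0, T.mem_Ks.2 ⟨i, hi, 0, h0, rfl⟩, by rw [T.pi_φ h0]; exact eκ m i⟩
  · intro y hy y' hy' h
    have hk : ∀ k, T.pi y ≠ T.q k := fun k hk => hy.2 (mem_iUnion.2 ⟨k, T.mem_Ls.2 hk⟩)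
    rw [(T.pi_notQ hk).1 rfl, (T.pi_notQ hk).1 h.symm]
  · intro m y hy
    obtain ⟨i, hi, x, hx, rfl⟩ := T.mem_Ks.1 hy
    exact mem_iUnion₂.2 ⟨T.κ m i, qmem m i, T.φ_int hx⟩
  · rintro (_ | m)
    · exact T.F_K0
    · exact T.F_Ks m
  · intro y hy
    obtain ⟨k, hk⟩ := mem_iUnion.1 hy
    exact mem_iUnion.2 ⟨T.nx k, T.mem_fr.2 (T.fr_maps (T.mem_fr.1 hk))⟩
  · rintro y ⟨hy, hw⟩
    by_contra hc
    obtain ⟨U, hU, hyU, h⟩ := T.NW (mem_uD.1 hy) (fun h => hc (mem_iUnion.2 ⟨0, h⟩))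
      (fun m h => hc (mem_iUnion.2 ⟨m + 1, h⟩))
    obtain ⟨n, hn, z, hz, hz'⟩ := hw U hU hyU
    exact h n hn z hz.1 hz'.1
  · intro i j hi hj hij
    rw [Set.disjoint_left]
    rintro _ ⟨x, hx, rfl⟩ ⟨x', hx', e⟩
    exact hij (T.φ_cross hj hi (mem_uD.1 hx') (mem_uD.1 hx) e).2.1.symm
  · intro i hi x hx
    exact T.F_mid hi (mem_uD.1 hx)
  · intro x hx
    rw [T.F_last (mem_uD.1 hx), eχm, (hχ m).it (mem_uD.1 hx)]
  · refine ⟨T.CF, T.Cf, eCf, rfl, T.CF_eq hn, fun μ hμ => T.Cp_good hn (T.CF_sub hμ), T.homeo hn⟩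
  · obtain ⟨Y, PER, h1, h2⟩ := O.ready
    refine ⟨Y, PER, h1, h2.trans ?_⟩
    rw [TD.OD.U, eO1, eO2]
    simp only [eχm, (hχ _).oS (hxχ _ _)]
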